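/- arXiv:astro-ph/0501541 — 2 statements merged into one kernel-verified Lean document; each statement's English description precedes it below -/
import Mathlib

section
/- Let M > 0. The energy-Casimir functional H_C = E_kin + E_pot + C is bounded from below on the constraint set F_M, and its infimum h_M = inf_{F_M} H_C satisfies -∞ < h_M < 0. -/
open MeasureTheory Filter Topology Set ENNReal

noncomputable section

/-- Physical space `ℝ³`. -/
abbrev R3 : Type := EuclideanSpace ℝ (Fin 3)

/-- Spatial density `ρ_f(x) = ∫ f(x,v) dv` induced by a phase-space density. -/
def spatialDensity (f : R3 × R3 → ℝ) (x : R3) : ℝ := ∫ v, f (x, v)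

/-- Kinetic energy `E_kin(f) = (1/2)∫∫ |v|² f dv dx`. -/
def Ekin (f : R3 × R3 → ℝ) : ℝ := (1/2) * ∫ p : R3 × R3, ‖p.2‖ ^ 2 * f p

/-- `D(σ) = ∫∫ σ(x)σ(y)/|x-y| dx dy`. -/
def Dpair (σ : R3 → ℝ) : ℝ := ∫ x, ∫ y, σ x * σ y / ‖x - y‖

/-- Potential energy `E_pot(ρ) = -(1/2)∫∫ ρ(x)ρ(y)/|x-y| dx dy`. -/
def Epot (ρ : R3 → ℝ) : ℝ := -(1/2) * Dpair ρ

/-- Casimir functional `C(f) = ∫∫ Φ(f) dv dx`. -/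
def Casimir (Φ : ℝ → ℝ) (f : R3 × R3 → ℝ) : ℝ := ∫ p, Φ (f p)

/-- Energy-Casimir functional `H_C = E_kin + E_pot + C`. -/
def HC (Φ : ℝ → ℝ) (f : R3 × R3 → ℝ) : ℝ :=
  Ekin f + Epot (spatialDensity f) + Casimir Φ f

/-- Membership in the constraint set `F_M`. -/
structure MemFM (Φ : ℝ → ℝ) (M : ℝ) (f : R3 × R3 → ℝ) : Prop where
  nonneg : ∀ p, 0 ≤ f p
  integrable : Integrable f
  mass : (∫ p, f p) = M
  kin_int : Integrable (fun p : R3 × R3 => ‖p.2‖ ^ 2 * f p)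
  cas_int : Integrable (fun p => Φ (f p))

/-- The constraint set `F_M`. -/
def FMset (Φ : ℝ → ℝ) (M : ℝ) : Set ((R3 × R3) → ℝ) := {f | MemFM Φ M f}

/-- Hypotheses (Φ1)-(Φ3) on the Casimir function `Φ`, with derivative `Φ'`
and growth exponents `k`, `k'`. -/
structure IsPhi (Φ Φ' : ℝ → ℝ) (k k' : ℝ) : Prop where
  zero : Φ 0 = 0
  deriv_zero : Φ' 0 = 0
  hasDeriv : ∀ s ∈ Ici (0:ℝ), HasDerivAt Φ (Φ' s) s
  derivCont : ContinuousOn Φ' (Ici 0)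
  nonneg : ∀ s ∈ Ici (0:ℝ), 0 ≤ Φ s
  sconvex : StrictConvexOn ℝ (Ici 0) Φ
  k_pos : 0 < k
  k_lt : k < 3/2
  k'_pos : 0 < k'
  k'_lt : k' < 3/2
  growth_large : ∃ C > 0, ∃ F₁ > 0, ∀ s, F₁ ≤ s → C * s ^ (1 + 1/k) ≤ Φ s
  growth_small : ∃ C > 0, ∃ F₂ > 0, ∀ s, 0 ≤ s → s ≤ F₂ → Φ s ≤ C * s ^ (1 + 1/k')

/-- Potential `U_ρ(x) = -∫ ρ(y)/|x-y| dy` induced by a spatial density. -/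
def U0rho (ρ : R3 → ℝ) (x : R3) : ℝ := -∫ y, ρ y / ‖x - y‖

/-- Particle energy `E(x,v) = (1/2)|v|² + U₀(x)` for the state `f₀`. -/
def Epart (f₀ : R3 × R3 → ℝ) (p : R3 × R3) : ℝ :=
  (1/2) * ‖p.2‖ ^ 2 + U0rho (spatialDensity f₀) p.1

/-- Reduced density function `Ψ(s)`, obtained from `Φ` by minimizing the sum of kinetic
energy density and Casimir density over all velocity profiles of total mass `s`. -/
def PsiOf (Φ : ℝ → ℝ) (s : ℝ) : ℝ :=
  sInf { r : ℝ | ∃ g : R3 → ℝ, (∀ v, 0 ≤ g v) ∧ Integrable g ∧ (∫ v, g v) = s ∧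
    Integrable (fun v => (1/2) * ‖v‖ ^ 2 * g v + Φ (g v)) ∧
    r = ∫ v, ((1/2) * ‖v‖ ^ 2 * g v + Φ (g v)) }

/-- Reduced functional `H_r(ρ) = ∫ Ψ(ρ) dx + E_pot(ρ)`. -/
def Hr (Ψ : ℝ → ℝ) (ρ : R3 → ℝ) : ℝ := (∫ x, Ψ (ρ x)) + Epot ρ

/-- Membership in the reduced constraint set `R_M`. -/
structure MemRM (Ψ : ℝ → ℝ) (M : ℝ) (ρ : R3 → ℝ) : Prop where
  nonneg : ∀ x, 0 ≤ ρ x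
  integrable : Integrable ρ
  mass : (∫ x, ρ x) = M
  psi_int : Integrable (fun x => Ψ (ρ x))

/-- The reduced constraint set `R_M`. -/
def RMset (Ψ : ℝ → ℝ) (M : ℝ) : Set (R3 → ℝ) := {ρ | MemRM Ψ M ρ}

/-- Hypotheses (Ψ1)-(Ψ3) on `Ψ`, with derivative `Ψ'` and growth exponents `n`, `n'`. -/
structure IsPsi (Ψ Ψ' : ℝ → ℝ) (n n' : ℝ) : Prop where
  zero : Ψ 0 = 0
  deriv_zero : Ψ' 0 = 0
  hasDeriv : ∀ s ∈ Ici (0:ℝ), HasDerivAt Ψ (Ψ' s) s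
  derivCont : ContinuousOn Ψ' (Ici 0)
  nonneg : ∀ s ∈ Ici (0:ℝ), 0 ≤ Ψ s
  sconvex : StrictConvexOn ℝ (Ici 0) Ψ
  n_pos : 0 < n
  n_lt : n < 3
  n'_pos : 0 < n'
  n'_lt : n' < 3
  growth_large : ∃ C > 0, ∃ s₁ > 0, ∀ s, s₁ ≤ s → C * s ^ (1 + 1/n) ≤ Ψ s
  growth_small : ∃ C > 0, ∃ s₂ > 0, ∀ s, 0 ≤ s → s ≤ s₂ → Ψ s ≤ C * s ^ (1 + 1/n')

/-- Relative "distance" `d(f,f₀) = ∫∫ [Φ(f) - Φ(f₀) + E (f - f₀)] dv dx`. -/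
def dVP (Φ : ℝ → ℝ) (f₀ f : R3 × R3 → ℝ) : ℝ :=
  ∫ p, (Φ (f p) - Φ (f₀ p) + Epart f₀ p * (f p - f₀ p))

/-- truncated Newton kernel -/
def newtK (R : ℝ) (s : ℝ) : ℝ := (Iio R).indicator (fun y => y⁻¹) s

lemma newtK_nonneg (R s : ℝ) (hs : 0 ≤ s) : 0 ≤ newtK R s := by
  unfold newtK indicator
  split_ifs
  · exact inv_nonneg.2 hs
  · exact le_rfl

lemma newtK_ball (R : ℝ) (hR : 0 < R) :
    ∫⁻ z : R3, ENNReal.ofReal (newtK R ‖z‖) =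
      ENNReal.ofReal ((3/2) * (volume : Measure R3).real (Metric.ball 0 1) * R^2) := by
  have hdim : Module.finrank ℝ R3 = 3 := by simp
  have heq : EqOn (fun y : ℝ => y ^ (Module.finrank ℝ R3 - 1) • newtK R y)
      ((Iio R).indicator (fun y => y)) (Ioi 0) := by
    intro y hy
    have hy' : (0:ℝ) < y := hy
    by_cases h : y < R
    · simp only [hdim, newtK, smul_eq_mul, indicator, mem_Iio, h, if_true]
      field_simp
    · simp [newtK, indicator, h]
  have hii : IntegrableOn ((Iio R).indicator (fun y : ℝ => y)) (Ioi 0) := by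
    rw [IntegrableOn, integrable_indicator_iff measurableSet_Iio, IntegrableOn,
      Measure.restrict_restrict measurableSet_Iio, Iio_inter_Ioi]
    have : IntegrableOn (fun y : ℝ => y) (Icc 0 R) := continuous_id.integrableOn_Icc
    exact this.mono_set Ioo_subset_Icc_self
  have hint : Integrable (fun z : R3 => newtK R ‖z‖) := by
    rw [integrable_fun_norm_addHaar volume (f := newtK R)]
    exact (integrableOn_congr_fun heq measurableSet_Ioi).2 hii
  rw [← ofReal_integral_eq_lintegral_ofReal hint, integral_fun_norm_addHaar volume (f := newtK R),
    setIntegral_congr_fun measurableSet_Ioi heq, integral_indicator measurableSet_Iio,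
      Measure.restrict_restrict measurableSet_Iio, Iio_inter_Ioi, ← integral_Ioc_eq_integral_Ioo,
      ← intervalIntegral.integral_of_le hR.le, integral_id, hdim]
  · congr 1
    simp only [smul_eq_mul, nsmul_eq_mul]
    push_cast
    ring
  · filter_upwards with z
    exact newtK_nonneg R _ (norm_nonneg z)
 
def V0 : ℝ := (3/2) * (volume : Measure R3).real (Metric.ball 0 1)

lemma V0_nonneg : 0 ≤ V0 := by unfold V0; positivity

lemma half_bound (ρ : R3 → ℝ) (hρ : Measurable ρ) (h0 : ∀ x, 0 ≤ ρ x) (M : ℝ)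
    (hM : 0 ≤ M) (hm : ∫⁻ x, ENNReal.ofReal (ρ x) ≤ ENNReal.ofReal M) (x : R3) :
    ∫⁻ y, {y | ρ y ≤ ρ x}.indicator
      (fun y => ENNReal.ofReal (ρ x * ρ y * ‖x - y‖⁻¹)) y
      ≤ ENNReal.ofReal (V0 + M) * ENNReal.ofReal (ρ x ^ (4/3:ℝ)) := by
  rcases (h0 x).eq_or_lt with h | ht
  · simp [← h]
  set t := ρ x with htdef
  set R : ℝ := t ^ (-(1/3):ℝ) with hR
  have hRpos : 0 < R := Real.rpow_pos_of_pos ht _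
  have hk0 : ∀ z : R3, 0 ≤ newtK R ‖z‖ := fun z =>
    newtK_nonneg R _ (norm_nonneg z)
  have hkm : Measurable (newtK R) := (measurable_inv).indicator measurableSet_Iio
  have key : ∀ y, {y | ρ y ≤ t}.indicator
      (fun y => ENNReal.ofReal (t * ρ y * ‖x - y‖⁻¹)) y ≤
      ENNReal.ofReal (t*t) * ENNReal.ofReal (newtK R ‖x - y‖) +
        ENNReal.ofReal (t * R⁻¹) * ENNReal.ofReal (ρ y) := by
    intro y
    by_cases hy : ρ y ≤ t
    · rw [indicator_of_mem (by exact hy), ← ENNReal.ofReal_mul (by positivity),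
        ← ENNReal.ofReal_mul (by positivity), ← ENNReal.ofReal_add
          (mul_nonneg (by positivity) (hk0 _)) (mul_nonneg (by positivity) (h0 y))]
      apply ENNReal.ofReal_le_ofReal
      have hy0 := h0 y
      by_cases hxy : ‖x - y‖ < R
      · have : newtK R ‖x - y‖ = ‖x - y‖⁻¹ := by simp [newtK, hxy]
        rw [this]
        have : t * ρ y * ‖x - y‖⁻¹ ≤ t * t * ‖x - y‖⁻¹ := by gcongr
        have h2 : 0 ≤ t * R⁻¹ * ρ y := by positivity
        linarith
      · have : newtK R ‖x - y‖ = 0 := by simp [newtK, hxy]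
        rw [this]
        have : t * ρ y * ‖x - y‖⁻¹ ≤ t * ρ y * R⁻¹ := by
          gcongr
          exact not_lt.1 hxy
        linarith
    · rw [indicator_of_notMem (by exact hy)]; exact zero_le
  calc _ ≤ ∫⁻ y, (ENNReal.ofReal (t*t) * ENNReal.ofReal (newtK R ‖x - y‖) +
        ENNReal.ofReal (t * R⁻¹) * ENNReal.ofReal (ρ y)) := lintegral_mono key
    _ = ENNReal.ofReal (t*t) * ENNReal.ofReal (V0 * R^2)
        + ENNReal.ofReal (t * R⁻¹) * ∫⁻ y, ENNReal.ofReal (ρ y) := by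
      rw [lintegral_add_right _ (by fun_prop), lintegral_const_mul _ (by fun_prop),
        lintegral_const_mul _ (by fun_prop),
        lintegral_sub_left_eq_self (fun z : R3 => ENNReal.ofReal (newtK R ‖z‖)) x,
        newtK_ball R hRpos, V0]
    _ ≤ ENNReal.ofReal (t*t) * ENNReal.ofReal (V0 * R^2)
        + ENNReal.ofReal (t * R⁻¹) * ENNReal.ofReal M := by gcongr
    _ = _ := by
      have hV := V0_nonneg
      rw [← ENNReal.ofReal_mul (by positivity), ← ENNReal.ofReal_mul (by positivity),
        ← ENNReal.ofReal_mul (by positivity), ← ENNReal.ofReal_add (by positivity) (by positivity)]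
      congr 1
      have e1 : t * t * R^2 = t ^ (4/3:ℝ) := by
        rw [hR, ← Real.rpow_natCast, ← Real.rpow_mul ht.le]
        nth_rewrite 1 [← Real.rpow_one t]
        nth_rewrite 2 [← Real.rpow_one t]
        rw [← Real.rpow_add ht, ← Real.rpow_add ht]
        norm_num
      have e2 : t * R⁻¹ = t ^ (4/3:ℝ) := by
        rw [hR, ← Real.rpow_neg ht.le]
        nth_rewrite 1 [← Real.rpow_one t]
        rw [← Real.rpow_add ht]
        norm_num
      calc _ = V0 * (t * t * R^2) + M * (t * R⁻¹) := by ring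
        _ = _ := by rw [e1, e2]; ring

lemma pair_bound_meas (ρ : R3 → ℝ) (hρ : Measurable ρ) (h0 : ∀ x, 0 ≤ ρ x) (M : ℝ)
    (hM : 0 ≤ M) (hm : ∫⁻ x, ENNReal.ofReal (ρ x) ≤ ENNReal.ofReal M) :
    ∫⁻ x, ∫⁻ y, ENNReal.ofReal (ρ x * ρ y * ‖x - y‖⁻¹)
      ≤ 2 * (ENNReal.ofReal (V0 + M) * ∫⁻ x, ENNReal.ofReal (ρ x ^ (4/3:ℝ))) := by
  let G : R3 → R3 → ℝ≥0∞ := fun x y => {y | ρ y ≤ ρ x}.indicator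
      (fun y => ENNReal.ofReal (ρ x * ρ y * ‖x - y‖⁻¹)) y
  have hG : Measurable (Function.uncurry G) := by
    have : Function.uncurry G = {p : R3 × R3 | ρ p.2 ≤ ρ p.1}.indicator
      (fun p => ENNReal.ofReal (ρ p.1 * ρ p.2 * ‖p.1 - p.2‖⁻¹)) := by
      ext p; simp [G, Function.uncurry, indicator]
    rw [this]
    apply Measurable.indicator
    · fun_prop
    · exact measurableSet_le (by fun_prop) (by fun_prop)
  have hle : ∀ x y, ENNReal.ofReal (ρ x * ρ y * ‖x - y‖⁻¹) ≤ G x y + G y x := by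
    intro x y
    rcases le_total (ρ y) (ρ x) with h | h
    · simp [G, indicator, h]
    · rw [norm_sub_rev, mul_comm (ρ x)]
      simp [G, indicator, h]
  have hGx : ∀ x, Measurable (G x) := fun x => hG.comp measurable_prodMk_left
  have hI : Measurable (fun x => ∫⁻ y, G x y) := hG.lintegral_prod_right'
  have hone : ∫⁻ x, ∫⁻ y, G x y ≤ ENNReal.ofReal (V0 + M) * ∫⁻ x, ENNReal.ofReal (ρ x ^ (4/3:ℝ)) := by
    rw [← lintegral_const_mul _ (by fun_prop)]
    exact lintegral_mono (fun x => half_bound ρ hρ h0 M hM hm x)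
  calc _ ≤ ∫⁻ x, ∫⁻ y, (G x y + G y x) := lintegral_mono fun x => lintegral_mono fun y => hle x y
    _ = (∫⁻ x, ∫⁻ y, G x y) + ∫⁻ x, ∫⁻ y, G y x := by
      rw [← lintegral_add_left hI]
      congr 1; ext x
      rw [lintegral_add_left (hGx x)]
    _ = (∫⁻ x, ∫⁻ y, G x y) + ∫⁻ x, ∫⁻ y, G x y := by
      congr 1
      rw [lintegral_lintegral_swap]
      exact (hG.comp measurable_swap).aemeasurable
    _ ≤ _ := by rw [two_mul]; gcongr

lemma pair_bound (ρ : R3 → ℝ) (hρ : Integrable ρ) (h0 : ∀ x, 0 ≤ ρ x) :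
    ∫⁻ x, ∫⁻ y, ENNReal.ofReal (ρ x * ρ y * ‖x - y‖⁻¹)
      ≤ 2 * (ENNReal.ofReal (V0 + ∫ x, ρ x) * ∫⁻ x, ENNReal.ofReal (ρ x ^ (4/3:ℝ))) := by
  obtain ⟨g, hgm, hg⟩ := hρ.aestronglyMeasurable.aemeasurable
  let σ : R3 → ℝ := fun x => max (g x) 0
  have hσ : Measurable σ := hgm.max measurable_const
  have hρσ : ρ =ᵐ[volume] σ := by
    filter_upwards [hg] with x hx
    simp only [σ, ← hx, max_eq_left (h0 x)]
  have hm : ∫⁻ x, ENNReal.ofReal (σ x) ≤ ENNReal.ofReal (∫ x, ρ x) := by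
    rw [ofReal_integral_eq_lintegral_ofReal hρ (Eventually.of_forall h0)]
    apply le_of_eq
    apply lintegral_congr_ae
    filter_upwards [hρσ] with x hx
    rw [hx]
  have := pair_bound_meas σ hσ (fun x => le_max_right _ _) _ (integral_nonneg h0) hm
  have e1 : ∫⁻ x, ENNReal.ofReal (ρ x ^ (4/3:ℝ)) = ∫⁻ x, ENNReal.ofReal (σ x ^ (4/3:ℝ)) := by
    apply lintegral_congr_ae
    filter_upwards [hρσ] with x hx
    rw [hx]
  rw [e1]
  refine le_of_eq_of_le ?_ this
  apply lintegral_congr_ae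
  filter_upwards [hρσ] with x hx
  apply lintegral_congr_ae
  filter_upwards [hρσ] with y hy
  rw [hx, hy]

lemma ball_real (b : ℝ) (hb : 0 ≤ b) :
    (volume : Measure R3).real (Metric.ball 0 b) =
      b^3 * (volume : Measure R3).real (Metric.ball 0 1) := by
  have hdim : Module.finrank ℝ R3 = 3 := by simp
  rw [Measure.real, Measure.addHaar_ball _ _ hb, hdim, ENNReal.toReal_mul,
    ENNReal.toReal_ofReal (by positivity), Measure.real]

lemma asym (k : ℝ) (hk : k < 3/2) (A B : ℝ) :
    ∃ s₀ > 0, ∀ s, s₀ ≤ s → s * (A + B * s ^ k) * s ^ (3/2:ℝ) ≤ s ^ 4 / 2 := by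
  have h1 : Tendsto (fun s : ℝ => A * s ^ (-(3/2):ℝ) + B * s ^ (-(3/2 - k))) atTop
      (𝓝 (A * 0 + B * 0)) :=
    ((tendsto_rpow_neg_atTop (by norm_num)).const_mul A).add
      ((tendsto_rpow_neg_atTop (by linarith)).const_mul B)
  simp only [mul_zero, add_zero] at h1
  have h2 := (h1.eventually (gt_mem_nhds (show (0:ℝ) < 1/2 by norm_num))).and
    (eventually_gt_atTop (0:ℝ))
  obtain ⟨s₀, hs₀⟩ := eventually_atTop.1 h2
  refine ⟨max s₀ 1, by positivity, fun s hs => ?_⟩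
  obtain ⟨h3, h4⟩ := hs₀ s ((le_max_left _ _).trans hs)
  have e1 : s * s ^ (3/2:ℝ) = s ^ 4 * s ^ (-(3/2):ℝ) := by
    rw [← Real.rpow_natCast, ← Real.rpow_add h4]
    nth_rewrite 1 [← Real.rpow_one s]
    rw [← Real.rpow_add h4]; norm_num
  have e2 : s * s ^ k * s ^ (3/2:ℝ) = s ^ 4 * s ^ (-(3/2 - k)) := by
    rw [← Real.rpow_natCast, ← Real.rpow_add h4]
    nth_rewrite 1 [← Real.rpow_one s]
    rw [← Real.rpow_add h4, ← Real.rpow_add h4]; norm_num; ring_nf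
  calc _ = A * (s * s ^ (3/2:ℝ)) + B * (s * s ^ k * s ^ (3/2:ℝ)) := by ring
    _ = s ^ 4 * (A * s ^ (-(3/2):ℝ) + B * s ^ (-(3/2 - k))) := by rw [e1, e2]; ring
    _ ≤ s ^ 4 * (1/2) := by gcongr
    _ = _ := by ring

lemma vel_bound {Φ Φ' : ℝ → ℝ} {k k' : ℝ} (hΦ : IsPhi Φ Φ' k k') (ε : ℝ) (hε : 0 < ε) :
    ∃ s₀ > 0, ∀ g : R3 → ℝ, (∀ v, 0 ≤ g v) → Integrable g →
      Integrable (fun v => ‖v‖ ^ 2 * g v) → Integrable (fun v => Φ (g v)) →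
      (∫ v, g v) ^ (4/3:ℝ) ≤ 2 * ε * ((1/2) * (∫ v, ‖v‖ ^ 2 * g v) + ∫ v, Φ (g v))
        + s₀ * ∫ v, g v := by
  obtain ⟨C, hC, F, hF, hgr⟩ := hΦ.growth_large
  set ω := (volume : Measure R3).real (Metric.ball 0 1) with hω
  have hω0 : 0 ≤ ω := by positivity
  set c := (2/ε) ^ (3/2:ℝ) * ω with hc
  obtain ⟨s₀, hs₀, has⟩ := asym k hΦ.k_lt (c * F) (c * (1 / (ε * C)) ^ k)
  refine ⟨s₀, hs₀, fun g g0 gi ki ci => ?_⟩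
  set t := ∫ v, g v with ht
  have ht0 : 0 ≤ t := integral_nonneg g0
  set s := t ^ (1/3:ℝ) with hs
  have hs0 : 0 ≤ s := by positivity
  have hst : s ^ 3 = t := by
    rw [hs, ← Real.rpow_natCast, ← Real.rpow_mul ht0]; norm_num
  have hst4 : t ^ (4/3:ℝ) = s ^ 4 := by
    rw [hs, ← Real.rpow_natCast, ← Real.rpow_mul ht0]; norm_num
  rw [hst4]
  have hP0 : ∀ v, 0 ≤ Φ (g v) := fun v => hΦ.nonneg _ (g0 v)
  have hE0 : 0 ≤ (1/2) * (∫ v, ‖v‖ ^ 2 * g v) + ∫ v, Φ (g v) := by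
    have h1 : 0 ≤ ∫ v, ‖v‖ ^ 2 * g v := integral_nonneg fun v => mul_nonneg (by positivity) (g0 v)
    have h2 : 0 ≤ ∫ v, Φ (g v) := integral_nonneg hP0
    positivity
  rcases le_total s s₀ with h | h
  · have : s ^ 4 ≤ s₀ * t := by
      calc s ^ 4 = s * s ^ 3 := by ring
        _ ≤ s₀ * s ^ 3 := by gcongr
        _ = _ := by rw [hst]
    have : 0 ≤ 2 * ε * ((1/2) * (∫ v, ‖v‖ ^ 2 * g v) + ∫ v, Φ (g v)) := by positivity
    linarith
  have hspos : 0 < s := hs₀.trans_le h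
  set A := F + (s / (ε * C)) ^ k with hA
  have hA0 : 0 ≤ A := by positivity
  set b := Real.sqrt (2 * s / ε) with hb
  have hb0 : 0 ≤ b := Real.sqrt_nonneg _
  have hb2 : b ^ 2 = 2 * s / ε := Real.sq_sqrt (by positivity)
  have key : ∀ v, s * g v ≤ ε * ((1/2) * (‖v‖ ^ 2 * g v) + Φ (g v)) +
      (Metric.ball (0:R3) b).indicator (fun _ => s * A) v := by
    intro v
    have hg := g0 v
    have hP := hP0 v
    by_cases hv : v ∈ Metric.ball (0:R3) b
    · rw [indicator_of_mem hv]
      rcases le_total (g v) A with h1 | h1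
      · have : s * g v ≤ s * A := by gcongr
        have : 0 ≤ ε * ((1/2) * (‖v‖ ^ 2 * g v) + Φ (g v)) := by positivity
        linarith
      · have hp : 0 ≤ (s / (ε * C)) ^ k := by positivity
        have h2 := hgr (g v) (by linarith)
        have hgpos : 0 < g v := by linarith
        have h3 : s / (ε * C) ≤ g v ^ (1/k) := by
          have h4 : ((s / (ε * C)) ^ k) ^ (1/k) ≤ g v ^ (1/k) := by
            have := hΦ.k_pos
            apply Real.rpow_le_rpow hp (by linarith) (by positivity)
          rwa [← Real.rpow_mul (by positivity), mul_one_div_cancel hΦ.k_pos.ne',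
            Real.rpow_one] at h4
        have h5 : s * g v ≤ ε * Φ (g v) := by
          calc s * g v = ε * (C * (g v * (s / (ε * C)))) := by field_simp
            _ ≤ ε * (C * (g v * g v ^ (1/k))) := by gcongr
            _ = ε * (C * g v ^ (1 + 1/k)) := by rw [Real.rpow_add hgpos, Real.rpow_one]
            _ ≤ _ := by gcongr
        have : 0 ≤ ε * ((1/2) * (‖v‖ ^ 2 * g v)) := by positivity
        have : 0 ≤ s * A := by positivity
        linarith
    · rw [indicator_of_notMem hv]
      have hv' : b ≤ ‖v‖ := by simpa using hv
      have h1 : 2 * s / ε ≤ ‖v‖ ^ 2 := by rw [← hb2]; gcongr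
      have h2 : s * g v ≤ ε * ((1/2) * (‖v‖ ^ 2 * g v)) := by
        calc s * g v = ε * ((1/2) * ((2 * s / ε) * g v)) := by field_simp
          _ ≤ _ := by gcongr
      have : 0 ≤ ε * Φ (g v) := by positivity
      linarith
  have hind : Integrable ((Metric.ball (0:R3) b).indicator (fun _ => s * A)) := by
    rw [integrable_indicator_iff measurableSet_ball]
    exact integrableOn_const (by exact measure_ball_lt_top.ne)
  have hsum : Integrable (fun v => (1/2) * (‖v‖ ^ 2 * g v) + Φ (g v)) := (ki.const_mul _).add ci
  have hint : s * t ≤ ε * ((1/2) * (∫ v, ‖v‖ ^ 2 * g v) + ∫ v, Φ (g v)) + s * A * (b ^ 3 * ω) := by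
    have := integral_mono (gi.const_mul s) ((hsum.const_mul ε).add hind) key
    rw [integral_const_mul] at this
    refine this.trans (le_of_eq ?_)
    simp only [Pi.add_apply]
    rw [integral_add (hsum.const_mul ε) hind, integral_const_mul,
      integral_add (ki.const_mul _) ci, integral_const_mul,
      integral_indicator measurableSet_ball, setIntegral_const, ball_real b hb0, smul_eq_mul]
    ring
  have hb3 : b ^ 3 * ω = c * s ^ (3/2:ℝ) := by
    rw [hb, Real.sqrt_eq_rpow, ← Real.rpow_natCast, ← Real.rpow_mul (by positivity), hc,
      show 2 * s / ε = (2 / ε) * s by ring, Real.mul_rpow (by positivity) hs0]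
    norm_num
    ring
  have hlast : s * A * (b ^ 3 * ω) ≤ s ^ 4 / 2 := by
    refine le_of_eq_of_le ?_ (has s h)
    rw [hb3, hA, show s / (ε * C) = (1 / (ε * C)) * s by ring, Real.mul_rpow (by positivity) hs0]
    ring
  have : s * t = s ^ 4 := by rw [← hst]; ring
  have : 0 ≤ s₀ * t := by positivity
  nlinarith

lemma Dpair_le (ρ : R3 → ℝ) (hρ : Integrable ρ) (h0 : ∀ x, 0 ≤ ρ x) (B : ℝ) (hB : 0 ≤ B)
    (h : ∫⁻ x, ENNReal.ofReal (ρ x ^ (4/3:ℝ)) ≤ ENNReal.ofReal B) :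
    Dpair ρ ≤ 2 * ((V0 + ∫ x, ρ x) * B) := by
  have hV : 0 ≤ V0 + ∫ x, ρ x := add_nonneg V0_nonneg (integral_nonneg h0)
  have h1 : ‖Dpair ρ‖ₑ ≤ ENNReal.ofReal (2 * ((V0 + ∫ x, ρ x) * B)) := by
    calc ‖Dpair ρ‖ₑ ≤ ∫⁻ x, ‖∫ y, ρ x * ρ y / ‖x - y‖‖ₑ := enorm_integral_le_lintegral_enorm _
      _ ≤ ∫⁻ x, ∫⁻ y, ‖ρ x * ρ y / ‖x - y‖‖ₑ :=
        lintegral_mono fun x => enorm_integral_le_lintegral_enorm _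
      _ = ∫⁻ x, ∫⁻ y, ENNReal.ofReal (ρ x * ρ y * ‖x - y‖⁻¹) := by
        congr 1; ext x; congr 1; ext y
        rw [Real.enorm_eq_ofReal, div_eq_mul_inv]
        have := h0 x
        have := h0 y
        positivity
      _ ≤ _ := pair_bound ρ hρ h0
      _ ≤ 2 * (ENNReal.ofReal (V0 + ∫ x, ρ x) * ENNReal.ofReal B) := by gcongr
      _ = _ := by
        rw [ENNReal.ofReal_mul (by norm_num), ENNReal.ofReal_mul hV]
        norm_num
  rw [Real.enorm_eq_ofReal_abs] at h1
  exact (le_abs_self _).trans ((ENNReal.ofReal_le_ofReal_iff (by positivity)).1 h1)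

lemma HC_lower (Φ Φ' : ℝ → ℝ) (k k' : ℝ) (hΦ : IsPhi Φ Φ' k k') (M : ℝ) (hM : 0 < M) :
    BddBelow (HC Φ '' FMset Φ M) := by
  have hV := V0_nonneg
  obtain ⟨s₀, hs₀, hvel⟩ := vel_bound hΦ (1 / (2 * (V0 + M))) (by positivity)
  refine ⟨-((V0 + M) * (s₀ * M)), ?_⟩
  rintro _ ⟨f, hf, rfl⟩
  obtain ⟨f0, fi, fm, ki, ci⟩ := hf
  have hri : Integrable (spatialDensity f) := Integrable.integral_prod_left fi
  have hr0 : ∀ x, 0 ≤ spatialDensity f x := fun x => integral_nonneg fun v => f0 _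
  have hrm : ∫ x, spatialDensity f x = M := by
    rw [← fm]; exact (integral_prod _ fi).symm
  have hki : Integrable (fun x => ∫ v, ‖v‖ ^ 2 * f (x, v)) := Integrable.integral_prod_left ki
  have hci : Integrable (fun x => ∫ v, Φ (f (x, v))) := Integrable.integral_prod_left ci
  have hke : ∫ x, ∫ v, ‖v‖ ^ 2 * f (x, v) = ∫ p : R3 × R3, ‖p.2‖ ^ 2 * f p :=
    (integral_prod _ ki).symm
  have hce : ∫ x, ∫ v, Φ (f (x, v)) = ∫ p, Φ (f p) := (integral_prod _ ci).symm
  set ε := 1 / (2 * (V0 + M)) with hε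
  have hVM : 0 < V0 + M := by positivity
  have hεpos : 0 < ε := by positivity
  set T : R3 → ℝ := fun x => 2 * ε * ((1/2) * (∫ v, ‖v‖ ^ 2 * f (x, v)) + ∫ v, Φ (f (x, v)))
        + s₀ * spatialDensity f x with hT
  have hTi : Integrable T := (((hki.const_mul _).add hci).const_mul _).add (hri.const_mul _)
  have hT0 : ∀ x, 0 ≤ T x := by
    intro x
    have h1 : 0 ≤ ∫ v, ‖v‖ ^ 2 * f (x, v) :=
      integral_nonneg fun v => mul_nonneg (by positivity) (f0 _)
    have h2 : 0 ≤ ∫ v, Φ (f (x, v)) := integral_nonneg fun v => hΦ.nonneg _ (f0 _)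
    have h3 := hr0 x
    simp only [hT]
    positivity
  have hTe : ∫ x, T x = 2 * ε * (Ekin f + Casimir Φ f) + s₀ * M := by
    have hs1 : Integrable (fun x => (1/2) * (∫ v, ‖v‖ ^ 2 * f (x, v)) + ∫ v, Φ (f (x, v))) :=
      (hki.const_mul _).add hci
    simp only [hT]
    rw [integral_add (hs1.const_mul _) (hri.const_mul _),
      integral_const_mul, integral_const_mul, integral_add (hki.const_mul _) hci,
      integral_const_mul, hke, hce, hrm, Ekin, Casimir]
  have hb : ∫⁻ x, ENNReal.ofReal (spatialDensity f x ^ (4/3:ℝ)) ≤ ENNReal.ofReal (∫ x, T x) := by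
    rw [ofReal_integral_eq_lintegral_ofReal hTi (Eventually.of_forall hT0)]
    apply lintegral_mono_ae
    filter_upwards [fi.prod_right_ae, ki.prod_right_ae, ci.prod_right_ae] with x h1 h2 h3
    exact ENNReal.ofReal_le_ofReal (hvel _ (fun v => f0 _) h1 h2 h3)
  have hD := Dpair_le _ hri hr0 _ (integral_nonneg hT0) hb
  rw [hTe, hrm] at hD
  have e : (V0 + M) * (2 * ε) = 1 := by rw [hε]; field_simp
  have hD' : Dpair (spatialDensity f) ≤ 2 * (Ekin f + Casimir Φ f) + 2 * ((V0 + M) * (s₀ * M)) := by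
    refine hD.trans (le_of_eq ?_)
    calc _ = 2 * ((V0 + M) * (2 * ε)) * (Ekin f + Casimir Φ f) + 2 * ((V0 + M) * (s₀ * M)) := by ring
      _ = _ := by rw [e]; ring
  unfold HC Epot
  linarith

lemma Dpair_ball (a m : ℝ) (ha : 0 < a) (hm : 0 < m) (ρ : R3 → ℝ)
    (hρdef : ρ = (Metric.ball (0:R3) a).indicator (fun _ => m)) :
    (∫ x, ρ x) ^ 2 / (2 * a) ≤ Dpair ρ := by
  have hρm : Measurable ρ := by
    rw [hρdef]; exact measurable_const.indicator measurableSet_ball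
  have hρi : Integrable ρ := by
    rw [hρdef, integrable_indicator_iff measurableSet_ball]
    exact integrableOn_const (by exact measure_ball_lt_top.ne)
  have h0 : ∀ x, 0 ≤ ρ x := by
    intro x; rw [hρdef]; exact indicator_nonneg (fun _ _ => hm.le) x
  have h43 : ∫⁻ x, ENNReal.ofReal (ρ x ^ (4/3:ℝ)) < ∞ := by
    have : ∀ x, ENNReal.ofReal (ρ x ^ (4/3:ℝ)) =
        (Metric.ball (0:R3) a).indicator (fun _ => ENNReal.ofReal (m ^ (4/3:ℝ))) x := by
      intro x
      by_cases hx : x ∈ Metric.ball (0:R3) a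
      · rw [hρdef, indicator_of_mem hx, indicator_of_mem hx]
      · rw [hρdef, indicator_of_notMem hx, indicator_of_notMem hx, Real.zero_rpow (by norm_num),
          ENNReal.ofReal_zero]
    simp_rw [this]
    rw [lintegral_indicator measurableSet_ball, setLIntegral_const]
    exact ENNReal.mul_lt_top ENNReal.ofReal_lt_top measure_ball_lt_top
  have hF : Integrable (fun p : R3 × R3 => ρ p.1 * ρ p.2 / ‖p.1 - p.2‖)
      ((volume : Measure R3).prod volume) := by
    refine ⟨Measurable.aestronglyMeasurable (by fun_prop), ?_⟩
    rw [HasFiniteIntegral, lintegral_prod _ (by fun_prop)]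
    have e : ∫⁻ x, ∫⁻ y, ‖ρ x * ρ y / ‖x - y‖‖ₑ =
        ∫⁻ x, ∫⁻ y, ENNReal.ofReal (ρ x * ρ y * ‖x - y‖⁻¹) := by
      congr 1; ext x; congr 1; ext y
      rw [Real.enorm_eq_ofReal, div_eq_mul_inv]
      have := h0 x
      have := h0 y
      positivity
    refine (le_of_eq_of_le e (pair_bound ρ hρi h0)).trans_lt ?_
    exact ENNReal.mul_lt_top (by norm_num) (ENNReal.mul_lt_top ENNReal.ofReal_lt_top h43)
  have hle : ∀ᵐ x : R3, ρ x * ((∫ y, ρ y) / (2 * a)) ≤ ∫ y, ρ x * ρ y / ‖x - y‖ := by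
    filter_upwards [hF.prod_right_ae] with x hx
    have : ρ x * ((∫ y, ρ y) / (2 * a)) = ∫ y, ρ x * ρ y * (2 * a)⁻¹ := by
      rw [integral_mul_const, integral_const_mul]; ring
    rw [this]
    apply integral_mono_ae ((hρi.const_mul _).mul_const _) hx
    have hne : ∀ᵐ y : R3, y ≠ x := by simp [ae_iff]
    filter_upwards [hne] with y hy
    by_cases hxb : x ∈ Metric.ball (0:R3) a
    · by_cases hyb : y ∈ Metric.ball (0:R3) a
      · have h1 : 0 < ‖x - y‖ := norm_pos_iff.2 (sub_ne_zero.2 hy.symm)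
        have h2 : ‖x - y‖ ≤ 2 * a := by
          have := norm_sub_le x y
          simp only [mem_ball_zero_iff] at hxb hyb
          linarith
        have := h0 x
        have := h0 y
        simp only [div_eq_mul_inv]
        gcongr
      · simp [hρdef, indicator_of_notMem hyb]
    · simp [hρdef, indicator_of_notMem hxb]
  calc (∫ x, ρ x) ^ 2 / (2 * a) = ∫ x, ρ x * ((∫ y, ρ y) / (2 * a)) := by
        rw [integral_mul_const]; ring
    _ ≤ _ := integral_mono_ae (hρi.mul_const _) hF.integral_prod_left hle

lemma test_bound {Φ Φ' : ℝ → ℝ} {k k' : ℝ} (hΦ : IsPhi Φ Φ' k k') (M a b h : ℝ)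
    (ha : 0 < a) (hb : 0 < b) (hh : 0 < h)
    (hM : h * ((a ^ 3 * (volume : Measure R3).real (Metric.ball 0 1)) *
      (b ^ 3 * (volume : Measure R3).real (Metric.ball 0 1))) = M) :
    ∃ f ∈ FMset Φ M, HC Φ f ≤ (1/2) * (b ^ 2 * M) - M ^ 2 / (4 * a) + M / h * Φ h := by
  set S : Set (R3 × R3) := Metric.ball (0:R3) a ×ˢ Metric.ball (0:R3) b with hS
  have hSm : MeasurableSet S := measurableSet_ball.prod measurableSet_ball
  have hSf : volume S ≠ ∞ := by
    rw [hS, Measure.volume_eq_prod, Measure.prod_prod]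
    exact (ENNReal.mul_lt_top measure_ball_lt_top measure_ball_lt_top).ne
  have hSr : volume.real S = (a ^ 3 * (volume : Measure R3).real (Metric.ball 0 1)) *
      (b ^ 3 * (volume : Measure R3).real (Metric.ball 0 1)) := by
    rw [hS, Measure.volume_eq_prod, measureReal_prod_prod, ball_real a ha.le, ball_real b hb.le]
  rw [← hSr] at hM
  have hind : ∀ c : ℝ, Integrable (S.indicator (fun _ => c)) := by
    intro c
    rw [integrable_indicator_iff hSm]
    exact integrableOn_const hSf
  have hindI : ∀ c : ℝ, ∫ p, S.indicator (fun _ => c) p = c * volume.real S := by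
    intro c
    rw [integral_indicator hSm, setIntegral_const, smul_eq_mul, mul_comm]
  set f : R3 × R3 → ℝ := S.indicator (fun _ => h) with hf
  have f0 : ∀ p, 0 ≤ f p := fun p => indicator_nonneg (fun _ _ => hh.le) p
  have hPf : (fun p => Φ (f p)) = S.indicator (fun _ => Φ h) := by
    ext p
    by_cases hp : p ∈ S
    · simp only [hf, indicator_of_mem hp]
    · simp only [hf, indicator_of_notMem hp, hΦ.zero]
  have hfm : ∫ p, f p = M := by rw [hf, hindI, hM]
  have hkle : ∀ p : R3 × R3, ‖p.2‖ ^ 2 * f p ≤ b ^ 2 * f p := by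
    intro p
    by_cases hp : p ∈ S
    · have : ‖p.2‖ ≤ b := by
        have := hp.2
        rw [mem_ball_zero_iff] at this
        exact this.le
      have := f0 p
      gcongr
    · simp [hf, indicator_of_notMem hp]
  have hki : Integrable (fun p : R3 × R3 => ‖p.2‖ ^ 2 * f p) := by
    refine ((hind h).const_mul (b ^ 2)).mono' ?_ ?_
    · exact AEStronglyMeasurable.mul (Continuous.aestronglyMeasurable (by fun_prop))
        (hind h).aestronglyMeasurable
    · filter_upwards with p
      rw [Real.norm_of_nonneg (mul_nonneg (by positivity) (f0 p))]
      exact hkle p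
  refine ⟨f, ⟨f0, hind h, hfm, hki, by rw [hPf]; exact hind _⟩, ?_⟩
  have hk : Ekin f ≤ (1/2) * (b ^ 2 * M) := by
    unfold Ekin
    have := integral_mono hki ((hind h).const_mul (b ^ 2)) hkle
    rw [integral_const_mul, ← hf, hfm] at this
    linarith
  have hc : Casimir Φ f = M / h * Φ h := by
    unfold Casimir
    rw [hPf, hindI, ← hM]
    field_simp
  have hrho : spatialDensity f = (Metric.ball (0:R3) a).indicator
      (fun _ => h * (volume : Measure R3).real (Metric.ball 0 b)) := by
    ext x
    unfold spatialDensity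
    by_cases hx : x ∈ Metric.ball (0:R3) a
    · rw [indicator_of_mem hx]
      have : (fun v => f (x, v)) = (Metric.ball (0:R3) b).indicator (fun _ => h) := by
        ext v
        by_cases hv : v ∈ Metric.ball (0:R3) b
        · rw [hf, indicator_of_mem hv, indicator_of_mem (show (x, v) ∈ S from ⟨hx, hv⟩)]
        · rw [hf, indicator_of_notMem hv, indicator_of_notMem (fun hc : (x, v) ∈ S => hv hc.2)]
      rw [this, integral_indicator measurableSet_ball, setIntegral_const, smul_eq_mul, mul_comm]
    · rw [indicator_of_notMem hx]
      have : (fun v => f (x, v)) = fun _ => 0 := by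
        ext v
        rw [hf, indicator_of_notMem (fun hc : (x, v) ∈ S => hx hc.1)]
      rw [this, integral_zero]
  have hpos : 0 < (volume : Measure R3).real (Metric.ball 0 b) :=
    ENNReal.toReal_pos (Metric.measure_ball_pos _ _ hb).ne' measure_ball_lt_top.ne
  have hrm : ∫ x, spatialDensity f x = M := by
    rw [← hfm]; exact (integral_prod _ (hind h)).symm
  have hD := Dpair_ball a _ ha (mul_pos hh hpos) _ hrho
  rw [hrm] at hD
  have e : M ^ 2 / (4 * a) = (1/2) * (M ^ 2 / (2 * a)) := by field_simp; norm_num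
  unfold HC Epot
  rw [hc, e]
  linarith

lemma HC_neg (Φ Φ' : ℝ → ℝ) (k k' : ℝ) (hΦ : IsPhi Φ Φ' k k') (M : ℝ) (hM : 0 < M) :
    ∃ f ∈ FMset Φ M, HC Φ f < 0 := by
  obtain ⟨C, hC, F, hF, hgr⟩ := hΦ.growth_small
  set ω := (volume : Measure R3).real (Metric.ball 0 1) with hω
  have hω0 : 0 < ω :=
    ENNReal.toReal_pos (Metric.measure_ball_pos _ _ one_pos).ne' measure_ball_lt_top.ne
  have hk' := hΦ.k'_pos
  set c : ℝ := M / (ω ^ 2 * (M / 4) ^ (3/2:ℝ)) with hc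
  have hc0 : 0 < c := by positivity
  set q : ℝ := 3 / 2 * (1 / k') with hq
  have hq1 : 1 < q := by
    rw [hq, mul_one_div, lt_div_iff₀ hk']
    linarith [hΦ.k'_lt]
  have t1 : Tendsto (fun a : ℝ => c * a ^ (-(3/2):ℝ)) atTop (𝓝 (c * 0)) :=
    (tendsto_rpow_neg_atTop (by norm_num)).const_mul c
  have t2 : Tendsto (fun a : ℝ => M * C * c ^ (1/k') * a ^ (-(q - 1))) atTop
      (𝓝 (M * C * c ^ (1/k') * 0)) :=
    (tendsto_rpow_neg_atTop (by linarith)).const_mul _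
  rw [mul_zero] at t1 t2
  obtain ⟨a, ⟨h1, h2⟩, ha⟩ := (((t1.eventually (gt_mem_nhds hF)).and
    (t2.eventually (gt_mem_nhds (show 0 < M ^ 2 / 8 by positivity)))).and
      (eventually_gt_atTop (0:ℝ))).exists
  set h := c * a ^ (-(3/2):ℝ) with hh
  have hh0 : 0 < h := by positivity
  set b := Real.sqrt (M / 4 / a) with hb
  have hb0 : 0 < b := Real.sqrt_pos.2 (by positivity)
  have hb2 : b ^ 2 = M / 4 / a := Real.sq_sqrt (by positivity)
  have hb3 : b ^ 3 = (M / 4) ^ (3/2:ℝ) * a ^ (-(3/2):ℝ) := by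
    rw [hb, Real.sqrt_eq_rpow, ← Real.rpow_natCast, ← Real.rpow_mul (by positivity),
      Real.div_rpow (by positivity) ha.le, Real.rpow_neg ha.le, div_eq_mul_inv]
    norm_num
  have ha3 : a ^ (-(3/2):ℝ) * a ^ (-(3/2):ℝ) * a ^ 3 = 1 := by
    rw [← Real.rpow_natCast, ← Real.rpow_add ha, ← Real.rpow_add ha]; norm_num
  have hmass : h * ((a ^ 3 * ω) * (b ^ 3 * ω)) = M := by
    calc _ = c * (ω ^ 2 * (M / 4) ^ (3/2:ℝ)) * (a ^ (-(3/2):ℝ) * a ^ (-(3/2):ℝ) * a ^ 3) := by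
          rw [hb3, hh]; ring
      _ = M := by rw [ha3, hc, mul_one, div_mul_cancel₀]; positivity
  obtain ⟨f, hf, hle⟩ := test_bound hΦ M a b h ha hb0 hh0 hmass
  refine ⟨f, hf, hle.trans_lt ?_⟩
  have hP : M / h * Φ h ≤ M * C * c ^ (1/k') * a ^ (-(q - 1)) / a := by
    have e2 : a ^ (-(q - 1)) / a = a ^ (-q) := by
      nth_rewrite 2 [← Real.rpow_one a]
      rw [← Real.rpow_sub ha]; ring_nf
    calc M / h * Φ h ≤ M / h * (C * h ^ (1 + 1/k')) := by
          gcongr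
          exact hgr h hh0.le h1.le
      _ = M * C * h ^ (1/k') := by
          rw [Real.rpow_add hh0, Real.rpow_one]; field_simp
      _ = M * C * c ^ (1/k') * (a ^ (-(q - 1)) / a) := by
          rw [e2, hh, Real.mul_rpow hc0.le (by positivity), ← Real.rpow_mul ha.le, hq, neg_mul]
          ring
      _ = _ := by ring
  have h3 : M * C * c ^ (1/k') * a ^ (-(q - 1)) / a < M ^ 2 / 8 / a := by gcongr
  have e : (1/2) * (b ^ 2 * M) - M ^ 2 / (4 * a) + M ^ 2 / 8 / a = 0 := by
    rw [hb2]; field_simp; ring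
  linarith

/-- the energy-Casimir functional is bounded from below on `F_M`
and its infimum `h_M` satisfies `-∞ < h_M < 0`. -/
theorem energyCasimir_bddBelow_inf_neg
    (Φ Φ' : ℝ → ℝ) (k k' : ℝ) (hΦ : IsPhi Φ Φ' k k') (M : ℝ) (hM : 0 < M) :
    BddBelow (HC Φ '' FMset Φ M) ∧ sInf (HC Φ '' FMset Φ M) < 0 := by
  have hb := HC_lower Φ Φ' k k' hΦ M hM
  refine ⟨hb, ?_⟩
  obtain ⟨f, hf, hn⟩ := HC_neg Φ Φ' k k' hΦ M hM
  exact (csInf_le hb ⟨f, hf, rfl⟩).trans_lt hn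
end
end

section
/- Let M > 0 and let (f_j) ⊂ F_M be a minimizing sequence of the energy-Casimir functional H_C, i.e. H_C(f_j) → h_M = inf_{F_M} H_C. Then there exist a function f₀ ∈ F_M, a subsequence (again denoted (f_j)) and a sequence of shift vectors (a_j) ⊂ ℝ³ such that D(ρ_{f_j}(·+a_j) - ρ_{f₀}) → 0 as j → ∞ (i.e. the shifted gravitational fields ∇U_{f_j}(·+a_j) converge to ∇U_{f₀} strongly in L²(ℝ³)), and f₀ minimizes H_C on F_M: H_C(f₀) = h_M. -/
open MeasureTheory Filter Topology Set ENNReal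

noncomputable section

set_option linter.unusedVariables false

/-- Newtonian kernel, extended-nonnegative valued. -/
def kk (z : R3) : ℝ≥0∞ := ENNReal.ofReal (‖z‖⁻¹)

lemma kk_meas : Measurable kk := by unfold kk; fun_prop

lemma kk_neg (z : R3) : kk (-z) = kk z := by simp [kk]

lemma kk_smul {r : ℝ} (hr : 0 < r) (z : R3) : kk (r • z) = ENNReal.ofReal (r⁻¹) * kk z := by
  unfold kk
  rw [norm_smul, mul_inv, ENNReal.ofReal_mul (by positivity), Real.norm_of_nonneg hr.le]

lemma lintegral_smul_R3 {r : ℝ} (hr : 0 < r) (g : R3 → ℝ≥0∞) (hg : Measurable g) :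
    ∫⁻ z, g z = ENNReal.ofReal (r ^ 3) * ∫⁻ z, g (r • z) := by
  have h := Measure.map_addHaar_smul (volume : Measure R3) hr.ne'
  have h2 : ∫⁻ z, g (r • z) = ∫⁻ z, g z ∂(Measure.map (fun x : R3 => r • x) volume) := by
    rw [lintegral_map hg (by fun_prop)]
  rw [h2, h, lintegral_smul_measure, smul_eq_mul, ← mul_assoc, ← ENNReal.ofReal_mul (by positivity)]
  simp only [finrank_euclideanSpace, Fintype.card_fin]
  rw [abs_of_nonneg (by positivity), mul_inv_cancel₀ (by positivity)]
  simp

lemma exists_c0 : ∃ c : ℝ, 0 < c ∧ ∀ r : ℝ, 0 < r →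
    ∫⁻ z, (Metric.ball (0:R3) r).indicator kk z ≤ ENNReal.ofReal (c * r ^ 2) := by
  have hfin : IntegrableOn (fun z : R3 => ‖z‖⁻¹) (Metric.ball 0 1) volume := by
    refine integrableOn_ball_of_norm_le_rpow (C := 1) (α := 1) (by simp) (by simp) ?_ ?_
    · refine Eventually.of_forall fun x => ?_
      rw [Real.rpow_neg_one]; simp
    · exact (by fun_prop : Measurable fun z : R3 => ‖z‖⁻¹).aestronglyMeasurable
  have hlt : ∫⁻ z in Metric.ball (0:R3) 1, kk z < ∞ := by
    have := hfin.lintegral_lt_top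
    exact this
  refine ⟨(∫⁻ z in Metric.ball (0:R3) 1, kk z).toReal + 1, by positivity, fun r hr => ?_⟩
  rw [lintegral_smul_R3 hr _ (kk_meas.indicator measurableSet_ball)]
  have : ∀ z, (Metric.ball (0:R3) r).indicator kk (r • z)
      = ENNReal.ofReal (r⁻¹) * (Metric.ball (0:R3) 1).indicator kk z := by
    intro z
    by_cases hz : z ∈ Metric.ball (0:R3) 1
    · have : r • z ∈ Metric.ball (0:R3) r := by
        simp [norm_smul, abs_of_pos hr] at hz ⊢; nlinarith
      rw [indicator_of_mem hz, indicator_of_mem this, kk_smul hr]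
    · have : r • z ∉ Metric.ball (0:R3) r := by
        simp [norm_smul, abs_of_pos hr] at hz ⊢; nlinarith
      rw [indicator_of_notMem hz, indicator_of_notMem this, mul_zero]
  simp_rw [this]
  rw [lintegral_const_mul _ (kk_meas.indicator measurableSet_ball),
    lintegral_indicator measurableSet_ball, ← mul_assoc, ← ENNReal.ofReal_mul (by positivity)]
  rw [← ENNReal.ofReal_toReal hlt.ne, ENNReal.toReal_ofReal (by positivity),
    ← ENNReal.ofReal_mul (by positivity)]
  apply ENNReal.ofReal_le_ofReal
  set q := (∫⁻ z in Metric.ball (0:R3) 1, kk z).toReal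
  have hq : 0 ≤ q := by positivity
  have : r ^ 3 * r⁻¹ = r ^ 2 := by field_simp
  rw [this]; nlinarith [sq_nonneg r]

def c0 : ℝ := exists_c0.choose
lemma c0_pos : 0 < c0 := exists_c0.choose_spec.1
lemma c0_spec {r : ℝ} (hr : 0 < r) :
    ∫⁻ z, (Metric.ball (0:R3) r).indicator kk z ≤ ENNReal.ofReal (c0 * r ^ 2) :=
  exists_c0.choose_spec.2 r hr

/-- inner estimate -/
lemma inner_est (A : Set R3) (w : R3 → ℝ) (hw0 : ∀ y, 0 ≤ w y) (hw : AEMeasurable w)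
    (x : R3) (hA : MeasurableSet A) (Q t : ℝ) (ht : 0 ≤ t) (r : ℝ) (hr : 0 < r)
    (hQ0 : 0 ≤ Q)
    (hQ : ∫⁻ y, A.indicator (fun _ => ENNReal.ofReal (w y)) (x - y) ≤ ENNReal.ofReal Q) :
    ∫⁻ y, ENNReal.ofReal (min (w y) t) * A.indicator kk (x - y)
      ≤ ENNReal.ofReal (t * (c0 * r ^ 2) + Q / r) := by
  have hpt : ∀ y, ENNReal.ofReal (min (w y) t) * A.indicator kk (x - y)
      ≤ ENNReal.ofReal t * (Metric.ball (0:R3) r).indicator kk (x - y)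
        + ENNReal.ofReal (r⁻¹) * A.indicator (fun _ => ENNReal.ofReal (w y)) (x - y) := by
    intro y
    by_cases hy : x - y ∈ Metric.ball (0:R3) r
    · rw [indicator_of_mem hy]
      refine le_trans ?_ (le_add_right le_rfl)
      gcongr
      · exact min_le_right _ _
      · exact indicator_le_self _ _ _
    · refine le_trans ?_ (le_add_left le_rfl)
      by_cases hyA : x - y ∈ A
      · rw [indicator_of_mem hyA, indicator_of_mem hyA, mul_comm]
        gcongr
        · unfold kk
          apply ENNReal.ofReal_le_ofReal
          simp at hy
          gcongr
        · exact min_le_left _ _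
      · simp [indicator_of_notMem hyA]
  refine (lintegral_mono hpt).trans ?_
  have hm1 : Measurable fun y : R3 => (Metric.ball (0:R3) r).indicator kk (x - y) :=
    (kk_meas.indicator measurableSet_ball).comp (by fun_prop)
  rw [lintegral_add_left (hm1.const_mul _), lintegral_const_mul _ hm1, lintegral_const_mul' _ _ (by simp)]
  rw [lintegral_sub_left_eq_self (fun z => (Metric.ball (0:R3) r).indicator kk z) x]
  have h0 := c0_pos
  have h1 : 0 ≤ t * (c0 * r ^ 2) := by positivity
  rw [ENNReal.ofReal_add h1 (by positivity), ENNReal.ofReal_mul ht,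
    div_eq_inv_mul, ENNReal.ofReal_mul (p := r⁻¹) (q := Q) (by positivity)]
  exact add_le_add (mul_le_mul_right (c0_spec hr) _) (mul_le_mul_right hQ _)

lemma half_est (A : Set R3) (u w : R3 → ℝ) (hw0 : ∀ y, 0 ≤ w y) (hu0 : ∀ y, 0 ≤ u y)
    (hw : AEMeasurable w)
    (hA : MeasurableSet A) (Q κ l : ℝ) (hκ : 0 < κ) (hl : 0 < l)
    (hQ0 : 0 ≤ Q)
    (hQ : ∀ x, ∫⁻ y, A.indicator (fun _ => ENNReal.ofReal (w y)) (x - y) ≤ ENNReal.ofReal Q) :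
    ∫⁻ x, ENNReal.ofReal (u x) * ∫⁻ y, ENNReal.ofReal (min (w y) (κ * u x)) * A.indicator kk (x - y)
      ≤ ENNReal.ofReal (κ * c0 * l ^ 2 + Q / l) * ∫⁻ x, ENNReal.ofReal (u x ^ (4/3 : ℝ)) := by
  rw [← lintegral_const_mul' _ _ (by simp)]
  refine lintegral_mono fun x => ?_
  rcases (hu0 x).eq_or_lt with h0 | h0
  · simp [← h0]
  set t := u x
  have := c0_pos
  have h := inner_est A w hw0 hw x hA Q (κ * t) (by positivity) (l * t ^ (-(1/3) : ℝ)) (by positivity) hQ0 (hQ x)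
  refine (mul_le_mul_right h _).trans ?_
  rw [← ENNReal.ofReal_mul (by positivity), ← ENNReal.ofReal_mul (by positivity)]
  apply ENNReal.ofReal_le_ofReal
  apply le_of_eq
  have e1 : t ^ (4/3 : ℝ) = t * t ^ (1/3:ℝ) := by
    rw [← Real.rpow_one_add' h0.le (by norm_num)]; norm_num
  have e2 : t ^ (-(1/3) : ℝ) = (t ^ (1/3:ℝ))⁻¹ := by rw [Real.rpow_neg h0.le]
  have e3 : (t ^ (1/3:ℝ)) ^ 3 = t := by
    rw [← Real.rpow_natCast, ← Real.rpow_mul h0.le]; norm_num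
  rw [e1, e2]
  have hq : 0 < t ^ (1/3:ℝ) := by positivity
  set q := t ^ (1/3:ℝ)
  rw [← e3]
  field_simp

/-- main potential estimate -/
lemma pot_est (A : Set R3) (u w : R3 → ℝ) (hw0 : ∀ y, 0 ≤ w y) (hu0 : ∀ y, 0 ≤ u y)
    (hw : AEMeasurable w) (hu : AEMeasurable u)
    (hA : MeasurableSet A) (hAs : ∀ z, z ∈ A → -z ∈ A)
    (Qu Qw κ l m : ℝ) (hκ : 0 < κ) (hl : 0 < l) (hm : 0 < m)
    (hQu0 : 0 ≤ Qu) (hQw0 : 0 ≤ Qw)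
    (hQw : ∀ x, ∫⁻ y, A.indicator (fun _ => ENNReal.ofReal (w y)) (x - y) ≤ ENNReal.ofReal Qw)
    (hQu : ∀ x, ∫⁻ y, A.indicator (fun _ => ENNReal.ofReal (u y)) (x - y) ≤ ENNReal.ofReal Qu) :
    ∫⁻ x, ∫⁻ y, ENNReal.ofReal (u x) * ENNReal.ofReal (w y) * A.indicator kk (x - y)
      ≤ (ENNReal.ofReal (κ * c0 * l ^ 2 + Qw / l) * ∫⁻ x, ENNReal.ofReal (u x ^ (4/3 : ℝ)))
       + ENNReal.ofReal (c0 * m ^ 2 / κ + Qu / m) * ∫⁻ x, ENNReal.ofReal (w x ^ (4/3 : ℝ)) := by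
  have hpt : ∀ x y, ENNReal.ofReal (u x) * ENNReal.ofReal (w y) * A.indicator kk (x - y)
      ≤ ENNReal.ofReal (u x) * (ENNReal.ofReal (min (w y) (κ * u x)) * A.indicator kk (x - y))
       + ENNReal.ofReal (w y) * (ENNReal.ofReal (min (u x) (κ⁻¹ * w y)) * A.indicator kk (x - y)) := by
    intro x y
    rcases le_total (w y) (κ * u x) with h | h
    · rw [min_eq_left h, mul_assoc]; exact le_add_right le_rfl
    · have : u x ≤ κ⁻¹ * w y := by rw [le_inv_mul_iff₀ hκ]; exact h
      rw [min_eq_left this]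
      refine le_trans ?_ (le_add_left le_rfl)
      rw [mul_comm (ENNReal.ofReal (u x)), mul_assoc]
  have mu : AEMeasurable (fun p : R3 × R3 => u p.1) (volume.prod volume) := hu.comp_fst
  have mw : AEMeasurable (fun p : R3 × R3 => w p.2) (volume.prod volume) := hw.comp_snd
  have mk : Measurable (fun p : R3 × R3 => A.indicator kk (p.1 - p.2)) :=
    (kk_meas.indicator hA).comp (by fun_prop)
  have m1 : AEMeasurable (fun p : R3 × R3 => ENNReal.ofReal (u p.1) *
      (ENNReal.ofReal (min (w p.2) (κ * u p.1)) * A.indicator kk (p.1 - p.2))) (volume.prod volume) :=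
    mu.ennreal_ofReal.mul ((mw.min (mu.const_mul κ)).ennreal_ofReal.mul mk.aemeasurable)
  have m2 : AEMeasurable (fun p : R3 × R3 => ENNReal.ofReal (w p.2) *
      (ENNReal.ofReal (min (u p.1) (κ⁻¹ * w p.2)) * A.indicator kk (p.1 - p.2))) (volume.prod volume) :=
    mw.ennreal_ofReal.mul ((mu.min (mw.const_mul _)).ennreal_ofReal.mul mk.aemeasurable)
  have h1 := half_est A u w hw0 hu0 hw hA Qw κ l hκ hl hQw0 hQw
  have h2 := half_est A w u hu0 hw0 hu hA Qu κ⁻¹ m (by positivity) hm hQu0 hQu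
  have hsw : ∀ x y : R3, A.indicator kk (x - y) = A.indicator kk (y - x) := by
    intro x y
    by_cases h : x - y ∈ A
    · have h' : y - x ∈ A := by have := hAs _ h; rwa [neg_sub] at this
      rw [indicator_of_mem h, indicator_of_mem h', ← kk_neg, neg_sub]
    · have h' : y - x ∉ A := fun h2 => h (by have := hAs _ h2; rwa [neg_sub] at this)
      rw [indicator_of_notMem h, indicator_of_notMem h']
  refine (lintegral_mono fun x => lintegral_mono fun y => hpt x y).trans ?_
  have e := lintegral_add_left' m1 (fun p : R3 × R3 => ENNReal.ofReal (w p.2) *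
          (ENNReal.ofReal (min (u p.1) (κ⁻¹ * w p.2)) * A.indicator kk (p.1 - p.2)))
  erw [lintegral_prod _ (m1.add m2)] at e
  rw [lintegral_prod _ m1, lintegral_prod _ m2] at e
  refine (le_of_eq e).trans ?_
  apply add_le_add
  · refine le_trans (le_of_eq ?_) h1
    refine lintegral_congr fun x => ?_
    dsimp only
    rw [lintegral_const_mul' _ _ (by simp)]
  · rw [lintegral_lintegral_swap m2]
    refine le_trans (le_of_eq ?_) (h2.trans (le_of_eq ?_))
    · refine lintegral_congr fun x => ?_
      dsimp only
      rw [lintegral_const_mul' _ _ (by simp)]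
      simp_rw [hsw x]
    · congr 3; ring

structure Good (σ : R3 → ℝ) : Prop where
  int : Integrable σ
  p43 : Integrable (fun x => |σ x| ^ (4/3 : ℝ))

def XX (σ : R3 → ℝ) : ℝ := ∫ x, |σ x| ^ (4/3 : ℝ)
def N1 (σ : R3 → ℝ) : ℝ := ∫ x, |σ x|

lemma XX_nonneg (σ : R3 → ℝ) : 0 ≤ XX σ := integral_nonneg fun x => by positivity
lemma N1_nonneg (σ : R3 → ℝ) : 0 ≤ N1 σ := integral_nonneg fun x => by positivity

lemma rpow43_add (a b : ℝ) : |a + b| ^ (4/3:ℝ) ≤ 2 * (|a| ^ (4/3:ℝ) + |b| ^ (4/3:ℝ)) := by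
  have h1 : |a + b| ^ (4/3:ℝ) ≤ (|a| + |b|) ^ (4/3:ℝ) :=
    Real.rpow_le_rpow (abs_nonneg _) (abs_add_le a b) (by norm_num)
  have h2 := NNReal.rpow_add_le_mul_rpow_add_rpow ‖a‖₊ ‖b‖₊ (p := 4/3) (by norm_num)
  have h2' : (|a| + |b|) ^ (4/3:ℝ) ≤ 2 ^ ((4/3:ℝ) - 1) * (|a| ^ (4/3:ℝ) + |b| ^ (4/3:ℝ)) := by
    exact_mod_cast h2
  have h3 : (2:ℝ) ^ ((4/3:ℝ) - 1) ≤ 2 := by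
    calc (2:ℝ) ^ ((4/3:ℝ) - 1) ≤ (2:ℝ) ^ (1:ℝ) := Real.rpow_le_rpow_of_exponent_le (by norm_num) (by norm_num)
      _ = 2 := by simp
  refine h1.trans (h2'.trans ?_)
  gcongr

lemma meas43 {σ : R3 → ℝ} (h : AEStronglyMeasurable σ) :
    AEStronglyMeasurable (fun x => |σ x| ^ (4/3 : ℝ)) :=
  (h.aemeasurable.norm.pow_const (4/3:ℝ)).aestronglyMeasurable

lemma Good.add {a b : R3 → ℝ} (ha : Good a) (hb : Good b) : Good (fun x => a x + b x) := by
  refine ⟨ha.int.add hb.int, ?_⟩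
  refine ((ha.p43.add hb.p43).const_mul 2).mono' (meas43 (ha.int.add hb.int).1) ?_
  refine Eventually.of_forall fun x => ?_
  rw [Real.norm_of_nonneg (by positivity)]
  exact rpow43_add _ _

lemma Good.neg {a : R3 → ℝ} (ha : Good a) : Good (fun x => - a x) := by
  refine ⟨ha.int.neg, ?_⟩
  simpa using ha.p43

lemma Good.sub {a b : R3 → ℝ} (ha : Good a) (hb : Good b) : Good (fun x => a x - b x) := by
  simpa [sub_eq_add_neg] using ha.add hb.neg

lemma XX_neg (a : R3 → ℝ) : XX (fun x => - a x) = XX a := by simp [XX]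
lemma N1_neg (a : R3 → ℝ) : N1 (fun x => - a x) = N1 a := by simp [N1]

lemma XX_add {a b : R3 → ℝ} (ha : Good a) (hb : Good b) :
    XX (fun x => a x + b x) ≤ 2 * (XX a + XX b) := by
  unfold XX
  rw [← integral_add ha.p43 hb.p43, ← integral_const_mul]
  exact integral_mono (ha.add hb).p43 ((ha.p43.add hb.p43).const_mul 2) fun x => rpow43_add _ _

lemma XX_sub {a b : R3 → ℝ} (ha : Good a) (hb : Good b) :
    XX (fun x => a x - b x) ≤ 2 * (XX a + XX b) := by
  have := XX_add ha hb.neg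
  simpa [sub_eq_add_neg, XX_neg] using this

lemma N1_add {a b : R3 → ℝ} (ha : Good a) (hb : Good b) :
    N1 (fun x => a x + b x) ≤ N1 a + N1 b := by
  unfold N1
  rw [← integral_add ha.int.abs hb.int.abs]
  exact integral_mono (ha.add hb).int.abs (ha.int.abs.add hb.int.abs) fun x => abs_add_le _ _

lemma N1_sub {a b : R3 → ℝ} (ha : Good a) (hb : Good b) :
    N1 (fun x => a x - b x) ≤ N1 a + N1 b := by
  have := N1_add ha hb.neg
  simpa [sub_eq_add_neg, N1_neg] using this

lemma Good.mono {a b : R3 → ℝ} (ha : Good a) (hb : AEStronglyMeasurable b) (h : ∀ x, |b x| ≤ |a x|) :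
    Good b := by
  refine ⟨ha.int.mono hb (Eventually.of_forall h), ha.p43.mono' (meas43 hb) ?_⟩
  refine Eventually.of_forall fun x => ?_
  rw [Real.norm_of_nonneg (by positivity)]
  exact Real.rpow_le_rpow (abs_nonneg _) (h x) (by norm_num)

lemma XX_mono {a b : R3 → ℝ} (ha : Good a) (hb : Good b) (h : ∀ x, |b x| ≤ |a x|) : XX b ≤ XX a :=
  integral_mono hb.p43 ha.p43 fun x => Real.rpow_le_rpow (abs_nonneg _) (h x) (by norm_num)

lemma N1_mono {a b : R3 → ℝ} (ha : Good a) (hb : Good b) (h : ∀ x, |b x| ≤ |a x|) : N1 b ≤ N1 a :=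
  integral_mono hb.int.abs ha.int.abs fun x => h x

lemma Good.ind {a : R3 → ℝ} (ha : Good a) {A : Set R3} (hA : MeasurableSet A) : Good (A.indicator a) :=
  ha.mono (ha.int.1.indicator hA) fun x => by
    by_cases hx : x ∈ A
    · simp [hx]
    · simp [hx]

def EA (A : Set R3) (u w : R3 → ℝ) : ℝ≥0∞ :=
  ∫⁻ x, ∫⁻ y, ENNReal.ofReal |u x| * ENNReal.ofReal |w y| * A.indicator kk (x - y)

/-- `Q` bounds the mass of `|w|` in all translates of `A`. -/
def QB (A : Set R3) (w : R3 → ℝ) (Q : ℝ) : Prop :=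
  ∀ x, ∫⁻ y, A.indicator (fun _ => ENNReal.ofReal |w y|) (x - y) ≤ ENNReal.ofReal Q

lemma N1_lint {w : R3 → ℝ} (hw : Good w) : ∫⁻ y, ENNReal.ofReal |w y| = ENNReal.ofReal (N1 w) := by
  unfold N1
  rw [ofReal_integral_eq_lintegral_ofReal hw.int.abs (Eventually.of_forall fun x => abs_nonneg _)]

lemma XX_lint {w : R3 → ℝ} (hw : Good w) :
    ∫⁻ y, ENNReal.ofReal (|w y| ^ (4/3:ℝ)) = ENNReal.ofReal (XX w) := by
  unfold XX
  rw [ofReal_integral_eq_lintegral_ofReal hw.p43 (Eventually.of_forall fun x => by positivity)]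

lemma QB_N1 (A : Set R3) {w : R3 → ℝ} (hw : Good w) : QB A w (N1 w) := by
  intro x
  rw [← N1_lint hw]
  exact lintegral_mono fun y => by
    by_cases h : x - y ∈ A
    · simp [h]
    · simp [h]

lemma EA_est {A : Set R3} {u w : R3 → ℝ} (hu : Good u) (hw : Good w)
    (hA : MeasurableSet A) (hAs : ∀ z, z ∈ A → -z ∈ A)
    {Qu Qw κ l m : ℝ} (hκ : 0 < κ) (hl : 0 < l) (hm : 0 < m)
    (hQu0 : 0 ≤ Qu) (hQw0 : 0 ≤ Qw) (hQw : QB A w Qw) (hQu : QB A u Qu) :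
    EA A u w ≤ ENNReal.ofReal
      ((κ * c0 * l ^ 2 + Qw / l) * XX u + (c0 * m ^ 2 / κ + Qu / m) * XX w) := by
  have h := pot_est A (fun x => |u x|) (fun x => |w x|) (fun _ => abs_nonneg _) (fun _ => abs_nonneg _)
    hw.int.1.aemeasurable.norm hu.int.1.aemeasurable.norm hA hAs Qu Qw κ l m hκ hl hm hQu0 hQw0 hQw hQu
  have := c0_pos
  have x1 := XX_nonneg u
  have x2 := XX_nonneg w
  have p1 : 0 ≤ κ * c0 * l ^ 2 + Qw / l := by positivity
  have p2 : 0 ≤ c0 * m ^ 2 / κ + Qu / m := by positivity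
  rw [XX_lint hu, XX_lint hw, ← ENNReal.ofReal_mul p1, ← ENNReal.ofReal_mul p2,
    ← ENNReal.ofReal_add (by positivity) (by positivity)] at h
  exact h

lemma EA_small {A : Set R3} {u w : R3 → ℝ} (hu : Good u) (hw : Good w)
    (hA : MeasurableSet A) (hAs : ∀ z, z ∈ A → -z ∈ A) {B τ : ℝ} (hB : 0 ≤ B) (hτ : 0 < τ)
    (hXu : XX u ≤ B) (hXw : XX w ≤ B) (hQw : QB A w (τ ^ 3)) (hQu : QB A u B) :
    EA A u w ≤ ENNReal.ofReal (τ * (B * (2 * c0 + 1 + B))) := by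
  refine (EA_est hu hw hA hAs (κ := (τ ^ 3)⁻¹) (l := τ ^ 2) (m := τ⁻¹) (by positivity) (by positivity)
    (by positivity) hB (by positivity) hQw hQu).trans (ENNReal.ofReal_le_ofReal ?_)
  have := c0_pos
  have e1 : (τ ^ 3)⁻¹ * c0 * (τ ^ 2) ^ 2 + τ ^ 3 / τ ^ 2 = τ * (c0 + 1) := by field_simp
  have e2 : c0 * τ⁻¹ ^ 2 / (τ ^ 3)⁻¹ + B / τ⁻¹ = τ * (c0 + B) := by field_simp
  rw [e1, e2]
  calc τ * (c0 + 1) * XX u + τ * (c0 + B) * XX w ≤ τ * (c0 + 1) * B + τ * (c0 + B) * B := by gcongr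
    _ = _ := by ring

/-- bilinear form -/
def Db (u w : R3 → ℝ) : ℝ := ∫ p : R3 × R3, u p.1 * w p.2 / ‖p.1 - p.2‖

lemma Db_aesm {u w : R3 → ℝ} (hu : AEStronglyMeasurable u) (hw : AEStronglyMeasurable w) :
    AEStronglyMeasurable (fun p : R3 × R3 => u p.1 * w p.2 / ‖p.1 - p.2‖) := by
  have h1 : AEMeasurable (fun p : R3 × R3 => u p.1) (volume.prod volume) := hu.aemeasurable.comp_fst
  have h2 : AEMeasurable (fun p : R3 × R3 => w p.2) (volume.prod volume) := hw.aemeasurable.comp_snd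
  exact ((h1.mul h2).div (by fun_prop)).aestronglyMeasurable

lemma EA_prod {A : Set R3} (hA : MeasurableSet A) {u w : R3 → ℝ}
    (hu : AEStronglyMeasurable u) (hw : AEStronglyMeasurable w) :
    EA A u w = ∫⁻ p : R3 × R3, ENNReal.ofReal |u p.1| * ENNReal.ofReal |w p.2| * A.indicator kk (p.1 - p.2) := by
  have h1 : AEMeasurable (fun p : R3 × R3 => u p.1) (volume.prod volume) := hu.aemeasurable.comp_fst
  have h2 : AEMeasurable (fun p : R3 × R3 => w p.2) (volume.prod volume) := hw.aemeasurable.comp_snd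
  have mk : Measurable (fun p : R3 × R3 => A.indicator kk (p.1 - p.2)) :=
    (kk_meas.indicator hA).comp (by fun_prop)
  rw [Measure.volume_eq_prod, lintegral_prod]
  · rfl
  · exact (h1.norm.ennreal_ofReal.mul h2.norm.ennreal_ofReal).mul mk.aemeasurable

lemma enorm_kern (u w : R3 → ℝ) (p : R3 × R3) : ‖u p.1 * w p.2 / ‖p.1 - p.2‖‖ₑ
    = ENNReal.ofReal |u p.1| * ENNReal.ofReal |w p.2| * kk (p.1 - p.2) := by
  rw [← ENNReal.ofReal_mul (by positivity)]
  unfold kk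
  rw [← ENNReal.ofReal_mul (by positivity), Real.enorm_eq_ofReal_abs]
  congr 1
  rw [abs_div, abs_mul, abs_norm, div_eq_mul_inv]

lemma EA_univ_fin {u w : R3 → ℝ} (hu : Good u) (hw : Good w) : EA univ u w < ∞ :=
  (EA_est hu hw MeasurableSet.univ (fun _ _ => mem_univ _) one_pos one_pos one_pos (N1_nonneg u) (N1_nonneg w)
    (QB_N1 _ hw) (QB_N1 _ hu)).trans_lt ENNReal.ofReal_lt_top

lemma Db_int {u w : R3 → ℝ} (hu : Good u) (hw : Good w) :
    Integrable (fun p : R3 × R3 => u p.1 * w p.2 / ‖p.1 - p.2‖) := by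
  refine ⟨Db_aesm hu.int.1 hw.int.1, ?_⟩
  have := EA_univ_fin hu hw
  rw [EA_prod MeasurableSet.univ hu.int.1 hw.int.1] at this
  unfold HasFiniteIntegral
  simp_rw [enorm_kern]
  simpa using this

lemma Dpair_eq {u : R3 → ℝ} (hu : Good u) : Dpair u = Db u u := by
  unfold Dpair Db
  have := Db_int hu hu
  rw [Measure.volume_eq_prod] at this ⊢
  rw [integral_prod _ this]

lemma Db_symm (u w : R3 → ℝ) : Db u w = Db w u := by
  unfold Db
  rw [Measure.volume_eq_prod, ← integral_prod_swap]
  congr 1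
  ext p
  simp [mul_comm, norm_sub_rev]

lemma Db_add_left {u v w : R3 → ℝ} (hu : Good u) (hv : Good v) (hw : Good w) :
    Db (fun x => u x + v x) w = Db u w + Db v w := by
  unfold Db
  rw [← integral_add (Db_int hu hw) (Db_int hv hw)]
  congr 1; ext p; ring

lemma Db_neg_left (u w : R3 → ℝ) : Db (fun x => - u x) w = - Db u w := by
  unfold Db
  rw [← integral_neg]
  congr 1; ext p; ring

lemma Db_smul_left (c : ℝ) (u w : R3 → ℝ) : Db (fun x => c * u x) w = c * Db u w := by
  unfold Db
  rw [← integral_const_mul]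
  congr 1; ext p; ring

lemma Db_sub_left {u v w : R3 → ℝ} (hu : Good u) (hv : Good v) (hw : Good w) :
    Db (fun x => u x - v x) w = Db u w - Db v w := by
  have := Db_add_left hu hv.neg hw
  rw [Db_neg_left] at this
  simpa [sub_eq_add_neg] using this

lemma Db_nonneg {u w : R3 → ℝ} (hu : ∀ x, 0 ≤ u x) (hw : ∀ x, 0 ≤ w x) : 0 ≤ Db u w :=
  integral_nonneg fun p => by have := hu p.1; have := hw p.2; positivity

lemma N1_prod {u w : R3 → ℝ} (hu : Good u) (hw : Good w) :
    ∫⁻ p : R3 × R3, ENNReal.ofReal |u p.1| * ENNReal.ofReal |w p.2| = ENNReal.ofReal (N1 u * N1 w) := by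
  rw [ENNReal.ofReal_mul (N1_nonneg u), ← N1_lint hu, ← N1_lint hw, Measure.volume_eq_prod]
  exact lintegral_prod_mul hu.int.1.aemeasurable.norm.ennreal_ofReal hw.int.1.aemeasurable.norm.ennreal_ofReal

/-- near-far estimate -/
lemma Db_near_far {u w : R3 → ℝ} (hu : Good u) (hw : Good w) {R C : ℝ} (hR : 0 < R) (hC : 0 ≤ C)
    (h : EA (Metric.ball 0 R) u w ≤ ENNReal.ofReal C) : |Db u w| ≤ C + N1 u * N1 w / R := by
  have n1 := N1_nonneg u
  have n2 := N1_nonneg w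
  have h1 : ENNReal.ofReal |Db u w| ≤ ENNReal.ofReal (C + N1 u * N1 w / R) := by
    rw [← Real.enorm_eq_ofReal_abs]
    refine (enorm_integral_le_lintegral_enorm _).trans ?_
    simp_rw [enorm_kern]
    have hpt : ∀ p : R3 × R3, ENNReal.ofReal |u p.1| * ENNReal.ofReal |w p.2| * kk (p.1 - p.2) ≤
       ENNReal.ofReal |u p.1| * ENNReal.ofReal |w p.2| * (Metric.ball 0 R).indicator kk (p.1 - p.2)
        + ENNReal.ofReal (R⁻¹) * (ENNReal.ofReal |u p.1| * ENNReal.ofReal |w p.2|) := by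
      intro p
      by_cases hp : p.1 - p.2 ∈ Metric.ball (0:R3) R
      · rw [indicator_of_mem hp]; exact le_add_right le_rfl
      · refine le_trans ?_ (le_add_left le_rfl)
        rw [mul_comm]
        gcongr
        unfold kk
        apply ENNReal.ofReal_le_ofReal
        simp at hp
        gcongr
    refine (lintegral_mono hpt).trans ?_
    have m1 : AEMeasurable (fun p : R3 × R3 => u p.1) (volume.prod volume) := hu.int.1.aemeasurable.comp_fst
    have m2 : AEMeasurable (fun p : R3 × R3 => w p.2) (volume.prod volume) := hw.int.1.aemeasurable.comp_snd
    have m3 : AEMeasurable (fun p : R3 × R3 => ENNReal.ofReal (R⁻¹) *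
        (ENNReal.ofReal |u p.1| * ENNReal.ofReal |w p.2|)) :=
      (m1.norm.ennreal_ofReal.mul m2.norm.ennreal_ofReal).const_mul _
    rw [lintegral_add_right' _ m3,
      lintegral_const_mul' _ _ (by simp), N1_prod hu hw, ← EA_prod measurableSet_ball hu.int.1 hw.int.1,
      ENNReal.ofReal_add hC (by positivity), div_eq_inv_mul, ENNReal.ofReal_mul (p := R⁻¹) (by positivity)]
    gcongr
  rwa [ENNReal.ofReal_le_ofReal_iff (by positivity)] at h1

lemma Db_le_univ {u w : R3 → ℝ} (hu : Good u) (hw : Good w) {C : ℝ} (hC : 0 ≤ C)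
    (h : EA univ u w ≤ ENNReal.ofReal C) : |Db u w| ≤ C := by
  rw [← ENNReal.ofReal_le_ofReal_iff hC, ← Real.enorm_eq_ofReal_abs]
  refine (enorm_integral_le_lintegral_enorm _).trans ?_
  rw [EA_prod MeasurableSet.univ hu.int.1 hw.int.1] at h
  simp_rw [enorm_kern]
  simpa using h

lemma Db_lin_est {u : R3 → ℝ} (hu : Good u) : |Db u u| ≤ 2 * (c0 + N1 u) * XX u := by
  have := c0_pos
  have n1 := N1_nonneg u
  have x1 := XX_nonneg u
  refine Db_le_univ hu hu (by positivity) ?_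
  refine (EA_est hu hu MeasurableSet.univ (fun _ _ => mem_univ _) one_pos one_pos one_pos (N1_nonneg u) (N1_nonneg u)
    (QB_N1 _ hu) (QB_N1 _ hu)).trans (le_of_eq ?_)
  congr 1; ring

lemma Db_small {u w : R3 → ℝ} (hu : Good u) (hw : Good w) {B τ : ℝ} (hB : 0 ≤ B) (hτ : 0 < τ)
    (hXu : XX u ≤ B) (hXw : XX w ≤ B) (hQw : N1 w ≤ τ ^ 3) (hQu : N1 u ≤ B) :
    |Db u w| ≤ τ * (B * (2 * c0 + 1 + B)) := by
  have := c0_pos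
  refine Db_le_univ hu hw (by positivity) ?_
  refine EA_small hu hw MeasurableSet.univ (fun _ _ => mem_univ _) hB hτ hXu hXw ?_ ?_
  · exact fun x => (QB_N1 _ hw x).trans (ENNReal.ofReal_le_ofReal hQw)
  · exact fun x => (QB_N1 _ hu x).trans (ENNReal.ofReal_le_ofReal hQu)

section phi
variable {Φ Φ' : ℝ → ℝ} {k k' : ℝ}

lemma phi_cont (h : IsPhi Φ Φ' k k') : ContinuousOn Φ (Ici 0) :=
  fun s hs => (h.hasDeriv s hs).continuousAt.continuousWithinAt

lemma phi_cont_max (h : IsPhi Φ Φ' k k') : Continuous (fun s => Φ (max s 0)) :=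
  (phi_cont h).comp_continuous (by fun_prop) (fun s => mem_Ici.2 (le_max_right _ _))

lemma phi_mono (h : IsPhi Φ Φ' k k') {s t : ℝ} (hs : 0 ≤ s) (hst : s ≤ t) : Φ s ≤ Φ t := by
  rcases hs.eq_or_lt with h0 | h0
  · rw [← h0, h.zero]; exact h.nonneg t (hs.trans hst)
  have ht : 0 < t := h0.trans_le hst
  have hq : 0 ≤ 1 - s / t := by rw [sub_nonneg, div_le_one ht]; exact hst
  have hq' : 0 ≤ s / t := by positivity
  have hc := h.sconvex.convexOn.2 (mem_Ici.2 le_rfl) (mem_Ici.2 ht.le) hq hq' (by ring)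
  simp only [smul_eq_mul, mul_zero, zero_add, h.zero] at hc
  rw [div_mul_cancel₀ _ ht.ne'] at hc
  have h1 : s / t ≤ 1 := by rw [div_le_one ht]; exact hst
  have := h.nonneg t ht.le
  nlinarith

lemma phi_aesm (h : IsPhi Φ Φ' k k') {α : Type*} [MeasurableSpace α] {μ : Measure α} {g : α → ℝ}
    (hg0 : ∀ p, 0 ≤ g p) (hg : AEStronglyMeasurable g μ) : AEStronglyMeasurable (fun p => Φ (g p)) μ := by
  have := (phi_cont_max h).comp_aestronglyMeasurable hg
  refine this.congr (Eventually.of_forall fun p => ?_)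
  simp [max_eq_left (hg0 p)]

lemma phi_superlin (h : IsPhi Φ Φ' k k') : ∃ C > 0, ∃ F₁ > 0, ∀ K, F₁ ≤ K → ∀ s, 0 ≤ s →
    s ≤ K + Φ s / (C * K ^ (1/k)) := by
  obtain ⟨C, hC, F, hF, hg⟩ := h.growth_large
  refine ⟨C, hC, F, hF, fun K hK s hs => ?_⟩
  have hK0 : 0 < K := hF.trans_le hK
  have hp := h.nonneg s hs
  have hk := h.k_pos
  rcases le_total s K with h1 | h1
  · have : 0 ≤ Φ s / (C * K ^ (1/k)) := by positivity
    linarith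
  · have h2 := hg s (hK.trans h1)
    have hs0 : 0 < s := hK0.trans_le h1
    rw [Real.rpow_add hs0, Real.rpow_one] at h2
    have h3 : K ^ (1/k) ≤ s ^ (1/k) := Real.rpow_le_rpow hK0.le h1 (by positivity)
    have h4 : s ≤ Φ s / (C * K ^ (1/k)) := by
      rw [le_div_iff₀ (by positivity)]
      calc s * (C * K ^ (1/k)) ≤ s * (C * s ^ (1/k)) := by gcongr
        _ = C * (s * s ^ (1/k)) := by ring
        _ ≤ Φ s := h2
    linarith

def om : ℝ := (volume (Metric.ball (0:R3) 1)).toReal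

lemma om_pos : 0 < om := ENNReal.toReal_pos (Metric.measure_ball_pos _ _ one_pos).ne' measure_ball_lt_top.ne

lemma vol_ball (x : R3) {V : ℝ} (hV : 0 < V) : volume.real (Metric.ball x V) = om * V ^ 3 := by
  rw [Measure.real, Measure.addHaar_ball _ _ hV.le]
  simp only [finrank_euclideanSpace, Fintype.card_fin]
  rw [ENNReal.toReal_mul, ENNReal.toReal_ofReal (by positivity), om, mul_comm]

lemma vel_basic {g : R3 → ℝ} (hg0 : ∀ v, 0 ≤ g v) (h : IsPhi Φ Φ' k k')
    (hgi : Integrable g) (hk : Integrable (fun v => ‖v‖ ^ 2 * g v)) (hp : Integrable (fun v => Φ (g v)))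
    {V K D : ℝ} (hV : 0 < V) (hD : 0 < D) (hK0 : 0 < K) (hK : ∀ s, 0 ≤ s → s ≤ K + Φ s / D) :
    ∫ v, g v ≤ K * (om * V ^ 3) + (∫ v, Φ (g v)) / D + (∫ v, ‖v‖ ^ 2 * g v) / V ^ 2 := by
  have hb : Integrable ((Metric.ball (0:R3) V).indicator (fun _ => K)) :=
    (integrable_indicator_iff measurableSet_ball).2 (integrableOn_const measure_ball_lt_top.ne)
  have h1 : ∫ v, g v ≤ ∫ v, ((Metric.ball (0:R3) V).indicator (fun _ => K) v + Φ (g v) / D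
      + (‖v‖ ^ 2 * g v) / V ^ 2) := by
    refine integral_mono hgi ((hb.add (hp.div_const D)).add (hk.div_const (V ^ 2))) fun v => ?_
    have hpn := h.nonneg (g v) (hg0 v)
    have hgv := hg0 v
    by_cases hv : v ∈ Metric.ball (0:R3) V
    · simp only [indicator_of_mem hv]
      have := hK (g v) (hg0 v)
      have : 0 ≤ ‖v‖ ^ 2 * g v / V ^ 2 := by positivity
      linarith
    · simp only [indicator_of_notMem hv]
      simp at hv
      have h2 : g v ≤ ‖v‖ ^ 2 * g v / V ^ 2 := by
        rw [le_div_iff₀ (by positivity), mul_comm]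
        gcongr
      have : 0 ≤ Φ (g v) / D := by positivity
      linarith
  refine h1.trans (le_of_eq ?_)
  rw [integral_add (f := fun v => (Metric.ball (0:R3) V).indicator (fun _ => K) v + Φ (g v) / D)
    (hb.add (hp.div_const D)) (hk.div_const (V ^ 2)),
    integral_add hb (hp.div_const D), integral_div, integral_div, integral_indicator measurableSet_ball,
    setIntegral_const, vol_ball _ hV, smul_eq_mul]
  ring

lemma vel_est (h : IsPhi Φ Φ' k k') {δ : ℝ} (hδ : 0 < δ) : ∃ Cδ : ℝ, 0 ≤ Cδ ∧ ∀ g : R3 → ℝ, (∀ v, 0 ≤ g v) →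
    Integrable g → Integrable (fun v => ‖v‖ ^ 2 * g v) → Integrable (fun v => Φ (g v)) →
    (∫ v, g v) ^ (4/3 : ℝ) ≤ δ * ((1/2) * (∫ v, ‖v‖ ^ 2 * g v) + ∫ v, Φ (g v)) + Cδ * ∫ v, g v := by
  obtain ⟨C, hC, F, hF, hs⟩ := phi_superlin h
  have hk := h.k_pos
  have hk2 := h.k_lt
  have ho := om_pos
  set d := Real.sqrt (4 / δ) with hd
  have hd0 : 0 < d := by positivity
  have hd2 : d ^ 2 = 4 / δ := Real.sq_sqrt (by positivity)
  set a := (2 * om * d ^ 3)⁻¹ with ha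
  have ha0 : 0 < a := by positivity
  -- eventually conditions
  have ev1 : ∀ᶠ y : ℝ in atTop, F ≤ a * y ^ 3 :=
    ((tendsto_pow_atTop (by norm_num : (3:ℕ) ≠ 0)).const_mul_atTop ha0).eventually_ge_atTop F
  have hexp : 0 < 3 / k - 2 := by
    rw [sub_pos, lt_div_iff₀ hk]; linarith
  have ev2 : ∀ᶠ y : ℝ in atTop, d ^ 2 / (C * a ^ (1/k)) ≤ y ^ (3 / k - 2) :=
    (tendsto_rpow_atTop hexp).eventually_ge_atTop _
  obtain ⟨Y, hY⟩ := ((ev1.and ev2).and (eventually_gt_atTop 0)).exists_forall_of_atTop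
  set T := max Y 1 with hT
  have hT0 : 0 < T := by positivity
  refine ⟨T ^ 2, by positivity, fun g hg0 hgi hgk hgp => ?_⟩
  set ρ := ∫ v, g v with hρ
  have hρ0 : 0 ≤ ρ := integral_nonneg hg0
  have hkin0 : 0 ≤ ∫ v, ‖v‖ ^ 2 * g v := integral_nonneg fun v => by have := hg0 v; positivity
  have hphi0 : 0 ≤ ∫ v, Φ (g v) := integral_nonneg fun v => h.nonneg _ (hg0 v)
  set y := ρ ^ (1/6 : ℝ) with hy
  have hy0 : 0 ≤ y := by positivity
  have e6 : y ^ 6 = ρ := by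
    rw [hy, ← Real.rpow_natCast, ← Real.rpow_mul hρ0]; norm_num
  have e43 : ρ ^ (4/3 : ℝ) = ρ * y ^ 2 := by
    rw [hy, ← Real.rpow_natCast, ← Real.rpow_mul hρ0, ← Real.rpow_one_add' hρ0 (by norm_num)]; norm_num
  rw [e43]
  rcases le_total y T with hyT | hyT
  · have : y ^ 2 ≤ T ^ 2 := by gcongr
    have h3 : 0 ≤ δ * ((1/2) * (∫ v, ‖v‖ ^ 2 * g v) + ∫ v, Φ (g v)) := by positivity
    nlinarith
  · have hyY : Y ≤ y := (le_max_left _ _).trans hyT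
    obtain ⟨⟨c1, c2⟩, hypos⟩ := hY y hyY
    have hV : 0 < d * y := by positivity
    have hK0 : 0 < a * y ^ 3 := by positivity
    have hKk : d ^ 2 * y ^ 2 ≤ C * (a * y ^ 3) ^ (1/k) := by
      rw [Real.mul_rpow ha0.le (by positivity), ← Real.rpow_natCast y 3, ← Real.rpow_mul hy0]
      rw [Real.rpow_sub hypos, div_le_div_iff₀ (by positivity) (by positivity)] at c2
      have e : ((3:ℕ):ℝ) * (1/k) = 3 / k := by push_cast; ring
      rw [e]
      have e' : y ^ (2:ℝ) = y ^ 2 := by norm_cast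
      rw [e'] at c2
      linarith
    have hmain := vel_basic hg0 h hgi hgk hgp (V := d * y) (K := a * y ^ 3) (D := d ^ 2 * y ^ 2) hV
      (by positivity) hK0 (by
        intro s hs0
        refine (hs _ c1 s hs0).trans ?_
        gcongr
        exact h.nonneg s hs0)
    have eK : a * y ^ 3 * (om * (d * y) ^ 3) = ρ / 2 := by
      rw [ha, ← e6]; field_simp
    rw [eK, ← hρ] at hmain
    have hm2 : ρ / 2 ≤ ((∫ v, Φ (g v)) + ∫ v, ‖v‖ ^ 2 * g v) / (d ^ 2 * y ^ 2) := by
      rw [add_div]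
      rw [mul_pow] at hmain
      linarith
    rw [le_div_iff₀ (by positivity), hd2] at hm2
    have h4 : ρ * y ^ 2 * (2 / δ) ≤ (∫ v, Φ (g v)) + ∫ v, ‖v‖ ^ 2 * g v := by
      calc ρ * y ^ 2 * (2 / δ) = ρ / 2 * (4 / δ * y ^ 2) := by ring
        _ ≤ _ := hm2
    have h5 : ρ * y ^ 2 ≤ δ / 2 * ((∫ v, Φ (g v)) + ∫ v, ‖v‖ ^ 2 * g v) := by
      calc ρ * y ^ 2 = δ / 2 * (ρ * y ^ 2 * (2 / δ)) := by field_simp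
        _ ≤ _ := by gcongr
    have h6 : 0 ≤ T ^ 2 * ρ := by positivity
    nlinarith [mul_nonneg hδ.le hphi0]

end phi

/-- kinetic plus Casimir -/
def PP (Φ : ℝ → ℝ) (f : R3 × R3 → ℝ) : ℝ := Ekin f + Casimir Φ f

section dens
variable {Φ Φ' : ℝ → ℝ} {k k' : ℝ} {M : ℝ} {f : R3 × R3 → ℝ}

lemma rho_nonneg (hf : MemFM Φ M f) (x : R3) : 0 ≤ spatialDensity f x :=
  integral_nonneg fun v => hf.nonneg _

lemma rho_int (hf : MemFM Φ M f) : Integrable (spatialDensity f) := by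
  have := hf.integrable
  rw [Measure.volume_eq_prod] at this
  exact this.integral_prod_left

lemma rho_mass (hf : MemFM Φ M f) : ∫ x, spatialDensity f x = M := by
  have := hf.integrable
  rw [Measure.volume_eq_prod] at this
  rw [← hf.mass, Measure.volume_eq_prod, integral_prod _ this]
  rfl

lemma rho_N1 (hf : MemFM Φ M f) : N1 (spatialDensity f) = M := by
  rw [← rho_mass hf]
  unfold N1
  congr 1; ext x; exact abs_of_nonneg (rho_nonneg hf x)

lemma M_nonneg (hf : MemFM Φ M f) : 0 ≤ M := by rw [← hf.mass]; exact integral_nonneg hf.nonneg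

lemma Ekin_nonneg (hf : MemFM Φ M f) : 0 ≤ Ekin f := by
  unfold Ekin
  have : 0 ≤ ∫ p : R3 × R3, ‖p.2‖ ^ 2 * f p := integral_nonneg fun p => by have := hf.nonneg p; positivity
  positivity

lemma Cas_nonneg (h : IsPhi Φ Φ' k k') (hf : MemFM Φ M f) : 0 ≤ Casimir Φ f :=
  integral_nonneg fun p => h.nonneg _ (hf.nonneg p)

lemma PP_nonneg (h : IsPhi Φ Φ' k k') (hf : MemFM Φ M f) : 0 ≤ PP Φ f :=
  add_nonneg (Ekin_nonneg hf) (Cas_nonneg h hf)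

lemma X_est (h : IsPhi Φ Φ' k k') {δ : ℝ} (hδ : 0 < δ) : ∃ Cδ : ℝ, 0 ≤ Cδ ∧
    ∀ (M : ℝ) (f : R3 × R3 → ℝ), MemFM Φ M f →
      Good (spatialDensity f) ∧ XX (spatialDensity f) ≤ δ * PP Φ f + Cδ * M := by
  obtain ⟨C, hC, hv⟩ := vel_est h hδ
  refine ⟨C, hC, fun M f hf => ?_⟩
  have i1 := hf.integrable
  have i2 := hf.kin_int
  have i3 := hf.cas_int
  rw [Measure.volume_eq_prod] at i1 i2 i3
  have hae : ∀ᵐ x : R3, |spatialDensity f x| ^ (4/3:ℝ) ≤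
      δ * ((1/2) * (∫ v, ‖v‖ ^ 2 * f (x, v)) + ∫ v, Φ (f (x, v))) + C * spatialDensity f x := by
    filter_upwards [i1.prod_right_ae, i2.prod_right_ae, i3.prod_right_ae] with x h1 h2 h3
    rw [abs_of_nonneg (rho_nonneg hf x)]
    exact hv (fun v => f (x, v)) (fun v => hf.nonneg _) h1 h2 h3
  have j1 : Integrable (fun x : R3 => ∫ v, ‖v‖ ^ 2 * f (x, v)) := i2.integral_prod_left
  have j2 : Integrable (fun x : R3 => ∫ v, Φ (f (x, v))) := i3.integral_prod_left
  have j3 : Integrable (fun x : R3 => (1/2) * (∫ v, ‖v‖ ^ 2 * f (x, v)) + ∫ v, Φ (f (x, v))) :=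
    (j1.const_mul (1/2)).add j2
  have hI : Integrable (fun x : R3 => δ * ((1/2) * (∫ v, ‖v‖ ^ 2 * f (x, v)) + ∫ v, Φ (f (x, v)))
      + C * spatialDensity f x) :=
    (j3.const_mul δ).add ((rho_int hf).const_mul C)
  have hp : Integrable (fun x => |spatialDensity f x| ^ (4/3 : ℝ)) := by
    refine hI.mono' (meas43 (rho_int hf).1) ?_
    filter_upwards [hae] with x hx
    rw [Real.norm_of_nonneg (by positivity)]; exact hx
  refine ⟨⟨rho_int hf, hp⟩, ?_⟩
  refine (integral_mono_ae hp hI hae).trans (le_of_eq ?_)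
  rw [integral_add (j3.const_mul δ)
    ((rho_int hf).const_mul C), integral_const_mul, integral_const_mul, rho_mass hf]
  rw [integral_add (j1.const_mul (1/2)) j2, integral_const_mul]
  unfold PP Ekin Casimir
  rw [Measure.volume_eq_prod, integral_prod _ i2, integral_prod _ i3]

lemma rho_good (h : IsPhi Φ Φ' k k') (hf : MemFM Φ M f) : Good (spatialDensity f) := by
  obtain ⟨C, _, hX⟩ := X_est h one_pos
  exact (hX M f hf).1

lemma HC_eq (h : IsPhi Φ Φ' k k') (hf : MemFM Φ M f) :
    HC Φ f = PP Φ f - (1/2) * Db (spatialDensity f) (spatialDensity f) := by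
  unfold HC PP Epot
  rw [Dpair_eq (rho_good h hf)]; ring

lemma HC_coercive (h : IsPhi Φ Φ' k k') (M : ℝ) (hM : 0 ≤ M) : ∃ C : ℝ, 0 ≤ C ∧
    ∀ (m : ℝ) (f : R3 × R3 → ℝ), m ≤ M → MemFM Φ m f →
      PP Φ f ≤ 2 * HC Φ f + C ∧ XX (spatialDensity f) ≤ PP Φ f + C := by
  have hc := c0_pos
  obtain ⟨C1, hC1, hX1⟩ := X_est h one_pos
  obtain ⟨C2, hC2, hX2⟩ := X_est h (δ := 1 / (2 * (c0 + M))) (by positivity)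
  refine ⟨C1 * M + 2 * ((c0 + M) * (C2 * M)), by positivity, fun m f hm hf => ?_⟩
  have hm0 := M_nonneg hf
  obtain ⟨hg, hx1⟩ := hX1 m f hf
  obtain ⟨_, hx2⟩ := hX2 m f hf
  have hP := PP_nonneg h hf
  have x0 := XX_nonneg (spatialDensity f)
  have b1 : C1 * m ≤ C1 * M := by gcongr
  have b2 : C2 * m ≤ C2 * M := by gcongr
  have hD := (le_abs_self _).trans (Db_lin_est hg)
  rw [rho_N1 hf] at hD
  have hD2 : Db (spatialDensity f) (spatialDensity f) ≤ 2 * (c0 + M) * (1 / (2 * (c0 + M)) * PP Φ f + C2 * M) := by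
    refine hD.trans ?_
    have : XX (spatialDensity f) ≤ 1 / (2 * (c0 + M)) * PP Φ f + C2 * M := by linarith
    have : 0 ≤ c0 + m := by positivity
    gcongr
  have e : 2 * (c0 + M) * (1 / (2 * (c0 + M)) * PP Φ f + C2 * M) = PP Φ f + 2 * ((c0 + M) * (C2 * M)) := by
    field_simp
  rw [e] at hD2
  have hH := HC_eq h hf
  have q : 0 ≤ C1 * M := by positivity
  have q' : 0 ≤ (c0 + M) * (C2 * M) := by positivity
  constructor <;> linarith

end dens

section scal
variable {Φ Φ' : ℝ → ℝ} {k k' : ℝ} {M m : ℝ} {f : R3 × R3 → ℝ}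

def hinf (Φ : ℝ → ℝ) (M : ℝ) : ℝ := sInf (HC Φ '' FMset Φ M)

lemma HC_bdd (h : IsPhi Φ Φ' k k') (hM : 0 ≤ M) : BddBelow (HC Φ '' FMset Φ M) := by
  obtain ⟨C, hC, hc⟩ := HC_coercive h M hM
  refine ⟨-C / 2, ?_⟩
  rintro _ ⟨f, hf, rfl⟩
  have h1 := (hc M f le_rfl hf).1
  have h2 := PP_nonneg h hf
  linarith

lemma hinf_le (h : IsPhi Φ Φ' k k') (hf : MemFM Φ M f) : hinf Φ M ≤ HC Φ f :=
  csInf_le (HC_bdd h (M_nonneg hf)) ⟨f, hf, rfl⟩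

lemma map_scale {b : ℝ} (hb : 0 < b) :
    Measure.map (fun p : R3 × R3 => (b • p.1, p.2)) volume = ENNReal.ofReal ((b ^ 3)⁻¹) • volume := by
  have h := Measure.map_addHaar_smul (volume : Measure R3) hb.ne'
  have h1 : Measure.map (fun p : R3 × R3 => (b • p.1, p.2)) (volume.prod volume)
      = (Measure.map (fun x : R3 => b • x) volume).prod (Measure.map id volume) := by
    rw [Measure.map_prod_map _ _ (by fun_prop) (by fun_prop)]
    rfl
  rw [Measure.volume_eq_prod, h1, h, Measure.map_id, Measure.prod_smul_left]
  simp only [finrank_euclideanSpace, Fintype.card_fin]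
  rw [abs_of_nonneg (by positivity)]

lemma scale_emb {b : ℝ} (hb : 0 < b) : MeasurableEmbedding (fun p : R3 × R3 => (b • p.1, p.2)) := by
  have := ((MeasurableEquiv.smul₀ (α := R3) b hb.ne').prodCongr (MeasurableEquiv.refl R3)).measurableEmbedding
  exact this

lemma int_scale {b : ℝ} (hb : 0 < b) {g : R3 × R3 → ℝ} (hg : Integrable g) :
    Integrable (fun p : R3 × R3 => g (b • p.1, p.2)) := by
  have h1 : Integrable g (Measure.map (fun p : R3 × R3 => (b • p.1, p.2)) volume) := by
    rw [map_scale hb]; exact hg.smul_measure (by simp)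
  exact ((scale_emb hb).integrable_map_iff).1 h1

lemma integral_scale {b : ℝ} (hb : 0 < b) (g : R3 × R3 → ℝ) :
    ∫ p : R3 × R3, g (b • p.1, p.2) = (b ^ 3)⁻¹ * ∫ p, g p := by
  rw [← (scale_emb hb).integral_map g, map_scale hb, integral_smul_measure, smul_eq_mul,
    ENNReal.toReal_ofReal (by positivity)]

lemma Db_scale {b : ℝ} (hb : 0 < b) (ρ : R3 → ℝ) :
    Db (fun x => ρ (b • x)) (fun x => ρ (b • x)) = (b ^ 5)⁻¹ * Db ρ ρ := by
  unfold Db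
  haveI : (volume : Measure (R3 × R3)).IsAddHaarMeasure := by
    rw [Measure.volume_eq_prod]; infer_instance
  have h := Measure.integral_comp_smul (volume : Measure (R3 × R3))
    (fun p => ρ p.1 * ρ p.2 / ‖p.1 - p.2‖) b
  have hfr : Module.finrank ℝ (R3 × R3) = 6 := by simp
  rw [hfr, abs_of_nonneg (by positivity), smul_eq_mul] at h
  have h2 : ∀ p : R3 × R3, ρ (b • p.1) * ρ (b • p.2) / ‖p.1 - p.2‖
      = b * (ρ (b • p).1 * ρ (b • p).2 / ‖(b • p).1 - (b • p).2‖) := by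
    intro p
    simp only [Prod.smul_fst, Prod.smul_snd]
    rw [← smul_sub, norm_smul, Real.norm_of_nonneg hb.le]
    field_simp
  simp_rw [h2]
  rw [integral_const_mul, h, ← mul_assoc]
  congr 1
  field_simp

lemma scaled_mem {b : ℝ} (hb : 0 < b) (hf : MemFM Φ m f) (hbm : (b ^ 3)⁻¹ * m = M) :
    MemFM Φ M (fun p => f (b • p.1, p.2)) where
  nonneg p := hf.nonneg _
  integrable := int_scale hb hf.integrable
  mass := by rw [integral_scale hb f, hf.mass, hbm]
  kin_int := int_scale hb hf.kin_int
  cas_int := int_scale hb hf.cas_int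

lemma scale_lower (h : IsPhi Φ Φ' k k') {b : ℝ} (hb : 0 < b) (hb1 : b ≤ 1) (hf : MemFM Φ m f)
    (hbm : (b ^ 3)⁻¹ * m = M) : b ^ 5 * hinf Φ M ≤ HC Φ f := by
  have hm := scaled_mem hb hf hbm
  have h1 := hinf_le h hm
  rw [HC_eq h hm] at h1
  rw [HC_eq h hf]
  have e1 : PP Φ (fun p => f (b • p.1, p.2)) = (b ^ 3)⁻¹ * PP Φ f := by
    unfold PP Ekin Casimir
    rw [integral_scale hb (fun p => ‖p.2‖ ^ 2 * f p), integral_scale hb (fun p => Φ (f p))]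
    ring
  have e2 : spatialDensity (fun p => f (b • p.1, p.2)) = fun x => spatialDensity f (b • x) := rfl
  rw [e1, e2, Db_scale hb] at h1
  have hP := PP_nonneg h hf
  have : b ^ 5 * hinf Φ M ≤ b ^ 5 * ((b ^ 3)⁻¹ * PP Φ f - 1 / 2 * ((b ^ 5)⁻¹ * Db (spatialDensity f) (spatialDensity f))) := by
    gcongr
  have e3 : b ^ 5 * ((b ^ 3)⁻¹ * PP Φ f - 1 / 2 * ((b ^ 5)⁻¹ * Db (spatialDensity f) (spatialDensity f)))
      = b ^ 2 * PP Φ f - 1 / 2 * Db (spatialDensity f) (spatialDensity f) := by field_simp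
  rw [e3] at this
  have : b ^ 2 ≤ 1 := by nlinarith
  nlinarith

lemma HC_nonneg_zero (h : IsPhi Φ Φ' k k') (hf : MemFM Φ 0 f) : 0 ≤ HC Φ f := by
  have hP := PP_nonneg h hf
  have hz : Dpair (spatialDensity f) = 0 := by
    have h0 : spatialDensity f =ᵐ[volume] 0 :=
      (integral_eq_zero_iff_of_nonneg (rho_nonneg hf) (rho_int hf)).1 (rho_mass hf)
    unfold Dpair
    rw [integral_eq_zero_of_ae]
    filter_upwards [h0] with x hx
    simp [hx]
  unfold HC Epot
  unfold PP at hP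
  rw [hz]; linarith

lemma mass_lower (h : IsPhi Φ Φ' k k') (hM : 0 < M) (hneg : hinf Φ M ≤ 0) (hf : MemFM Φ m f) (hm : m ≤ M) :
    hinf Φ M * (m / M - (2/3) * (m / M) * (1 - m / M)) ≤ HC Φ f := by
  have hm0 := M_nonneg hf
  rcases hm0.eq_or_lt with h0 | h0
  · subst h0
    simp
    exact HC_nonneg_zero h hf
  set b := (m / M) ^ (1/3 : ℝ) with hbd
  have hq : 0 < m / M := by positivity
  have hb : 0 < b := by positivity
  have hb3 : b ^ 3 = m / M := by
    rw [hbd, ← Real.rpow_natCast, ← Real.rpow_mul hq.le]; norm_num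
  have hb1 : b ≤ 1 := Real.rpow_le_one hq.le (by rw [div_le_one hM]; exact hm) (by norm_num)
  have hl := scale_lower h hb hb1 hf (M := M) (by rw [hb3]; field_simp)
  rw [← hb3]
  refine le_trans ?_ hl
  have : b ^ 5 ≤ b ^ 3 - 2 / 3 * b ^ 3 * (1 - b ^ 3) := by
    have e : b ^ 3 - 2 / 3 * b ^ 3 * (1 - b ^ 3) - b ^ 5 = b ^ 3 * (1/3) * ((b - 1) ^ 2 * (2 * b + 1)) := by ring
    have : 0 ≤ b ^ 3 * (1/3) * ((b - 1) ^ 2 * (2 * b + 1)) := by positivity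
    linarith
  nlinarith

lemma diag_null : ∀ᵐ p : R3 × R3, p.1 ≠ p.2 := by
  rw [Measure.volume_eq_prod, Measure.ae_prod_iff_ae_ae (by
    exact (measurableSet_eq_fun measurable_fst measurable_snd).compl)]
  refine Eventually.of_forall fun x => ?_
  have : ∀ᵐ y : R3, y ≠ x := by
    rw [ae_iff]; simp
  filter_upwards [this] with y hy using fun h => hy h.symm

lemma exists_neg (h : IsPhi Φ Φ' k k') (hM : 0 < M) : ∃ f, MemFM Φ M f ∧ HC Φ f < 0 := by
  obtain ⟨C, hC, F, hF, hg⟩ := h.growth_small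
  have ho := om_pos
  have hk := h.k'_pos
  have hk2 := h.k'_lt
  set e := Real.sqrt (M / 4) with he
  have he0 : 0 < e := by positivity
  have he2 : e ^ 2 = M / 4 := Real.sq_sqrt (by positivity)
  set A := M / (om ^ 2 * e ^ 3) with hA
  have hA0 : 0 < A := by positivity
  have hexp : 0 < 3 / k' - 2 := by rw [sub_pos, lt_div_iff₀ hk]; linarith
  have ev1 : ∀ᶠ y : ℝ in atTop, A / F ≤ y ^ 3 :=
    (tendsto_pow_atTop (by norm_num : (3:ℕ) ≠ 0)).eventually_ge_atTop _
  have ev2 : ∀ᶠ y : ℝ in atTop, 8 * C * A ^ (1/k') / M < y ^ (3 / k' - 2) :=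
    (tendsto_rpow_atTop hexp).eventually_gt_atTop _
  obtain ⟨y, ⟨c1, c2⟩, hy⟩ := ((ev1.and ev2).and (eventually_gt_atTop 0)).exists
  set R := y ^ 2 with hR
  set V := e / y with hV
  set a := A / y ^ 3 with ha
  have hR0 : 0 < R := by positivity
  have hV0 : 0 < V := by positivity
  have ha0 : 0 < a := by positivity
  have haF : a ≤ F := by
    rw [ha, div_le_iff₀ (by positivity)]
    rw [div_le_iff₀ hF] at c1; linarith
  set S : Set (R3 × R3) := Metric.ball (0:R3) R ×ˢ Metric.ball (0:R3) V with hS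
  have hSm : MeasurableSet S := measurableSet_ball.prod measurableSet_ball
  have hSv : volume.real S = (om * R ^ 3) * (om * V ^ 3) := by
    rw [hS, Measure.volume_eq_prod, measureReal_prod_prod, vol_ball _ hR0, vol_ball _ hV0]
  have hSf : volume S ≠ ∞ := by
    intro hc
    have : volume.real S = 0 := by simp [Measure.real, hc]
    rw [hSv] at this
    have : 0 < (om * R ^ 3) * (om * V ^ 3) := by positivity
    linarith
  have haM : a * ((om * R ^ 3) * (om * V ^ 3)) = M := by
    rw [ha, hA, hR, hV]; field_simp
  set f : R3 × R3 → ℝ := S.indicator (fun _ => a) with hf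
  have hfi : Integrable f := (integrable_indicator_iff hSm).2 (integrableOn_const hSf)
  have hf0 : ∀ p, 0 ≤ f p := fun p => indicator_nonneg (fun _ _ => ha0.le) p
  have hmass : ∫ p, f p = M := by
    rw [hf, integral_indicator hSm, setIntegral_const, smul_eq_mul, hSv, mul_comm, haM]
  have hkb : ∀ p : R3 × R3, ‖p.2‖ ^ 2 * f p ≤ V ^ 2 * f p := by
    intro p
    by_cases hp : p ∈ S
    · have : ‖p.2‖ ≤ V := by
        have := hp.2
        simp at this; exact this.le
      have := hf0 p
      gcongr
    · simp [hf, hp]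
  have hki : Integrable (fun p : R3 × R3 => ‖p.2‖ ^ 2 * f p) := by
    refine (hfi.const_mul (V ^ 2)).mono' ?_ ?_
    · exact (by fun_prop : Measurable fun p : R3 × R3 => ‖p.2‖ ^ 2).aestronglyMeasurable.mul hfi.1
    · refine Eventually.of_forall fun p => ?_
      have := hf0 p
      rw [Real.norm_of_nonneg (by positivity)]
      exact hkb p
  have hphi : (fun p => Φ (f p)) = S.indicator (fun _ => Φ a) := by
    ext p
    by_cases hp : p ∈ S
    · simp [hf, hp]
    · simp [hf, hp, h.zero]
  have hci : Integrable (fun p => Φ (f p)) := by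
    rw [hphi]; exact (integrable_indicator_iff hSm).2 (integrableOn_const hSf)
  have hmem : MemFM Φ M f := ⟨hf0, hfi, hmass, hki, hci⟩
  refine ⟨f, hmem, ?_⟩
  rw [HC_eq h hmem]
  have hE : Ekin f ≤ V ^ 2 * M / 2 := by
    unfold Ekin
    have := integral_mono hki (hfi.const_mul (V ^ 2)) hkb
    rw [integral_const_mul, hmass] at this
    linarith
  have hCas : Casimir Φ f ≤ C * a ^ (1/k') * M := by
    unfold Casimir
    rw [hphi, integral_indicator hSm, setIntegral_const, smul_eq_mul, hSv]
    have h1 := hg a ha0.le haF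
    rw [Real.rpow_add ha0, Real.rpow_one] at h1
    calc (om * R ^ 3) * (om * V ^ 3) * Φ a ≤ (om * R ^ 3) * (om * V ^ 3) * (C * (a * a ^ (1/k'))) := by gcongr
      _ = C * a ^ (1/k') * (a * ((om * R ^ 3) * (om * V ^ 3))) := by ring
      _ = _ := by rw [haM]
  have hG := rho_good h hmem
  have hrho : ∀ x, x ∉ Metric.ball (0:R3) R → spatialDensity f x = 0 := by
    intro x hx
    unfold spatialDensity
    have : ∀ v, f (x, v) = 0 := fun v => by
      rw [hf, indicator_of_notMem]
      exact fun hc => hx hc.1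
    simp [this]
  have hD : M ^ 2 / (2 * R) ≤ Db (spatialDensity f) (spatialDensity f) := by
    have e1 : M ^ 2 / (2 * R) = ∫ p : R3 × R3, (2 * R)⁻¹ * (spatialDensity f p.1 * spatialDensity f p.2) := by
      rw [integral_const_mul, Measure.volume_eq_prod, integral_prod_mul, rho_mass hmem]
      field_simp
    rw [e1]
    refine integral_mono_ae ((hG.int.mul_prod hG.int).const_mul _) (Db_int hG hG) ?_
    filter_upwards [diag_null] with p hp
    have r1 := rho_nonneg hmem p.1
    have r2 := rho_nonneg hmem p.2
    by_cases h1 : p.1 ∈ Metric.ball (0:R3) R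
    · by_cases h2 : p.2 ∈ Metric.ball (0:R3) R
      · simp at h1 h2
        have h3 : ‖p.1 - p.2‖ ≤ 2 * R := (norm_sub_le _ _).trans (by linarith)
        have h4 : 0 < ‖p.1 - p.2‖ := norm_pos_iff.2 (sub_ne_zero.2 hp)
        rw [div_eq_inv_mul]
        gcongr
      · simp [hrho _ h2]
    · simp [hrho _ h1]
  have hcas2 : C * a ^ (1/k') * M < M ^ 2 / (8 * R) := by
    rw [ha, Real.div_rpow hA0.le (by positivity), ← Real.rpow_natCast y 3, ← Real.rpow_mul hy.le]
    have e3 : ((3:ℕ):ℝ) * (1/k') = 3 / k' := by push_cast; ring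
    rw [e3, hR]
    rw [Real.rpow_sub hy, div_lt_div_iff₀ hM (by positivity)] at c2
    have e' : y ^ (2:ℝ) = y ^ 2 := by norm_cast
    rw [e'] at c2
    have hp : 0 < y ^ (3/k') := by positivity
    have e4 : C * (A ^ (1/k') / y ^ (3/k')) * M = (C * A ^ (1/k') * M) / y ^ (3/k') := by ring
    rw [e4, div_lt_div_iff₀ hp (by positivity)]
    nlinarith
  have hV2 : V ^ 2 * M / 2 = M ^ 2 / (8 * R) := by
    rw [hV, hR, div_pow, he2]; field_simp; ring
  have e5 : M ^ 2 / (2 * R) = 4 * (M ^ 2 / (8 * R)) := by field_simp; ring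
  unfold PP
  linarith

lemma hinf_neg (h : IsPhi Φ Φ' k k') (hM : 0 < M) : hinf Φ M < 0 := by
  obtain ⟨f, hf, hn⟩ := exists_neg h hM
  exact (hinf_le h hf).trans_lt hn

end scal

section split
variable {Φ Φ' : ℝ → ℝ} {k k' : ℝ} {M m : ℝ} {f : R3 × R3 → ℝ}

def cut (A : Set R3) (f : R3 × R3 → ℝ) : R3 × R3 → ℝ := (A ×ˢ (univ : Set R3)).indicator f

def mas (f : R3 × R3 → ℝ) (A : Set R3) : ℝ := ∫ x in A, spatialDensity f x

lemma cut_rho (A : Set R3) (f : R3 × R3 → ℝ) : spatialDensity (cut A f) = A.indicator (spatialDensity f) := by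
  ext x
  unfold spatialDensity cut
  by_cases hx : x ∈ A
  · simp [hx, Set.indicator]
  · simp [hx, Set.indicator]

lemma cut_eq (A : Set R3) (f : R3 × R3 → ℝ) (p : R3 × R3) :
    (p.1 ∈ A ∧ cut A f p = f p) ∨ (p.1 ∉ A ∧ cut A f p = 0) := by
  by_cases hx : p.1 ∈ A
  · left; simp [cut, Set.indicator, hx]
  · right; simp [cut, Set.indicator, hx]

lemma cut_mem (h : IsPhi Φ Φ' k k') {A : Set R3} (hA : MeasurableSet A) (hf : MemFM Φ M f) :
    MemFM Φ (mas f A) (cut A f) := by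
  have hS : MeasurableSet (A ×ˢ (univ : Set R3)) := hA.prod MeasurableSet.univ
  have hi : Integrable (cut A f) := hf.integrable.indicator hS
  refine ⟨fun p => ?_, hi, ?_, ?_, ?_⟩
  · rcases cut_eq A f p with h1 | h1 <;> rw [h1.2]
    exact hf.nonneg p
  · have h2 := hi
    rw [Measure.volume_eq_prod] at h2 ⊢
    rw [integral_prod _ h2]
    have : ∀ x, ∫ v, cut A f (x, v) = A.indicator (spatialDensity f) x := fun x => by
      rw [← cut_rho]; rfl
    simp_rw [this]
    rw [integral_indicator hA]; rfl
  · refine (hf.kin_int.indicator hS).congr (Eventually.of_forall fun p => ?_)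
    by_cases hx : p.1 ∈ A <;> simp [cut, Set.indicator, hx]
  · refine (hf.cas_int.indicator hS).congr (Eventually.of_forall fun p => ?_)
    by_cases hx : p.1 ∈ A <;> simp [cut, Set.indicator, hx, h.zero]

lemma PP_split (h : IsPhi Φ Φ' k k') {A B : Set R3} (hA : MeasurableSet A) (hB : MeasurableSet B)
    (hAB : Disjoint A B) (hf : MemFM Φ M f) : PP Φ (cut A f) + PP Φ (cut B f) ≤ PP Φ f := by
  have ha := cut_mem h hA hf
  have hb := cut_mem h hB hf
  have h1 : (∫ p : R3 × R3, ‖p.2‖ ^ 2 * cut A f p) + ∫ p : R3 × R3, ‖p.2‖ ^ 2 * cut B f p ≤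
      ∫ p : R3 × R3, ‖p.2‖ ^ 2 * f p := by
    rw [← integral_add ha.kin_int hb.kin_int]
    refine integral_mono (ha.kin_int.add hb.kin_int) hf.kin_int fun p => ?_
    have h0 := hf.nonneg p
    dsimp only
    rcases cut_eq A f p with h1 | h1 <;> rcases cut_eq B f p with h2 | h2 <;> rw [h1.2, h2.2]
    · exact absurd h2.1 (disjoint_left.1 hAB h1.1)
    · simp
    · simp
    · simp; positivity
  have h2 : (∫ p : R3 × R3, Φ (cut A f p)) + ∫ p : R3 × R3, Φ (cut B f p) ≤ ∫ p : R3 × R3, Φ (f p) := by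
    rw [← integral_add ha.cas_int hb.cas_int]
    refine integral_mono (ha.cas_int.add hb.cas_int) hf.cas_int fun p => ?_
    have h0 := h.nonneg _ (hf.nonneg p)
    dsimp only
    rcases cut_eq A f p with h1 | h1 <;> rcases cut_eq B f p with h2 | h2 <;> rw [h1.2, h2.2]
    · exact absurd h2.1 (disjoint_left.1 hAB h1.1)
    · simp [h.zero]
    · simp [h.zero]
    · simpa [h.zero] using h0
  unfold PP Ekin Casimir
  linarith

lemma mas_nonneg (hf : MemFM Φ M f) (A : Set R3) : 0 ≤ mas f A :=
  integral_nonneg fun x => rho_nonneg hf x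

lemma mas_le (hf : MemFM Φ M f) (A : Set R3) : mas f A ≤ M := by
  rw [← rho_mass hf]
  exact setIntegral_le_integral (rho_int hf) (Eventually.of_forall fun x => rho_nonneg hf x)

lemma mas_mono (hf : MemFM Φ M f) {A B : Set R3} (h : A ⊆ B) : mas f A ≤ mas f B :=
  setIntegral_mono_set (rho_int hf).integrableOn (Eventually.of_forall fun x => rho_nonneg hf x)
    h.eventuallyLE

lemma mas_diff (hf : MemFM Φ M f) {A B : Set R3} (hA : MeasurableSet A) (h : A ⊆ B) :
    mas f (B \ A) = mas f B - mas f A :=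
  setIntegral_sdiff hA (rho_int hf).integrableOn h

lemma Db_far {u w : R3 → ℝ} (hu : Good u) (hw : Good w) {a : R3} {R L : ℝ} (hL : 0 < L)
    (h1 : ∀ x, x ∉ Metric.ball a R → u x = 0) (h2 : ∀ x, x ∈ Metric.ball a (R + L) → w x = 0) :
    |Db u w| ≤ N1 u * N1 w / L := by
  have := Db_near_far hu hw hL (le_refl (0:ℝ)) ?_
  · simpa using this
  rw [ENNReal.ofReal_zero, nonpos_iff_eq_zero]
  unfold EA
  have : ∀ x y, ENNReal.ofReal |u x| * ENNReal.ofReal |w y| * (Metric.ball (0:R3) L).indicator kk (x - y) = 0 := by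
    intro x y
    by_cases hx : x ∈ Metric.ball a R
    · by_cases hy : y ∈ Metric.ball a (R + L)
      · simp [h2 y hy]
      · have : x - y ∉ Metric.ball (0:R3) L := by
          intro hxy
          apply hy
          rw [mem_ball_zero_iff] at hxy
          rw [Metric.mem_ball] at hx ⊢
          have := dist_triangle y x a
          rw [dist_comm y x, dist_eq_norm x y] at this
          linarith
        simp [this]
    · simp [h1 x hx]
  simp [this]

lemma HC_split (h : IsPhi Φ Φ' k k') (hf : MemFM Φ M f) {B τ : ℝ} (hB : 0 ≤ B) (hMB : M ≤ B)
    (hX : XX (spatialDensity f) ≤ B) (a : R3) {R L : ℝ} (hL : 0 < L) (hτ : 0 < τ)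
    (hann : mas f (Metric.ball a (R + L) \ Metric.ball a R) ≤ τ ^ 3) :
    HC Φ (cut (Metric.ball a R) f) + HC Φ (cut (Metric.ball a (R + L))ᶜ f)
      ≤ HC Φ f + τ * (B * (2 * c0 + 1 + B)) + M ^ 2 / L := by
  set A1 := Metric.ball a R with hA1
  set A2 := Metric.ball a (R + L) with hA2
  have m1 : MeasurableSet A1 := measurableSet_ball
  have m2 : MeasurableSet A2 := measurableSet_ball
  have hsub : A1 ⊆ A2 := Metric.ball_subset_ball (by linarith)
  have hdis : Disjoint A1 A2ᶜ := disjoint_left.2 fun x hx hy => hy (hsub hx)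
  have f1 := cut_mem h m1 hf
  have f3 := cut_mem h m2.compl hf
  have hPP := PP_split h m1 m2.compl hdis hf
  rw [HC_eq h f1, HC_eq h f3, HC_eq h hf, cut_rho, cut_rho]
  set ρ := spatialDensity f with hρ
  have g : Good ρ := rho_good h hf
  have g1 : Good (A1.indicator ρ) := g.ind m1
  have g2 : Good ((A2 \ A1).indicator ρ) := g.ind (m2.diff m1)
  have g3 : Good (A2ᶜ.indicator ρ) := g.ind m2.compl
  have hr : ∀ x, 0 ≤ ρ x := rho_nonneg hf
  have gg := g1.add g3
  have hle : ∀ x, |A1.indicator ρ x + A2ᶜ.indicator ρ x| ≤ |ρ x| := by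
    intro x
    by_cases hx : x ∈ A1
    · simp [hx, hsub hx]
    · by_cases hx2 : x ∈ A2 <;> simp [hx, hx2]
  have hle2 : ∀ (A : Set R3) x, |A.indicator ρ x| ≤ |ρ x| := by
    intro A x
    by_cases hx : x ∈ A <;> simp [hx]
  have e1 : ρ = fun x => (A1.indicator ρ x + A2ᶜ.indicator ρ x) + (A2 \ A1).indicator ρ x := by
    ext x
    by_cases hx : x ∈ A1
    · simp [hx, hsub hx]
    · by_cases hx2 : x ∈ A2 <;> simp [hx, hx2]
  have n2 : N1 ((A2 \ A1).indicator ρ) ≤ τ ^ 3 := by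
    refine le_trans (le_of_eq ?_) hann
    unfold N1 mas
    rw [← integral_indicator (m2.diff m1)]
    congr 1; ext x
    exact abs_of_nonneg (indicator_nonneg (fun x _ => hr x) x)
  have nM := rho_N1 hf
  have c := c0_pos
  have b1 := Db_small g g2 hB hτ hX ((XX_mono g g2 (hle2 _)).trans hX) n2 (nM.le.trans hMB)
  have b2 := Db_small gg g2 hB hτ ((XX_mono g gg hle).trans hX) ((XX_mono g g2 (hle2 _)).trans hX) n2
    ((N1_mono g gg hle).trans (nM.le.trans hMB))
  have b3 := Db_far (a := a) (R := R) (L := L) g1 g3 hL (fun x hx => by simp [A1, hx] at *)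
    (fun x hx => by simp only [A2]; simp [hx])
  have d1 : Db ρ ρ = Db (fun x => A1.indicator ρ x + A2ᶜ.indicator ρ x) ρ + Db ((A2 \ A1).indicator ρ) ρ := by
    conv_lhs => rw [e1]
    rw [← Db_add_left gg g2 g]; rw [← e1]
  have d2 : Db ρ (fun x => A1.indicator ρ x + A2ᶜ.indicator ρ x)
     = Db (fun x => A1.indicator ρ x + A2ᶜ.indicator ρ x) (fun x => A1.indicator ρ x + A2ᶜ.indicator ρ x)
       + Db ((A2 \ A1).indicator ρ) (fun x => A1.indicator ρ x + A2ᶜ.indicator ρ x) := by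
    rw [← Db_add_left gg g2 gg]; rw [← e1]
  have d3 := Db_add_left g1 g3 gg
  have d4 := Db_add_left g1 g3 g1
  have d5 := Db_add_left g1 g3 g3
  rw [Db_symm (fun x => A1.indicator ρ x + A2ᶜ.indicator ρ x) ρ, Db_symm ((A2 \ A1).indicator ρ) ρ] at d1
  rw [Db_symm ((A2 \ A1).indicator ρ)] at d2
  rw [Db_symm (A1.indicator ρ) (fun _ => _), Db_symm (A2ᶜ.indicator ρ) (fun _ => _), d4, d5,
    Db_symm (A2ᶜ.indicator ρ) (A1.indicator ρ)] at d3
  have b4 : N1 (A1.indicator ρ) * N1 (A2ᶜ.indicator ρ) / L ≤ M ^ 2 / L := by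
    have q1 := (N1_mono g g1 (hle2 _)).trans nM.le
    have q2 := (N1_mono g g3 (hle2 _)).trans nM.le
    have q3 := N1_nonneg (A1.indicator ρ)
    have q4 := N1_nonneg (A2ᶜ.indicator ρ)
    gcongr
    nlinarith
  have := le_abs_self (Db ρ ((A2 \ A1).indicator ρ))
  have := le_abs_self (Db (fun x => A1.indicator ρ x + A2ᶜ.indicator ρ x) ((A2 \ A1).indicator ρ))
  have := le_abs_self (Db (A1.indicator ρ) (A2ᶜ.indicator ρ))
  linarith

lemma split_mass (h : IsPhi Φ Φ' k k') (hM : 0 < M) (hf : MemFM Φ M f) {B τ : ℝ} (hB : 0 ≤ B) (hMB : M ≤ B)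
    (hX : XX (spatialDensity f) ≤ B) (a : R3) {R L : ℝ} (hL : 0 < L) (hτ : 0 < τ)
    (hann : mas f (Metric.ball a (R + L) \ Metric.ball a R) ≤ τ ^ 3) :
    (2/3) * (-hinf Φ M) * (mas f (Metric.ball a R) / M * (mas f (Metric.ball a (R + L))ᶜ / M))
      ≤ HC Φ f - hinf Φ M + τ * (B * (2 * c0 + 1 + B)) + M ^ 2 / L := by
  have h1 := HC_split h hf hB hMB hX a hL hτ hann
  have m1 : MeasurableSet (Metric.ball a R) := measurableSet_ball
  have m2 : MeasurableSet (Metric.ball a (R + L)) := measurableSet_ball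
  have hsub : Metric.ball a R ⊆ Metric.ball a (R + L) := Metric.ball_subset_ball (by linarith)
  have f1 := cut_mem h m1 hf
  have f3 := cut_mem h m2.compl hf
  have hn := hinf_neg h hM
  have l1 := mass_lower h hM hn.le f1 (mas_le hf _)
  have l3 := mass_lower h hM hn.le f3 (mas_le hf _)
  have hsum : mas f (Metric.ball a R) + mas f (Metric.ball a (R + L))ᶜ ≤ M := by
    have e := integral_add_compl m2 (rho_int hf)
    rw [rho_mass hf] at e
    have := mas_mono hf hsub
    unfold mas at *
    linarith
  have hsum' : mas f (Metric.ball a R) / M + mas f (Metric.ball a (R + L))ᶜ / M ≤ 1 := by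
    rw [← add_div, div_le_one hM]; exact hsum
  have p1 : 0 ≤ mas f (Metric.ball a R) / M := div_nonneg (mas_nonneg hf _) hM.le
  have p3 : 0 ≤ mas f (Metric.ball a (R + L))ᶜ / M := div_nonneg (mas_nonneg hf _) hM.le
  set s := mas f (Metric.ball a R) / M
  set t := mas f (Metric.ball a (R + L))ᶜ / M
  set H := hinf Φ M
  have key : H + (2/3) * (-H) * (s * t) ≤ H * (s - 2/3 * s * (1 - s)) + H * (t - 2/3 * t * (1 - t)) := by
    have k1 : 0 ≤ (-H) * (1 - s - t) := mul_nonneg (by linarith) (by linarith)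
    have k2 : 0 ≤ (-H) * (1 - s - t) * s := mul_nonneg k1 p1
    have k3 : 0 ≤ (-H) * (1 - s - t) * t := mul_nonneg k1 p3
    have k4 : 0 ≤ (-H) * (s * t) := mul_nonneg (by linarith) (mul_nonneg p1 p3)
    nlinarith
  linarith

lemma tight (h : IsPhi Φ Φ' k k') (hM : 0 < M) {B : ℝ} (hB : 0 ≤ B) (hMB : M ≤ B) {R0 δ : ℝ} (hδ : 0 < δ)
    {η : ℝ} (hη : 0 < η) : ∃ R, ∃ ε > 0, ∀ f a, MemFM Φ M f → XX (spatialDensity f) ≤ B →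
      δ ≤ mas f (Metric.ball a R0) → HC Φ f ≤ hinf Φ M + ε → mas f (Metric.ball a R)ᶜ ≤ η := by
  have hn := hinf_neg h hM
  have c := c0_pos
  set K := B * (2 * c0 + 1 + B) with hK
  have hK0 : 0 ≤ K := by positivity
  set E := (2/3) * (-hinf Φ M) * (δ / M * (η / M)) with hE
  have hE0 : 0 < E := by
    have : 0 < -hinf Φ M := by linarith
    positivity
  set τ := E / (3 * (K + 1)) with hτd
  have hτ : 0 < τ := by positivity
  set L := 3 * M ^ 2 / E with hLd
  have hL : 0 < L := by positivity
  obtain ⟨N, hN⟩ := exists_nat_gt (M / τ ^ 3)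
  have hN0 : (0:ℝ) < N := lt_of_le_of_lt (by positivity) hN
  refine ⟨R0 + N * L, E / 3, by positivity, fun f a hf hX hm hH => ?_⟩
  set F : ℕ → ℝ := fun i => mas f (Metric.ball a (R0 + i * L)) with hF
  obtain ⟨i, hi, hiF⟩ : ∃ i ∈ Finset.range N, F (i + 1) - F i ≤ M / N := by
    apply Finset.exists_le_of_sum_le
    · simp only [Finset.nonempty_range_iff]
      rintro rfl; simp at hN0
    · rw [Finset.sum_range_sub, Finset.sum_const, Finset.card_range, nsmul_eq_mul]
      have q1 : F N ≤ M := mas_le hf _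
      have q2 : 0 ≤ F 0 := mas_nonneg hf _
      have : (N:ℝ) * (M / N) = M := by field_simp
      linarith
  have hiN : i + 1 ≤ N := Finset.mem_range.1 hi
  have hR : R0 + ((i + 1 : ℕ):ℝ) * L = (R0 + i * L) + L := by push_cast; ring
  have hann : mas f (Metric.ball a (R0 + i * L + L) \ Metric.ball a (R0 + i * L)) ≤ τ ^ 3 := by
    rw [mas_diff hf measurableSet_ball (Metric.ball_subset_ball (by linarith))]
    simp only [F, hR] at hiF
    refine hiF.trans ?_
    rw [div_le_iff₀ hN0]
    rw [div_lt_iff₀ (by positivity)] at hN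
    linarith
  have s := split_mass h hM hf hB hMB hX a hL hτ hann
  have s1 : δ ≤ mas f (Metric.ball a (R0 + i * L)) :=
    hm.trans (mas_mono hf (Metric.ball_subset_ball (by have : 0 ≤ (i:ℝ) * L := by positivity
                                                       linarith)))
  have s3 : mas f (Metric.ball a (R0 + N * L))ᶜ ≤ mas f (Metric.ball a (R0 + i * L + L))ᶜ := by
    apply mas_mono hf
    apply compl_subset_compl.2
    apply Metric.ball_subset_ball
    rw [← hR]
    have : ((i + 1 : ℕ):ℝ) ≤ N := by exact_mod_cast hiN
    gcongr
  refine s3.trans ?_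
  by_contra hcon
  push Not at hcon
  have t1 : τ * K < E / 3 := by
    rw [hτd, div_mul_eq_mul_div, div_lt_div_iff₀ (by positivity) (by norm_num)]
    nlinarith
  have t2 : M ^ 2 / L = E / 3 := by
    rw [hLd]; field_simp
  have t3 : E ≤ (2/3) * (-hinf Φ M) * (mas f (Metric.ball a (R0 + i * L)) / M * (mas f (Metric.ball a (R0 + i * L + L))ᶜ / M)) := by
    rw [hE]
    have : 0 ≤ (2/3) * (-hinf Φ M) := by linarith
    have h2 := mas_nonneg hf (Metric.ball a (R0 + i * L))
    gcongr
  linarith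

/-- non-vanishing -/
lemma nonvanish (h : IsPhi Φ Φ' k k') (hM : 0 < M) {B : ℝ} (hB : 0 ≤ B) (hMB : M ≤ B) :
    ∃ R0, ∃ δ > 0, ∀ f, MemFM Φ M f → XX (spatialDensity f) ≤ B → HC Φ f ≤ hinf Φ M / 2 →
      ∃ a, δ ≤ mas f (Metric.ball a R0) := by
  have hn := hinf_neg h hM
  have c := c0_pos
  set K := B * (2 * c0 + 1 + B) with hK
  have hK0 : 0 ≤ K := by positivity
  set H := -hinf Φ M with hH
  have hH0 : 0 < H := by linarith
  set τ := H / (4 * (K + 1)) with hτd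
  have hτ : 0 < τ := by positivity
  set R := 4 * M ^ 2 / H with hRd
  have hR : 0 < R := by positivity
  refine ⟨R, τ ^ 3, by positivity, fun f hf hX hHC => ?_⟩
  by_contra hcon
  push Not at hcon
  have g := rho_good h hf
  have hQ : QB (Metric.ball 0 R) (spatialDensity f) (τ ^ 3) := by
    intro x
    have e : ∀ y, (Metric.ball (0:R3) R).indicator (fun _ => ENNReal.ofReal |spatialDensity f y|) (x - y)
        = (Metric.ball x R).indicator (fun y => ENNReal.ofReal (spatialDensity f y)) y := by
      intro y
      have : x - y ∈ Metric.ball (0:R3) R ↔ y ∈ Metric.ball x R := by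
        rw [mem_ball_zero_iff, Metric.mem_ball, dist_comm, dist_eq_norm]
      rw [abs_of_nonneg (rho_nonneg hf y)]
      by_cases hy : y ∈ Metric.ball x R
      · rw [indicator_of_mem (this.2 hy), indicator_of_mem hy]
      · rw [indicator_of_notMem (fun h => hy (this.1 h)), indicator_of_notMem hy]
    simp_rw [e]
    rw [lintegral_indicator measurableSet_ball, ← ofReal_integral_eq_lintegral_ofReal (rho_int hf).integrableOn
      (Eventually.of_forall fun x => rho_nonneg hf x)]
    exact ENNReal.ofReal_le_ofReal (hcon x).le
  have hQB : QB (Metric.ball 0 R) (spatialDensity f) B := fun x =>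
    (QB_N1 _ g x).trans (ENNReal.ofReal_le_ofReal ((rho_N1 hf).le.trans hMB))
  have hE := EA_small g g measurableSet_ball (fun z hz => by simpa using hz) hB hτ hX hX hQ hQB
  have hD := Db_near_far g g hR (by positivity) hE
  rw [rho_N1 hf] at hD
  rw [HC_eq h hf] at hHC
  have := PP_nonneg h hf
  have := le_abs_self (Db (spatialDensity f) (spatialDensity f))
  have t1 : τ * K < H / 4 := by
    rw [hτd, div_mul_eq_mul_div, div_lt_div_iff₀ (by positivity) (by norm_num)]
    nlinarith
  have t2 : M * M / R = H / 4 := by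
    rw [hRd]; field_simp
  linarith
end split

section shifts
variable {Φ Φ' : ℝ → ℝ} {k k' : ℝ} {M m : ℝ} {f : R3 × R3 → ℝ}

def shft (a : R3) (f : R3 × R3 → ℝ) : R3 × R3 → ℝ := fun p => f (p.1 + a, p.2)

lemma shft_mp (a : R3) : MeasurePreserving (fun p : R3 × R3 => (p.1 + a, p.2)) volume volume := by
  rw [Measure.volume_eq_prod]
  exact (measurePreserving_add_right volume a).prod (MeasurePreserving.id volume)

lemma shft_emb (a : R3) : MeasurableEmbedding (fun p : R3 × R3 => (p.1 + a, p.2)) :=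
  ((MeasurableEquiv.addRight a).prodCongr (MeasurableEquiv.refl R3)).measurableEmbedding

lemma shft_int (a : R3) {g : R3 × R3 → ℝ} (hg : Integrable g) :
    Integrable (fun p : R3 × R3 => g (p.1 + a, p.2)) :=
  (shft_mp a).integrable_comp_of_integrable hg

lemma shft_integral (a : R3) (g : R3 × R3 → ℝ) :
    ∫ p : R3 × R3, g (p.1 + a, p.2) = ∫ p, g p :=
  (shft_mp a).integral_comp (shft_emb a) g

lemma shft_mem (a : R3) (hf : MemFM Φ M f) : MemFM Φ M (shft a f) where
  nonneg p := hf.nonneg _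
  integrable := shft_int a hf.integrable
  mass := by rw [← hf.mass]; exact shft_integral a f
  kin_int := shft_int a hf.kin_int
  cas_int := shft_int a hf.cas_int

lemma shft_rho (a : R3) (f : R3 × R3 → ℝ) (x : R3) : spatialDensity (shft a f) x = spatialDensity f (x + a) := rfl

lemma shft_HC (a : R3) (f : R3 × R3 → ℝ) : HC Φ (shft a f) = HC Φ f := by
  have h1 : Ekin (shft a f) = Ekin f := by
    unfold Ekin
    congr 1
    exact shft_integral a (fun p => ‖p.2‖ ^ 2 * f p)
  have h2 : Casimir Φ (shft a f) = Casimir Φ f := shft_integral a (fun p => Φ (f p))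
  have h3 : Dpair (spatialDensity (shft a f)) = Dpair (spatialDensity f) := by
    unfold Dpair
    simp_rw [shft_rho]
    have : ∀ x, ∫ y, spatialDensity f (x + a) * spatialDensity f (y + a) / ‖x - y‖
        = ∫ y, spatialDensity f (x + a) * spatialDensity f y / ‖(x + a) - y‖ := by
      intro x
      rw [← integral_add_right_eq_self (fun y => spatialDensity f (x + a) * spatialDensity f y / ‖(x + a) - y‖) a]
      congr 1; ext y
      rw [add_sub_add_right_eq_sub]
    simp_rw [this]
    exact integral_add_right_eq_self (fun x => ∫ y, spatialDensity f x * spatialDensity f y / ‖x - y‖) a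
  unfold HC Epot
  rw [h1, h2, h3]

lemma shft_mas (a : R3) (f : R3 × R3 → ℝ) (R : ℝ) :
    mas (shft a f) (Metric.ball 0 R)ᶜ = mas f (Metric.ball a R)ᶜ := by
  unfold mas
  rw [← integral_indicator measurableSet_ball.compl, ← integral_indicator measurableSet_ball.compl,
    ← integral_add_right_eq_self ((Metric.ball a R)ᶜ.indicator (fun x => spatialDensity f x)) a]
  congr 1; ext x
  have : x ∈ (Metric.ball (0:R3) R)ᶜ ↔ x + a ∈ (Metric.ball a R)ᶜ := by
    simp [dist_eq_norm]
  by_cases hx : x ∈ (Metric.ball (0:R3) R)ᶜ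
  · rw [indicator_of_mem hx, indicator_of_mem (this.1 hx), shft_rho]
  · rw [indicator_of_notMem hx, indicator_of_notMem (fun h => hx (this.2 h))]

/-- a bounded, tight minimizing sequence -/
structure TightSeq (Φ : ℝ → ℝ) (M B : ℝ) (g : ℕ → R3 × R3 → ℝ) : Prop where
  mem : ∀ j, MemFM Φ M (g j)
  lim : Tendsto (fun j => HC Φ (g j)) atTop (𝓝 (hinf Φ M))
  xx : ∀ j, XX (spatialDensity (g j)) ≤ B
  pp : ∀ j, PP Φ (g j) ≤ B
  tight : ∀ η > 0, ∃ R, ∀ᶠ j in atTop, mas (g j) (Metric.ball 0 R)ᶜ ≤ η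

lemma TightSeq.comp {B : ℝ} {g : ℕ → R3 × R3 → ℝ} (hg : TightSeq Φ M B g) {φ : ℕ → ℕ} (hφ : StrictMono φ) :
    TightSeq Φ M B (fun j => g (φ j)) where
  mem j := hg.mem _
  lim := hg.lim.comp hφ.tendsto_atTop
  xx j := hg.xx _
  pp j := hg.pp _
  tight η hη := by
    obtain ⟨R, hR⟩ := hg.tight η hη
    exact ⟨R, hφ.tendsto_atTop.eventually hR⟩

lemma exists_tight (h : IsPhi Φ Φ' k k') (hM : 0 < M) {f : ℕ → R3 × R3 → ℝ} (hf : ∀ j, MemFM Φ M (f j))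
    (hmin : Tendsto (fun j => HC Φ (f j)) atTop (𝓝 (hinf Φ M))) :
    ∃ B, M ≤ B ∧ ∃ a : ℕ → R3, TightSeq Φ M B (fun j => shft (a j) (f j)) := by
  obtain ⟨C, hC, hc⟩ := HC_coercive h M hM.le
  obtain ⟨A, hA⟩ := hmin.bddAbove_range
  have hA' : ∀ j, HC Φ (f j) ≤ A := fun j => hA ⟨j, rfl⟩
  set B := 2 * |A| + 2 * C + M with hBd
  have hB : 0 ≤ B := by positivity
  have hMB : M ≤ B := by
    have := abs_nonneg A
    linarith
  have hA2 := le_abs_self A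
  have hP : ∀ g, MemFM Φ M g → HC Φ g ≤ A → PP Φ g ≤ B ∧ XX (spatialDensity g) ≤ B := by
    intro g hg hgA
    have := hc M g le_rfl hg
    constructor <;> linarith
  obtain ⟨R0, δ, hδ, hnv⟩ := nonvanish h hM hB hMB
  have hn := hinf_neg h hM
  have ha : ∀ j, ∃ a, HC Φ (f j) ≤ hinf Φ M / 2 → δ ≤ mas (f j) (Metric.ball a R0) := by
    intro j
    by_cases hj : HC Φ (f j) ≤ hinf Φ M / 2
    · obtain ⟨a, ha⟩ := hnv (f j) (hf j) (hP _ (hf j) (hA' j)).2 hj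
      exact ⟨a, fun _ => ha⟩
    · exact ⟨0, fun h => absurd h hj⟩
  choose a ha using ha
  refine ⟨B, hMB, a, fun j => shft_mem _ (hf j), ?_, fun j => ?_, fun j => ?_, fun η hη => ?_⟩
  · simpa only [shft_HC] using hmin
  · exact (hP _ (shft_mem _ (hf j)) ((shft_HC _ _).le.trans (hA' j))).2
  · exact (hP _ (shft_mem _ (hf j)) ((shft_HC _ _).le.trans (hA' j))).1
  · obtain ⟨R, ε, hε, ht⟩ := tight h hM hB hMB hδ hη (R0 := R0)
    refine ⟨R, ?_⟩
    filter_upwards [hmin.eventually_le_const (show hinf Φ M < hinf Φ M / 2 by linarith),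
      hmin.eventually_le_const (show hinf Φ M < hinf Φ M + ε by linarith)] with j h1 h2
    rw [shft_mas]
    exact ht (f j) (a j) (hf j) (hP _ (hf j) (hA' j)).2 (ha j h1) h2
end shifts

section moll

def Ue (e : ℝ) (ρ : R3 → ℝ) (x : R3) : ℝ := ∫ y, (max ‖x - y‖ e)⁻¹ * ρ y

lemma ker_bd {e : ℝ} (he : 0 < e) (z : R3) : |(max ‖z‖ e)⁻¹| ≤ e⁻¹ := by
  rw [abs_of_nonneg (by positivity)]
  exact inv_anti₀ he (le_max_right _ _)

lemma ker_meas (e : ℝ) (x : R3) : AEStronglyMeasurable (fun y : R3 => (max ‖x - y‖ e)⁻¹) :=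
  Measurable.aestronglyMeasurable (by fun_prop)

lemma Ue_int {e : ℝ} (he : 0 < e) {ρ : R3 → ℝ} (hρ : Integrable ρ) (x : R3) :
    Integrable (fun y => (max ‖x - y‖ e)⁻¹ * ρ y) :=
  hρ.bdd_mul (c := e⁻¹) (ker_meas e x) (Eventually.of_forall fun y => ker_bd he _)

lemma Ue_bd {e : ℝ} (he : 0 < e) {ρ : R3 → ℝ} (hρ : Integrable ρ) (x : R3) : |Ue e ρ x| ≤ e⁻¹ * N1 ρ := by
  unfold Ue N1
  rw [← integral_const_mul]
  refine (abs_integral_le_integral_abs).trans ?_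
  refine integral_mono (Ue_int he hρ x).abs (hρ.abs.const_mul _) fun y => ?_
  dsimp only
  rw [abs_mul]
  exact mul_le_mul_of_nonneg_right (ker_bd he _) (abs_nonneg _)

lemma Ue_lip {e : ℝ} (he : 0 < e) {ρ : R3 → ℝ} (hρ : Integrable ρ) (x z : R3) :
    |Ue e ρ x - Ue e ρ z| ≤ ‖x - z‖ * (e⁻¹ * e⁻¹ * N1 ρ) := by
  unfold Ue N1
  rw [← integral_sub (Ue_int he hρ x) (Ue_int he hρ z), ← integral_const_mul, ← integral_const_mul]
  refine (abs_integral_le_integral_abs).trans ?_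
  refine integral_mono ((Ue_int he hρ x).sub (Ue_int he hρ z)).abs ((hρ.abs.const_mul _).const_mul _) fun y => ?_
  dsimp only
  rw [← sub_mul, abs_mul, ← mul_assoc]
  refine mul_le_mul_of_nonneg_right ?_ (abs_nonneg _)
  have p1 : 0 < max ‖x - y‖ e := lt_max_of_lt_right he
  have p2 : 0 < max ‖z - y‖ e := lt_max_of_lt_right he
  rw [inv_sub_inv p1.ne' p2.ne', abs_div, abs_of_pos (mul_pos p1 p2), div_eq_mul_inv, mul_inv]
  have q : |max ‖z - y‖ e - max ‖x - y‖ e| ≤ ‖x - z‖ := by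
    refine (abs_max_sub_max_le_abs _ _ _).trans ?_
    refine (abs_norm_sub_norm_le _ _).trans ?_
    rw [sub_sub_sub_cancel_right, norm_sub_rev]
  have r1 : (max ‖x - y‖ e)⁻¹ ≤ e⁻¹ := inv_anti₀ he (le_max_right _ _)
  have r2 : (max ‖z - y‖ e)⁻¹ ≤ e⁻¹ := inv_anti₀ he (le_max_right _ _)
  gcongr

lemma Ue_sub {e : ℝ} (he : 0 < e) {ρ σ : R3 → ℝ} (hρ : Integrable ρ) (hσ : Integrable σ) (x : R3) :
    Ue e (fun y => ρ y - σ y) x = Ue e ρ x - Ue e σ x := by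
  unfold Ue
  rw [← integral_sub (Ue_int he hρ x) (Ue_int he hσ x)]
  congr 1; ext y; ring

lemma Db_moll {e C : ℝ} (he : 0 < e) (hC : 0 ≤ C) {σ : R3 → ℝ} (hσ : Good σ)
    (h : EA (Metric.ball 0 e) σ σ ≤ ENNReal.ofReal C) :
    |Db σ σ| ≤ C + |∫ x, σ x * Ue e σ x| := by
  have hi1 : Integrable (fun p : R3 × R3 => σ p.1 * σ p.2) := by
    rw [Measure.volume_eq_prod]; exact hσ.int.mul_prod hσ.int
  have hi2 : Integrable (fun p : R3 × R3 => (max ‖p.1 - p.2‖ e)⁻¹ * (σ p.1 * σ p.2)) :=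
    hi1.bdd_mul (c := e⁻¹) (Measurable.aestronglyMeasurable (by fun_prop)) (Eventually.of_forall fun y => ker_bd he _)
  have e1 : ∫ p : R3 × R3, (max ‖p.1 - p.2‖ e)⁻¹ * (σ p.1 * σ p.2) = ∫ x, σ x * Ue e σ x := by
    have := hi2
    rw [Measure.volume_eq_prod] at this ⊢
    rw [integral_prod _ this]
    congr 1; ext x
    unfold Ue
    rw [← integral_const_mul]
    congr 1; ext y; ring
  have e2 : |Db σ σ - ∫ x, σ x * Ue e σ x| ≤ C := by
    rw [← e1]
    unfold Db
    rw [← integral_sub (Db_int hσ hσ) hi2, ← ENNReal.ofReal_le_ofReal_iff hC, ← Real.enorm_eq_ofReal_abs]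
    refine (enorm_integral_le_lintegral_enorm _).trans ?_
    rw [EA_prod measurableSet_ball hσ.int.1 hσ.int.1] at h
    refine le_trans (lintegral_mono_ae ?_) h
    filter_upwards [diag_null] with p hp
    have hp0 : 0 < ‖p.1 - p.2‖ := norm_pos_iff.2 (sub_ne_zero.2 hp)
    by_cases hb : p.1 - p.2 ∈ Metric.ball (0:R3) e
    · rw [indicator_of_mem hb, ← enorm_kern]
      rw [mem_ball_zero_iff] at hb
      rw [Real.enorm_eq_ofReal_abs, Real.enorm_eq_ofReal_abs]
      apply ENNReal.ofReal_le_ofReal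
      rw [max_eq_right hb.le, div_eq_mul_inv, mul_comm e⁻¹, ← mul_sub, abs_mul, abs_mul (σ p.1 * σ p.2)]
      refine mul_le_mul_of_nonneg_left ?_ (abs_nonneg _)
      have : e⁻¹ ≤ ‖p.1 - p.2‖⁻¹ := inv_anti₀ hp0 hb.le
      have h0 : 0 < e⁻¹ := by positivity
      rw [abs_of_nonneg (by linarith), abs_of_nonneg (by positivity)]
      linarith
    · rw [indicator_of_notMem hb]
      rw [mem_ball_zero_iff, not_lt] at hb
      rw [max_eq_left hb, div_eq_mul_inv, mul_comm (_)⁻¹, sub_self]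
      simp
  have := abs_sub_abs_le_abs_sub (Db σ σ) (∫ x, σ x * Ue e σ x)
  linarith

lemma QB_small {B τ : ℝ} (hB : 0 ≤ B) (hτ : 0 < τ) : ∃ e0 > 0, ∀ e, 0 < e → e ≤ e0 → ∀ σ, Good σ → XX σ ≤ B →
    QB (Metric.ball 0 e) σ (τ ^ 3) := by
  have ho := om_pos
  set κ := 2 * (B + 1) / τ ^ 3 with hκ
  have hκ0 : 0 < κ := by positivity
  set e0 := τ / (2 * κ * (om + 1)) with he0
  have he00 : 0 < e0 := by positivity
  refine ⟨e0, he00, fun e hep hee σ hσ hX x => ?_⟩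
  have pt : ∀ y, |σ y| ≤ κ ^ 3 + κ⁻¹ * |σ y| ^ (4/3 : ℝ) := by
    intro y
    rcases le_total (|σ y|) (κ ^ 3) with h | h
    · have : 0 ≤ κ⁻¹ * |σ y| ^ (4/3 : ℝ) := by positivity
      linarith
    · have h0 : 0 < |σ y| := lt_of_lt_of_le (by positivity) h
      have h1 : κ ≤ |σ y| ^ (1/3 : ℝ) := by
        have := Real.rpow_le_rpow (by positivity) h (show (0:ℝ) ≤ 1/3 by norm_num)
        rw [← Real.rpow_natCast κ 3, ← Real.rpow_mul hκ0.le] at this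
        norm_num at this
        exact this
      have h2 : |σ y| ^ (4/3 : ℝ) = |σ y| ^ (1/3 : ℝ) * |σ y| := by
        rw [← Real.rpow_add_one h0.ne']; norm_num
      rw [h2]
      have h3 : κ * |σ y| ≤ |σ y| ^ (1/3 : ℝ) * |σ y| := by gcongr
      have h4 : |σ y| ≤ κ⁻¹ * (|σ y| ^ (1/3 : ℝ) * |σ y|) := by
        rw [inv_mul_eq_div, le_div_iff₀ hκ0]; linarith
      have : 0 < κ ^ 3 := by positivity
      linarith
  calc ∫⁻ y, (Metric.ball (0:R3) e).indicator (fun _ => ENNReal.ofReal |σ y|) (x - y)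
      ≤ ∫⁻ y, ((Metric.ball x e).indicator (fun _ => ENNReal.ofReal (κ ^ 3)) y
          + ENNReal.ofReal κ⁻¹ * ENNReal.ofReal (|σ y| ^ (4/3 : ℝ))) := by
        refine lintegral_mono fun y => ?_
        by_cases hy : y ∈ Metric.ball x e
        · have hy2 : x - y ∈ Metric.ball (0:R3) e := by
            rw [mem_ball_zero_iff, ← dist_eq_norm, dist_comm]; exact hy
          rw [indicator_of_mem hy2, indicator_of_mem hy, ← ENNReal.ofReal_mul (by positivity),
            ← ENNReal.ofReal_add (by positivity) (by positivity)]
          exact ENNReal.ofReal_le_ofReal (pt y)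
        · have hy2 : x - y ∉ Metric.ball (0:R3) e := by
            rw [mem_ball_zero_iff, ← dist_eq_norm, dist_comm]; exact hy
          rw [indicator_of_notMem hy2]; simp
    _ = ENNReal.ofReal (κ ^ 3) * volume (Metric.ball x e) + ENNReal.ofReal κ⁻¹ * ENNReal.ofReal (XX σ) := by
        rw [lintegral_add_left (measurable_const.indicator measurableSet_ball),
          lintegral_indicator_const measurableSet_ball, lintegral_const_mul' _ _ ENNReal.ofReal_ne_top, XX_lint hσ]
    _ ≤ ENNReal.ofReal (τ ^ 3) := by
        have hv : volume (Metric.ball x e) = ENNReal.ofReal (om * e ^ 3) := by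
          rw [← vol_ball x hep, Measure.real, ENNReal.ofReal_toReal measure_ball_lt_top.ne]
        rw [hv, ← ENNReal.ofReal_mul (by positivity), ← ENNReal.ofReal_mul (by positivity),
          ← ENNReal.ofReal_add (by positivity) (by have := XX_nonneg σ; positivity)]
        apply ENNReal.ofReal_le_ofReal
        have t1 : κ⁻¹ * XX σ ≤ τ ^ 3 / 2 := by
          rw [inv_mul_eq_div, div_le_iff₀ hκ0, hκ]
          have : τ ^ 3 / 2 * (2 * (B + 1) / τ ^ 3) = B + 1 := by field_simp
          rw [this]; linarith
        have t2 : κ ^ 3 * (om * e ^ 3) ≤ τ ^ 3 / 2 := by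
          have a1 : e ^ 3 ≤ e0 ^ 3 := by gcongr
          have a2 : κ ^ 3 * (om * e0 ^ 3) = τ ^ 3 * (om / (8 * (om + 1) ^ 3)) := by
            rw [he0]; field_simp; ring
          have a3 : om / (8 * (om + 1) ^ 3) ≤ 1 / 2 := by
            rw [div_le_div_iff₀ (by positivity) (by norm_num)]
            nlinarith [pow_pos ho 3, pow_pos ho 2]
          calc κ ^ 3 * (om * e ^ 3) ≤ κ ^ 3 * (om * e0 ^ 3) := by gcongr
            _ = τ ^ 3 * (om / (8 * (om + 1) ^ 3)) := a2
            _ ≤ τ ^ 3 * (1 / 2) := by gcongr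
            _ = τ ^ 3 / 2 := by ring
        linarith

lemma extract (ρ : ℕ → R3 → ℝ) (M : ℝ) (hρ : ∀ j, Integrable (ρ j)) (hM : ∀ j, N1 (ρ j) = M) :
    ∃ φ : ℕ → ℕ, StrictMono φ ∧ ∀ n : ℕ, ∀ R r : ℝ, 0 < r → ∃ J, ∀ i ≥ J, ∀ j ≥ J, ∀ x ∈ Metric.ball (0:R3) R,
      |Ue (1 / ((n:ℝ) + 1)) (ρ (φ i)) x - Ue (1 / ((n:ℝ) + 1)) (ρ (φ j)) x| ≤ r := by
  have hM0 : 0 ≤ M := by rw [← hM 0]; exact N1_nonneg _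
  set z := TopologicalSpace.denseSeq R3 with hz
  set ee : ℕ → ℝ := fun n => 1 / ((n:ℝ) + 1) with hee
  have hee0 : ∀ n, 0 < ee n := fun n => by positivity
  set u : ℕ → (ℕ × ℕ → ℝ) := fun j q => Ue (ee q.1) (ρ j) (z q.2) with hu
  have hcpt : IsCompact (Set.pi univ (fun q : ℕ × ℕ => Icc (-((ee q.1)⁻¹ * M)) ((ee q.1)⁻¹ * M))) :=
    isCompact_univ_pi fun q => isCompact_Icc
  obtain ⟨l, -, φ, hφ, hlim⟩ := hcpt.tendsto_subseq (x := u) (fun j q _ => by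
    have := Ue_bd (hee0 q.1) (hρ j) (z q.2)
    rw [hM] at this
    exact abs_le.1 this)
  refine ⟨φ, hφ, fun n R r hr => ?_⟩
  rw [tendsto_pi_nhds] at hlim
  set Lc := (ee n)⁻¹ * (ee n)⁻¹ * M with hLc
  have hLc0 : 0 ≤ Lc := by have := hee0 n; positivity
  set s := r / (4 * (Lc + 1)) with hs
  have hs0 : 0 < s := by positivity
  obtain ⟨t, ht⟩ := (isCompact_closedBall (0:R3) R).elim_finite_subcover (fun m : ℕ => Metric.ball (z m) s)
    (fun m => Metric.isOpen_ball) (fun x _ => by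
      obtain ⟨m, hm⟩ := (TopologicalSpace.denseRange_denseSeq R3).exists_dist_lt x hs0
      exact mem_iUnion.2 ⟨m, hm⟩)
  have hc : ∀ m ∈ t, ∃ J, ∀ i ≥ J, ∀ j ≥ J, |u (φ i) (n, m) - u (φ j) (n, m)| < r / 2 := by
    intro m _
    have hcs := (hlim (n, m)).cauchySeq
    obtain ⟨J, hJ⟩ := Metric.cauchySeq_iff.1 hcs (r / 2) (by positivity)
    exact ⟨J, fun i hi j hj => by simpa [Real.dist_eq] using hJ i hi j hj⟩
  choose! Jf hJf using hc
  refine ⟨t.sup Jf, fun i hi j hj x hx => ?_⟩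
  obtain ⟨m, hm⟩ := mem_iUnion.1 (ht (Metric.ball_subset_closedBall hx))
  obtain ⟨hmt, hxm⟩ := mem_iUnion.1 hm
  have hle : Jf m ≤ t.sup Jf := Finset.le_sup hmt
  have h1 := hJf m hmt i (hle.trans hi) j (hle.trans hj)
  have l1 := Ue_lip (hee0 n) (hρ (φ i)) x (z m)
  have l2 := Ue_lip (hee0 n) (hρ (φ j)) x (z m)
  rw [hM] at l1 l2
  rw [Metric.mem_ball, dist_eq_norm] at hxm
  have h3 : ‖x - z m‖ * Lc ≤ r / 4 := by
    have : s * (Lc + 1) = r / 4 := by rw [hs]; field_simp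
    have : ‖x - z m‖ * Lc ≤ s * (Lc + 1) := by
      apply mul_le_mul hxm.le (by linarith) hLc0 hs0.le
    linarith
  simp only [u] at h1
  rw [abs_le] at *
  rw [abs_lt] at h1
  constructor <;> linarith [h1.1, h1.2, l1.1, l1.2, l2.1, l2.2]

end moll

section dc
variable {Φ Φ' : ℝ → ℝ} {k k' : ℝ} {M B : ℝ}

lemma D_cauchy (h : IsPhi Φ Φ' k k') (hM : 0 < M) (hMB : M ≤ B) {g : ℕ → R3 × R3 → ℝ} (hg : TightSeq Φ M B g) :
    ∃ φ : ℕ → ℕ, StrictMono φ ∧ ∀ η > 0, ∃ J, ∀ i ≥ J, ∀ j ≥ J,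
      |Db (fun x => spatialDensity (g (φ i)) x - spatialDensity (g (φ j)) x)
        (fun x => spatialDensity (g (φ i)) x - spatialDensity (g (φ j)) x)| ≤ η := by
  obtain ⟨φ, hφ, hU⟩ := extract (fun j => spatialDensity (g j)) M (fun j => rho_int (hg.mem j))
    (fun j => rho_N1 (hg.mem j))
  refine ⟨φ, hφ, fun η hη => ?_⟩
  have c := c0_pos
  have hB : 0 < B := hM.trans_le hMB
  set B4 := 4 * B with hB4
  set K := B4 * (2 * c0 + 1 + B4) with hK
  have hK0 : 0 < K := by positivity
  set τ := η / (3 * K) with hτ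
  have hτ0 : 0 < τ := by positivity
  obtain ⟨e0, he0, hQ⟩ := QB_small (B := B4) (by positivity) hτ0
  obtain ⟨n, hn⟩ := exists_nat_one_div_lt he0
  set e : ℝ := 1 / ((n:ℝ) + 1) with he
  have hep : 0 < e := by positivity
  set η' := η * e / (12 * M) with hη'
  have hη'0 : 0 < η' := by positivity
  obtain ⟨R, hR⟩ := hg.tight η' hη'0
  obtain ⟨J1, hJ1⟩ := eventually_atTop.1 (hφ.tendsto_atTop.eventually hR)
  obtain ⟨J2, hJ2⟩ := hU n R (η / (6 * M)) (by positivity)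
  refine ⟨max J1 J2, fun i hi j hj => ?_⟩
  have mi := hg.mem (φ i)
  have mj := hg.mem (φ j)
  have ti := hJ1 i ((le_max_left _ _).trans hi)
  have tj := hJ1 j ((le_max_left _ _).trans hj)
  have hu := hJ2 i ((le_max_right _ _).trans hi) j ((le_max_right _ _).trans hj)
  have gi := rho_good h mi
  have gj := rho_good h mj
  have xi := hg.xx (φ i)
  have xj := hg.xx (φ j)
  have ni := rho_N1 mi
  have nj := rho_N1 mj
  have ri := rho_nonneg mi
  have rj := rho_nonneg mj
  unfold mas at ti tj
  generalize spatialDensity (g (φ i)) = ρ1 at *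
  generalize spatialDensity (g (φ j)) = ρ2 at *
  have gs := gi.sub gj
  have xs := XX_sub gi gj
  have ns := N1_sub gi gj
  have hsub : ∀ x, Ue e (fun x => ρ1 x - ρ2 x) x = Ue e ρ1 x - Ue e ρ2 x := Ue_sub hep gi.int gj.int
  have habs : ∀ x, |ρ1 x - ρ2 x| ≤ ρ1 x + ρ2 x := fun x => by
    rw [abs_le]; constructor <;> linarith [ri x, rj x]
  have hE := EA_small gs gs measurableSet_ball (fun z hz => by simpa using hz) (B := B4) (by positivity) hτ0
    (by linarith) (by linarith) (hQ e hep hn.le _ gs (by linarith))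
    (fun x => (QB_N1 _ gs x).trans (ENNReal.ofReal_le_ofReal (by linarith)))
  have hD := Db_moll hep (by positivity) gs hE
  have hIntg : |∫ x, (ρ1 x - ρ2 x) * Ue e (fun x => ρ1 x - ρ2 x) x| ≤ 2 * η / 3 := by
    set A := (Metric.ball (0:R3) R)ᶜ with hA
    have mA : MeasurableSet A := measurableSet_ball.compl
    have ib : Integrable (fun x => (η / (6 * M)) * (ρ1 x + ρ2 x) + (e⁻¹ * (2 * M)) * (A.indicator ρ1 x + A.indicator ρ2 x)) :=
      ((gi.int.add gj.int).const_mul _).add (((gi.int.indicator mA).add (gj.int.indicator mA)).const_mul _)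
    have pw : ∀ x, ‖(ρ1 x - ρ2 x) * Ue e (fun x => ρ1 x - ρ2 x) x‖ ≤
        (η / (6 * M)) * (ρ1 x + ρ2 x) + (e⁻¹ * (2 * M)) * (A.indicator ρ1 x + A.indicator ρ2 x) := by
      intro x
      rw [Real.norm_eq_abs, abs_mul]
      have := ri x
      have := rj x
      by_cases hx : x ∈ A
      · rw [indicator_of_mem hx, indicator_of_mem hx]
        have b := Ue_bd hep gs.int x
        have b' : |Ue e (fun x => ρ1 x - ρ2 x) x| ≤ e⁻¹ * (2 * M) := by
          refine b.trans ?_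
          gcongr; linarith
        have : |ρ1 x - ρ2 x| * |Ue e (fun x => ρ1 x - ρ2 x) x| ≤ (ρ1 x + ρ2 x) * (e⁻¹ * (2 * M)) := by
          gcongr; exact habs x
        have : 0 ≤ (η / (6 * M)) * (ρ1 x + ρ2 x) := by positivity
        linarith
      · rw [indicator_of_notMem hx, indicator_of_notMem hx]
        have b' : |Ue e (fun x => ρ1 x - ρ2 x) x| ≤ η / (6 * M) := by
          rw [hsub]; exact hu x (by simpa [A] using hx)
        have : |ρ1 x - ρ2 x| * |Ue e (fun x => ρ1 x - ρ2 x) x| ≤ (ρ1 x + ρ2 x) * (η / (6 * M)) := by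
          gcongr; exact habs x
        linarith
    have h1 := norm_integral_le_of_norm_le ib (Eventually.of_forall pw)
    rw [Real.norm_eq_abs] at h1
    refine h1.trans ?_
    have n1 : ∫ x, ρ1 x = M := by
      rw [← ni]; unfold N1; congr 1; ext x; exact (abs_of_nonneg (ri x)).symm
    have n2 : ∫ x, ρ2 x = M := by
      rw [← nj]; unfold N1; congr 1; ext x; exact (abs_of_nonneg (rj x)).symm
    have i1 : Integrable (fun x => (η / (6 * M)) * (ρ1 x + ρ2 x)) := (gi.int.add gj.int).const_mul _
    have i2 : Integrable (fun x => (e⁻¹ * (2 * M)) * (A.indicator ρ1 x + A.indicator ρ2 x)) :=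
      ((gi.int.indicator mA).add (gj.int.indicator mA)).const_mul _
    have i3 : Integrable (fun x => A.indicator ρ1 x) := gi.int.indicator mA
    have i4 : Integrable (fun x => A.indicator ρ2 x) := gj.int.indicator mA
    rw [integral_add i1 i2, integral_const_mul, integral_const_mul, integral_add gi.int gj.int, integral_add i3 i4,
      integral_indicator mA, integral_indicator mA, n1, n2]
    have q1 : (e⁻¹ * (2 * M)) * ((∫ x in A, ρ1 x) + ∫ x in A, ρ2 x) ≤ (e⁻¹ * (2 * M)) * (η' + η') := by
      gcongr
    have q2 : (e⁻¹ * (2 * M)) * (η' + η') = η / 3 := by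
      rw [hη']; field_simp; norm_num
    have q3 : η / (6 * M) * (M + M) = η / 3 := by field_simp; norm_num
    linarith
  have : τ * K = η / 3 := by rw [hτ]; field_simp
  linarith
end dc

section gap
variable {Φ Φ' : ℝ → ℝ} {k k' : ℝ} {M B : ℝ}

def GG (Φ : ℝ → ℝ) (s t : ℝ) : ℝ := (Φ s + Φ t) / 2 - Φ ((s + t) / 2)

lemma GG_nonneg (h : IsPhi Φ Φ' k k') {s t : ℝ} (hs : 0 ≤ s) (ht : 0 ≤ t) : 0 ≤ GG Φ s t := by
  have := h.sconvex.convexOn.2 (mem_Ici.2 hs) (mem_Ici.2 ht) (show (0:ℝ) ≤ 1/2 by norm_num)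
    (show (0:ℝ) ≤ 1/2 by norm_num) (by norm_num)
  simp only [smul_eq_mul] at this
  unfold GG
  rw [show (s + t) / 2 = 1/2 * s + 1/2 * t by ring]
  linarith

lemma GG_pos (h : IsPhi Φ Φ' k k') {s t : ℝ} (hs : 0 ≤ s) (ht : 0 ≤ t) (hst : s ≠ t) : 0 < GG Φ s t := by
  have := h.sconvex.2 (mem_Ici.2 hs) (mem_Ici.2 ht) hst (show (0:ℝ) < 1/2 by norm_num)
    (show (0:ℝ) < 1/2 by norm_num) (by norm_num)
  simp only [smul_eq_mul] at this
  unfold GG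
  rw [show (s + t) / 2 = 1/2 * s + 1/2 * t by ring]
  linarith

lemma GG_lower (h : IsPhi Φ Φ' k k') (K : ℝ) {η : ℝ} (hη : 0 < η) : ∃ c > 0, ∀ s t, 0 ≤ s → 0 ≤ t → s ≤ K → t ≤ K →
    η ≤ |s - t| → c ≤ GG Φ s t := by
  set S : Set (ℝ × ℝ) := (Icc 0 K ×ˢ Icc 0 K) ∩ {q | η ≤ |q.1 - q.2|} with hS
  have hc : IsCompact S := (isCompact_Icc.prod isCompact_Icc).inter_right
    (isClosed_le continuous_const (by fun_prop))
  rcases S.eq_empty_or_nonempty with he | hne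
  · refine ⟨1, one_pos, fun s t hs ht hsK htK hst => ?_⟩
    exact absurd (show (s, t) ∈ S from ⟨⟨⟨hs, hsK⟩, ⟨ht, htK⟩⟩, hst⟩) (by rw [he]; exact notMem_empty _)
  · have hcont : ContinuousOn (fun q : ℝ × ℝ => GG Φ q.1 q.2) S := by
      have p := phi_cont h
      unfold GG
      refine ContinuousOn.sub (ContinuousOn.div_const (ContinuousOn.add ?_ ?_) 2) ?_
      · exact p.comp continuous_fst.continuousOn fun q hq => hq.1.1.1
      · exact p.comp continuous_snd.continuousOn fun q hq => hq.1.2.1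
      · refine p.comp (Continuous.continuousOn (by fun_prop)) fun q hq => ?_
        have h1 : 0 ≤ q.1 := hq.1.1.1
        have h2 : 0 ≤ q.2 := hq.1.2.1
        exact mem_Ici.2 (by positivity)
    obtain ⟨q, hq, hmin⟩ := hc.exists_isMinOn hne hcont
    refine ⟨GG Φ q.1 q.2, GG_pos h hq.1.1.1 hq.1.2.1 ?_, fun s t hs ht hsK htK hst => ?_⟩
    · intro he
      have : η ≤ |q.1 - q.2| := hq.2
      rw [he] at this; simp at this; linarith
    · exact isMinOn_iff.1 hmin (s, t) ⟨⟨⟨hs, hsK⟩, ⟨ht, htK⟩⟩, hst⟩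

lemma Db_congr {u w : R3 → ℝ} (h : u =ᵐ[volume] w) : Db u u = Db w w := by
  unfold Db
  apply integral_congr_ae
  rw [Measure.volume_eq_prod]
  have h1 : (fun p : R3 × R3 => u p.1) =ᵐ[volume.prod volume] fun p => w p.1 :=
    Measure.quasiMeasurePreserving_fst.ae_eq_comp h
  have h2 : (fun p : R3 × R3 => u p.2) =ᵐ[volume.prod volume] fun p => w p.2 :=
    Measure.quasiMeasurePreserving_snd.ae_eq_comp h
  filter_upwards [h1, h2] with p h1 h2
  rw [h1, h2]

lemma slice_int {f : R3 × R3 → ℝ} (hf : Integrable f) : ∀ᵐ x, Integrable (fun v => f (x, v)) := by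
  rw [Measure.volume_eq_prod] at hf
  exact hf.prod_right_ae

variable {f g : R3 × R3 → ℝ}

lemma mid_mem (h : IsPhi Φ Φ' k k') (hf : MemFM Φ M f) (hg : MemFM Φ M g) :
    MemFM Φ M (fun p => (f p + g p) / 2) := by
  have hi : Integrable (fun p => (f p + g p) / 2) := (hf.integrable.add hg.integrable).div_const 2
  have hn : ∀ p, 0 ≤ (f p + g p) / 2 := fun p => by have := hf.nonneg p; have := hg.nonneg p; positivity
  refine ⟨hn, hi, ?_, ?_, ?_⟩
  · rw [integral_div, integral_add hf.integrable hg.integrable, hf.mass, hg.mass]; ring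
  · refine ((hf.kin_int.add hg.kin_int).div_const 2).congr (Eventually.of_forall fun p => ?_)
    simp only [Pi.add_apply]; ring
  · refine ((hf.cas_int.add hg.cas_int).div_const 2).mono' (phi_aesm h hn hi.1) (Eventually.of_forall fun p => ?_)
    rw [Real.norm_of_nonneg (h.nonneg _ (hn p))]
    have := GG_nonneg h (hf.nonneg p) (hg.nonneg p)
    unfold GG at this
    simp only [Pi.add_apply]
    linarith

lemma GG_int (h : IsPhi Φ Φ' k k') (hf : MemFM Φ M f) (hg : MemFM Φ M g) :
    Integrable (fun p => GG Φ (f p) (g p)) :=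
  ((hf.cas_int.add hg.cas_int).div_const 2).sub (mid_mem h hf hg).cas_int

lemma gap_bound (h : IsPhi Φ Φ' k k') (hf : MemFM Φ M f) (hg : MemFM Φ M g) :
    ∫ p, GG Φ (f p) (g p) ≤ (HC Φ f + HC Φ g) / 2 - hinf Φ M
      + (1/8) * |Db (fun x => spatialDensity f x - spatialDensity g x) (fun x => spatialDensity f x - spatialDensity g x)| := by
  have hm := mid_mem h hf hg
  have h1 := hinf_le h hm
  rw [HC_eq h hm] at h1
  rw [HC_eq h hf, HC_eq h hg]
  have gf := rho_good h hf
  have gg := rho_good h hg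
  have hr : spatialDensity (fun p => (f p + g p) / 2) =ᵐ[volume]
      fun x => (1/2 : ℝ) * (spatialDensity f x + spatialDensity g x) := by
    filter_upwards [slice_int hf.integrable, slice_int hg.integrable] with x i1 i2
    unfold spatialDensity
    rw [integral_div, integral_add i1 i2]; ring
  rw [Db_congr hr, Db_smul_left, Db_symm, Db_smul_left] at h1
  have a1 := Db_add_left gf gg (gf.add gg)
  have a2 := Db_add_left gf gg gf
  have a3 := Db_add_left gf gg gg
  have s1 := Db_sub_left gf gg (gf.sub gg)
  have s2 := Db_sub_left gf gg gf
  have s3 := Db_sub_left gf gg gg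
  rw [Db_symm (spatialDensity f) (fun _ => _), Db_symm (spatialDensity g) (fun _ => _), a2, a3] at a1
  rw [Db_symm (spatialDensity f) (fun _ => _), Db_symm (spatialDensity g) (fun _ => _), s2, s3] at s1
  rw [Db_symm (spatialDensity g) (spatialDensity f)] at a1 s1
  have hk : Ekin (fun p => (f p + g p) / 2) = (Ekin f + Ekin g) / 2 := by
    unfold Ekin
    have : ∀ p : R3 × R3, ‖p.2‖ ^ 2 * ((f p + g p) / 2) = (‖p.2‖ ^ 2 * f p + ‖p.2‖ ^ 2 * g p) / 2 := fun p => by ring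
    simp_rw [this]
    rw [integral_div, integral_add hf.kin_int hg.kin_int]; ring
  have hc : ∫ p, GG Φ (f p) (g p) = (Casimir Φ f + Casimir Φ g) / 2 - Casimir Φ (fun p => (f p + g p) / 2) := by
    unfold GG Casimir
    have i1 : Integrable (fun p => (Φ (f p) + Φ (g p)) / 2) := (hf.cas_int.add hg.cas_int).div_const 2
    rw [integral_sub i1 hm.cas_int, integral_div, integral_add hf.cas_int hg.cas_int]
  rw [hc]
  have := le_abs_self (Db (fun x => spatialDensity f x - spatialDensity g x) (fun x => spatialDensity f x - spatialDensity g x))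
  unfold PP at *
  rw [hk] at h1
  linarith

lemma pw_bound (h : IsPhi Φ Φ' k k') {θ : ℝ} (hθ : 0 < θ) : ∃ K > 0, ∀ η > 0, ∃ c > 0, ∀ s t, 0 ≤ s → 0 ≤ t →
    |s - t| ≤ η + K / c * GG Φ s t + θ * (Φ s + Φ t) := by
  obtain ⟨C, hC, F, hF, hs⟩ := phi_superlin h
  have hk := h.k_pos
  obtain ⟨K0, hK1, hK2⟩ : ∃ K0, F ≤ K0 ∧ 2 / (θ * C) ≤ K0 ^ (1/k) := by
    have := (tendsto_rpow_atTop (show 0 < 1/k by positivity)).eventually_ge_atTop (2 / (θ * C))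
    obtain ⟨K0, a, b⟩ := ((eventually_ge_atTop F).and this).exists
    exact ⟨K0, a, b⟩
  have hK0 : 0 < K0 := hF.trans_le hK1
  have key : ∀ s, 0 ≤ s → 2 * K0 < s → s ≤ θ * Φ s := by
    intro s hs0 hsK
    have h1 := hs K0 hK1 s hs0
    have hp := h.nonneg s hs0
    have h2 : Φ s / (C * K0 ^ (1/k)) ≤ θ / 2 * Φ s := by
      rw [div_le_iff₀ (by positivity)]
      rw [div_le_iff₀ (by positivity)] at hK2
      have : 2 * Φ s ≤ K0 ^ (1/k) * (θ * C) * Φ s := mul_le_mul_of_nonneg_right hK2 hp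
      nlinarith
    linarith
  refine ⟨2 * K0, by positivity, fun η hη => ?_⟩
  obtain ⟨c, hc, hG⟩ := GG_lower h (2 * K0) hη
  refine ⟨c, hc, fun s t hs0 ht0 => ?_⟩
  have g0 := GG_nonneg h hs0 ht0
  have ps := h.nonneg s hs0
  have pt := h.nonneg t ht0
  have t1 : 0 ≤ 2 * K0 / c * GG Φ s t := by positivity
  have t2 : 0 ≤ θ * Φ s := by positivity
  have t3 : 0 ≤ θ * Φ t := by positivity
  have hst : |s - t| ≤ max s t := by
    rw [abs_le]; constructor
    · linarith [le_max_right s t]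
    · linarith [le_max_left s t]
  rcases le_or_gt s (2 * K0) with a | a
  · rcases le_or_gt t (2 * K0) with b | b
    · rcases le_or_gt η (|s - t|) with e | e
      · have := hG s t hs0 ht0 a b e
        have : 2 * K0 * 1 ≤ 2 * K0 / c * GG Φ s t := by
          rw [div_mul_eq_mul_div, le_div_iff₀ hc]
          nlinarith
        have := max_le a b
        linarith
      · linarith
    · have := key t ht0 b
      rw [max_eq_right (a.trans b.le)] at hst
      linarith
  · have k1 := key s hs0 a
    rcases le_or_gt t (2 * K0) with b | b
    · rw [max_eq_left (b.trans a.le)] at hst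
      linarith
    · have k2 := key t ht0 b
      have : max s t ≤ s + t := max_le (by linarith) (by linarith)
      linarith

lemma L1_bound (h : IsPhi Φ Φ' k k') (hf : MemFM Φ M f) (hg : MemFM Φ M g) {R V η K θ : ℝ} (hV : 0 < V) (hη : 0 < η)
    (hθ : 0 < θ) (hpw : ∀ s t, 0 ≤ s → 0 ≤ t → |s - t| ≤ η + K * GG Φ s t + θ * (Φ s + Φ t))
    (hK : 0 ≤ K) :
    ∫ p, |f p - g p| ≤ η * volume.real (Metric.ball (0:R3) R ×ˢ Metric.ball (0:R3) V) + K * (∫ p, GG Φ (f p) (g p))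
      + θ * (Casimir Φ f + Casimir Φ g) + (mas f (Metric.ball 0 R)ᶜ + mas g (Metric.ball 0 R)ᶜ)
      + (2 / V ^ 2) * (Ekin f + Ekin g) := by
  set Q := Metric.ball (0:R3) R ×ˢ Metric.ball (0:R3) V with hQ
  have mQ : MeasurableSet Q := measurableSet_ball.prod measurableSet_ball
  set A := (Metric.ball (0:R3) R)ᶜ with hA
  have mA : MeasurableSet A := measurableSet_ball.compl
  have hQf : volume Q ≠ ∞ := by
    rw [Measure.volume_eq_prod, Measure.prod_prod]
    exact (ENNReal.mul_lt_top measure_ball_lt_top measure_ball_lt_top).ne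
  have cf := cut_mem h mA hf
  have cg := cut_mem h mA hg
  have i1 : Integrable (Q.indicator (fun _ => η)) := (integrable_indicator_iff mQ).2 (integrableOn_const hQf)
  have i2 : Integrable (fun p => K * GG Φ (f p) (g p)) := (GG_int h hf hg).const_mul K
  have i3 : Integrable (fun p => θ * (Φ (f p) + Φ (g p))) := (hf.cas_int.add hg.cas_int).const_mul θ
  have i4 : Integrable (fun p => cut A f p + cut A g p) := cf.integrable.add cg.integrable
  have i5 : Integrable (fun p : R3 × R3 => (1 / V ^ 2) * (‖p.2‖ ^ 2 * f p + ‖p.2‖ ^ 2 * g p)) :=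
    (hf.kin_int.add hg.kin_int).const_mul _
  have i12 : Integrable (fun p => Q.indicator (fun _ => η) p + K * GG Φ (f p) (g p)) := i1.add i2
  have i123 : Integrable (fun p => Q.indicator (fun _ => η) p + K * GG Φ (f p) (g p) + θ * (Φ (f p) + Φ (g p))) :=
    i12.add i3
  have i1234 : Integrable (fun p => Q.indicator (fun _ => η) p + K * GG Φ (f p) (g p) + θ * (Φ (f p) + Φ (g p))
    + (cut A f p + cut A g p)) := i123.add i4
  have pw : ∀ p, |f p - g p| ≤ Q.indicator (fun _ => η) p + K * GG Φ (f p) (g p) + θ * (Φ (f p) + Φ (g p))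
    + (cut A f p + cut A g p) + (1 / V ^ 2) * (‖p.2‖ ^ 2 * f p + ‖p.2‖ ^ 2 * g p) := by
    intro p
    have f0 := hf.nonneg p
    have g0 := hg.nonneg p
    have a := hpw _ _ f0 g0
    have b1 : 0 ≤ K * GG Φ (f p) (g p) := mul_nonneg hK (GG_nonneg h f0 g0)
    have b2 : 0 ≤ θ * (Φ (f p) + Φ (g p)) := mul_nonneg hθ.le (add_nonneg (h.nonneg _ f0) (h.nonneg _ g0))
    have b3 : 0 ≤ cut A f p := cf.nonneg p
    have b4 : 0 ≤ cut A g p := cg.nonneg p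
    have b5 : 0 ≤ (1 / V ^ 2) * (‖p.2‖ ^ 2 * f p + ‖p.2‖ ^ 2 * g p) := by positivity
    by_cases hp : p ∈ Q
    · rw [indicator_of_mem hp]; linarith
    · rw [indicator_of_notMem hp]
      have ab : |f p - g p| ≤ f p + g p := by rw [abs_le]; constructor <;> linarith
      by_cases hx : p.1 ∈ A
      · have e1 : cut A f p = f p := by simp [cut, Set.indicator, hx]
        have e2 : cut A g p = g p := by simp [cut, Set.indicator, hx]
        rw [e1, e2]; linarith
      · have hv : V ≤ ‖p.2‖ := by
          by_contra hv
          push Not at hv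
          apply hp
          exact ⟨by simpa [A] using hx, by simpa using hv⟩
        have : f p + g p ≤ (1 / V ^ 2) * (‖p.2‖ ^ 2 * f p + ‖p.2‖ ^ 2 * g p) := by
          rw [← mul_add, ← mul_assoc]
          have : 1 ≤ 1 / V ^ 2 * ‖p.2‖ ^ 2 := by
            rw [div_mul_eq_mul_div, one_mul, le_div_iff₀ (by positivity), one_mul]
            gcongr
          nlinarith
        linarith
  have I := integral_mono (hf.integrable.sub hg.integrable).abs (i1234.add i5) pw
  refine I.trans (le_of_eq ?_)
  have e := integral_add i1234 i5
  simp only [Pi.add_apply] at e ⊢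
  rw [e, integral_add i123 i4, integral_add i12 i3, integral_add i1 i2, integral_indicator_const _ mQ,
    integral_const_mul, integral_const_mul, integral_const_mul, integral_add hf.cas_int hg.cas_int,
    integral_add cf.integrable cg.integrable, integral_add hf.kin_int hg.kin_int, cf.mass, cg.mass]
  unfold Casimir Ekin
  rw [smul_eq_mul]
  ring

lemma L1_cauchy (h : IsPhi Φ Φ' k k') (hM : 0 < M) (hMB : M ≤ B) {g : ℕ → R3 × R3 → ℝ} (hg : TightSeq Φ M B g)
    (hD : ∀ η > 0, ∃ J, ∀ i ≥ J, ∀ j ≥ J,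
      |Db (fun x => spatialDensity (g i) x - spatialDensity (g j) x)
        (fun x => spatialDensity (g i) x - spatialDensity (g j) x)| ≤ η) :
    ∀ ε > 0, ∃ J, ∀ i ≥ J, ∀ j ≥ J, ∫ p, |g i p - g j p| ≤ ε := by
  intro ε hε
  have hB : 0 < B := hM.trans_le hMB
  have hkin : ∀ j, Ekin (g j) ≤ B := fun j => by
    have := hg.pp j; have := Cas_nonneg h (hg.mem j); unfold PP at *; linarith
  have hcas : ∀ j, Casimir Φ (g j) ≤ B := fun j => by
    have := hg.pp j; have := Ekin_nonneg (hg.mem j); unfold PP at *; linarith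
  set θ := ε / (10 * B) with hθ
  have hθ0 : 0 < θ := by positivity
  obtain ⟨K, hK, hpw⟩ := pw_bound h hθ0
  obtain ⟨R, hR⟩ := hg.tight (ε / 10) (by positivity)
  set V := Real.sqrt (20 * B / ε) with hV
  have hV0 : 0 < V := Real.sqrt_pos.2 (by positivity)
  have hV2 : V ^ 2 = 20 * B / ε := Real.sq_sqrt (by positivity)
  set q := volume.real (Metric.ball (0:R3) R ×ˢ Metric.ball (0:R3) V) with hq
  have hq0 : 0 ≤ q := measureReal_nonneg
  set η := ε / (5 * (q + 1)) with hη
  have hη0 : 0 < η := by positivity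
  obtain ⟨c, hc, hpw⟩ := hpw η hη0
  have hKc : 0 < K / c := by positivity
  set ζ := ε / (5 * (K / c)) with hζ
  have hζ0 : 0 < ζ := by positivity
  obtain ⟨J1, hJ1⟩ := hD ζ hζ0
  obtain ⟨J2, hJ2⟩ := eventually_atTop.1 (hR.and (hg.lim.eventually_le_const (show hinf Φ M < hinf Φ M + ζ / 2 by linarith)))
  refine ⟨max J1 J2, fun i hi j hj => ?_⟩
  have d := hJ1 i ((le_max_left _ _).trans hi) j ((le_max_left _ _).trans hj)
  obtain ⟨ri, li⟩ := hJ2 i ((le_max_right _ _).trans hi)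
  obtain ⟨rj, lj⟩ := hJ2 j ((le_max_right _ _).trans hj)
  have gb := gap_bound h (hg.mem i) (hg.mem j)
  have L := L1_bound h (hg.mem i) (hg.mem j) (R := R) hV0 hη0 hθ0 hpw hKc.le
  have b1 : η * q ≤ ε / 5 := by
    rw [hη, div_mul_eq_mul_div, div_le_div_iff₀ (by positivity) (by norm_num)]
    nlinarith
  have b2 : K / c * (∫ p, GG Φ (g i p) (g j p)) ≤ ε / 5 := by
    have : K / c * ζ = ε / 5 := by rw [hζ]; field_simp
    rw [← this]
    gcongr
    linarith
  have b3 : θ * (Casimir Φ (g i) + Casimir Φ (g j)) ≤ ε / 5 := by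
    have : θ * (B + B) = ε / 5 := by rw [hθ]; field_simp; norm_num
    rw [← this]
    gcongr
    · exact hcas i
    · exact hcas j
  have b5 : (2 / V ^ 2) * (Ekin (g i) + Ekin (g j)) ≤ ε / 5 := by
    have : (2 / V ^ 2) * (B + B) = ε / 5 := by rw [hV2]; field_simp; norm_num
    rw [← this]
    gcongr
    · exact hkin i
    · exact hkin j
  linarith
end gap

section fin
variable {Φ Φ' : ℝ → ℝ} {k k' : ℝ} {M B : ℝ}

lemma L1_limit {g : ℕ → R3 × R3 → ℝ} (hi : ∀ j, Integrable (g j)) (h0 : ∀ j p, 0 ≤ g j p)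
    (hc : ∀ ε > 0, ∃ J, ∀ i ≥ J, ∀ j ≥ J, ∫ p, |g i p - g j p| ≤ ε) :
    ∃ f : R3 × R3 → ℝ, Integrable f ∧ (∀ p, 0 ≤ f p) ∧ Tendsto (fun j => ∫ p, |g j p - f p|) atTop (𝓝 0) ∧
      ∃ ns : ℕ → ℕ, StrictMono ns ∧ ∀ᵐ p, Tendsto (fun j => g (ns j) p) atTop (𝓝 (f p)) := by
  set H : ℕ → (R3 × R3 →₁[volume] ℝ) := fun j => (hi j).toL1 (g j) with hH
  have hd : ∀ i j, ‖H i - H j‖ = ∫ p, |g i p - g j p| := by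
    intro i j
    rw [L1.norm_eq_integral_norm]
    apply integral_congr_ae
    filter_upwards [Lp.coeFn_sub (H i) (H j), (hi i).coeFn_toL1, (hi j).coeFn_toL1] with p h1 h2 h3
    rw [h1, Pi.sub_apply, h2, h3, Real.norm_eq_abs]
  have hcs : CauchySeq H := by
    rw [Metric.cauchySeq_iff]
    intro ε hε
    obtain ⟨J, hJ⟩ := hc (ε / 2) (by positivity)
    refine ⟨J, fun i hi j hj => ?_⟩
    rw [dist_eq_norm, hd]
    have := hJ i hi j hj
    linarith
  obtain ⟨F, hF⟩ := cauchySeq_tendsto_of_complete hcs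
  have hFi : Integrable F := L1.integrable_coeFn F
  obtain ⟨ns, hns, hae⟩ := (tendstoInMeasure_of_tendsto_Lp hF).exists_seq_tendsto_ae
  refine ⟨fun p => max (F p) 0, hFi.pos_part, fun p => le_max_right _ _, ?_, ns, hns, ?_⟩
  · have h1 : Tendsto (fun j => ‖H j - F‖) atTop (𝓝 0) := tendsto_iff_norm_sub_tendsto_zero.1 hF
    refine squeeze_zero (fun j => integral_nonneg fun p => abs_nonneg _) (fun j => ?_) h1
    rw [L1.norm_eq_integral_norm]
    refine integral_mono_ae ((hi j).sub hFi.pos_part).abs (L1.integrable_coeFn _).norm ?_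
    filter_upwards [Lp.coeFn_sub (H j) F, (hi j).coeFn_toL1] with p h1 h2
    rw [h1, Pi.sub_apply, h2, Real.norm_eq_abs]
    have := abs_max_sub_max_le_abs (g j p) (F p) 0
    rwa [max_eq_left (h0 j p)] at this
  · have hall : ∀ᵐ p, ∀ j, H j p = g j p := ae_all_iff.2 fun j => (hi j).coeFn_toL1
    filter_upwards [hae, hall] with p h1 h2
    simp_rw [h2] at h1
    have h3 := h1.max (tendsto_const_nhds (x := (0:ℝ)))
    refine h3.congr fun j => max_eq_left (h0 _ p)

def WW (Φ : ℝ → ℝ) (f : R3 × R3 → ℝ) (p : R3 × R3) : ℝ := (1/2) * (‖p.2‖ ^ 2 * f p) + Φ (f p)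

lemma WW_int {f : R3 × R3 → ℝ} (hf : MemFM Φ M f) : Integrable (WW Φ f) :=
  (hf.kin_int.const_mul _).add hf.cas_int

lemma WW_eq {f : R3 × R3 → ℝ} (hk : Integrable (fun p : R3 × R3 => ‖p.2‖ ^ 2 * f p))
    (hc : Integrable (fun p => Φ (f p))) : ∫ p, WW Φ f p = PP Φ f := by
  unfold WW PP Ekin Casimir
  rw [integral_add (hk.const_mul _) hc, integral_const_mul]

lemma WW_nonneg (h : IsPhi Φ Φ' k k') {f : R3 × R3 → ℝ} (hf : ∀ p, 0 ≤ f p) (p : R3 × R3) : 0 ≤ WW Φ f p := by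
  have := hf p
  have := h.nonneg _ (hf p)
  unfold WW; positivity

lemma WW_aesm (h : IsPhi Φ Φ' k k') {f : R3 × R3 → ℝ} (hf : ∀ p, 0 ≤ f p) (hi : AEStronglyMeasurable f) :
    AEStronglyMeasurable (WW Φ f) := by
  have h1 : AEStronglyMeasurable (fun p : R3 × R3 => ‖p.2‖ ^ 2) := Measurable.aestronglyMeasurable (by fun_prop)
  exact ((h1.mul hi).const_mul _).add (phi_aesm h hf hi)

lemma fatou (h : IsPhi Φ Φ' k k') {g : ℕ → R3 × R3 → ℝ} (hg : ∀ j, MemFM Φ M (g j)) {f : R3 × R3 → ℝ}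
    (hf : ∀ p, 0 ≤ f p) (hi : Integrable f) (hlim : ∀ᵐ p, Tendsto (fun j => g j p) atTop (𝓝 (f p))) {L : ℝ}
    (hL0 : 0 ≤ L) (hL : ∀ᶠ j in atTop, PP Φ (g j) ≤ L) :
    Integrable (WW Φ f) ∧ ∫ p, WW Φ f p ≤ L := by
  have hm := WW_aesm h hf hi.1
  have key : ∫⁻ p, ENNReal.ofReal (WW Φ f p) ≤ ENNReal.ofReal L := by
    calc ∫⁻ p, ENNReal.ofReal (WW Φ f p) = ∫⁻ p, liminf (fun j => ENNReal.ofReal (WW Φ (g j) p)) atTop := by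
          apply lintegral_congr_ae
          filter_upwards [hlim] with p hp
          refine (Tendsto.liminf_eq ?_).symm
          apply ENNReal.tendsto_ofReal
          unfold WW
          refine (((hp.const_mul _).const_mul _)).add ?_
          have h1 := ((phi_cont_max h).tendsto (f p)).comp hp
          rw [max_eq_left (hf p)] at h1
          refine h1.congr fun j => ?_
          simp [max_eq_left ((hg j).nonneg p)]
      _ ≤ liminf (fun j => ∫⁻ p, ENNReal.ofReal (WW Φ (g j) p)) atTop :=
          lintegral_liminf_le' fun j => (WW_int (hg j)).1.aemeasurable.ennreal_ofReal
      _ ≤ ENNReal.ofReal L := by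
          refine liminf_le_of_frequently_le' (Eventually.frequently ?_)
          filter_upwards [hL] with j hj
          rw [← ofReal_integral_eq_lintegral_ofReal (WW_int (hg j))
            (Eventually.of_forall (WW_nonneg h (hg j).nonneg)), WW_eq (hg j).kin_int (hg j).cas_int]
          exact ENNReal.ofReal_le_ofReal hj
  have hIntg : Integrable (WW Φ f) := by
    refine ⟨hm, ?_⟩
    rw [hasFiniteIntegral_iff_ofReal (Eventually.of_forall (WW_nonneg h hf))]
    exact key.trans_lt ENNReal.ofReal_lt_top
  refine ⟨hIntg, ?_⟩
  rw [← ofReal_integral_eq_lintegral_ofReal hIntg (Eventually.of_forall (WW_nonneg h hf))] at key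
  exact (ENNReal.ofReal_le_ofReal_iff hL0).1 key

lemma fin_mem (h : IsPhi Φ Φ' k k') {f : R3 × R3 → ℝ} (hf : ∀ p, 0 ≤ f p) (hi : Integrable f) (hm : ∫ p, f p = M)
    (hw : Integrable (WW Φ f)) : MemFM Φ M f := by
  have h1 : AEStronglyMeasurable (fun p : R3 × R3 => ‖p.2‖ ^ 2) := Measurable.aestronglyMeasurable (by fun_prop)
  refine ⟨hf, hi, hm, ?_, ?_⟩
  · refine (hw.const_mul 2).mono' (h1.mul hi.1) (Eventually.of_forall fun p => ?_)
    have a1 := hf p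
    have a2 := h.nonneg _ (hf p)
    rw [Real.norm_of_nonneg (by positivity)]
    unfold WW; linarith
  · refine hw.mono' (phi_aesm h hf hi.1) (Eventually.of_forall fun p => ?_)
    have a1 := hf p
    have a2 := h.nonneg _ (hf p)
    rw [Real.norm_of_nonneg a2]
    have : 0 ≤ ‖p.2‖ ^ 2 * f p := by positivity
    unfold WW; linarith

lemma N1_diff {f g : R3 × R3 → ℝ} (hf : MemFM Φ M f) (hg : MemFM Φ M g) :
    N1 (fun x => spatialDensity f x - spatialDensity g x) ≤ ∫ p, |f p - g p| := by
  have hi : Integrable (fun p => |f p - g p|) := (hf.integrable.sub hg.integrable).abs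
  have hi' := hi
  rw [Measure.volume_eq_prod] at hi'
  rw [Measure.volume_eq_prod, integral_prod _ hi']
  unfold N1
  refine integral_mono_ae ((rho_int hf).sub (rho_int hg)).abs hi'.integral_prod_left ?_
  filter_upwards [slice_int hf.integrable, slice_int hg.integrable] with x i1 i2
  unfold spatialDensity
  rw [← integral_sub i1 i2]
  exact abs_integral_le_integral_abs

lemma final (h : IsPhi Φ Φ' k k') (hM : 0 < M) (hMB : M ≤ B) {g : ℕ → R3 × R3 → ℝ} (hg : TightSeq Φ M B g)
    (hc : ∀ ε > 0, ∃ J, ∀ i ≥ J, ∀ j ≥ J, ∫ p, |g i p - g j p| ≤ ε) :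
    ∃ f, MemFM Φ M f ∧ Tendsto (fun j => Dpair (fun x => spatialDensity (g j) x - spatialDensity f x)) atTop (𝓝 0) ∧
      HC Φ f = hinf Φ M := by
  obtain ⟨f, hfi, hf0, hL1, ns, hns, hae⟩ := L1_limit (fun j => (hg.mem j).integrable) (fun j => (hg.mem j).nonneg) hc
  have hB : 0 < B := hM.trans_le hMB
  have hgn := hg.comp hns
  have hmass : ∫ p, f p = M := by
    have h1 : ∀ j, |M - ∫ p, f p| ≤ ∫ p, |g j p - f p| := by
      intro j
      rw [← (hg.mem j).mass, ← integral_sub (hg.mem j).integrable hfi]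
      exact abs_integral_le_integral_abs
    have h2 := ge_of_tendsto' hL1 h1
    have := abs_nonpos_iff.1 h2
    linarith
  obtain ⟨hw, -⟩ := fatou h hgn.mem hf0 hfi hae hB.le (Eventually.of_forall hgn.pp)
  have hf := fin_mem h hf0 hfi hmass hw
  have gf := rho_good h hf
  have c := c0_pos
  set B' := 4 * (B + XX (spatialDensity f)) with hB'
  have hX0 := XX_nonneg (spatialDensity f)
  have hB'0 : 0 < B' := by positivity
  set K := B' * (2 * c0 + 1 + B') with hK
  have hK0 : 0 < K := by positivity
  have hN : Tendsto (fun j => N1 (fun x => spatialDensity (g j) x - spatialDensity f x)) atTop (𝓝 0) :=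
    squeeze_zero (fun j => N1_nonneg _) (fun j => N1_diff (hg.mem j) hf) hL1
  have small : ∀ ε > 0, ∀ᶠ j in atTop, ∀ u, Good u → XX u ≤ B' → N1 u ≤ B' →
      |Db u (fun x => spatialDensity (g j) x - spatialDensity f x)| ≤ ε := by
    intro ε hε
    have hτ : 0 < ε / K := by positivity
    filter_upwards [hN.eventually_le_const (show 0 < (ε / K) ^ 3 by positivity)] with j hj u gu xu nu
    have gj := rho_good h (hg.mem j)
    have xs := XX_sub gj gf
    have := hg.xx j
    have s := Db_small gu (gj.sub gf) hB'0.le hτ xu (by linarith) hj nu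
    rwa [show ε / K * (B' * (2 * c0 + 1 + B')) = ε by rw [← hK]; field_simp] at s
  have hD1 : Tendsto (fun j => Dpair (fun x => spatialDensity (g j) x - spatialDensity f x)) atTop (𝓝 0) := by
    rw [Metric.tendsto_nhds]
    intro ε hε
    filter_upwards [small (ε / 2) (by positivity)] with j hj
    have gj := rho_good h (hg.mem j)
    rw [Dpair_eq (gj.sub gf), Real.dist_eq, sub_zero]
    have xs := XX_sub gj gf
    have := hg.xx j
    have ns := N1_sub gj gf
    rw [rho_N1 (hg.mem j), rho_N1 hf] at ns
    have := hj _ (gj.sub gf) (by linarith) (by linarith)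
    linarith
  refine ⟨f, hf, hD1, le_antisymm ?_ (hinf_le h hf)⟩
  set D0 := Db (spatialDensity f) (spatialDensity f) with hD0
  have hPP : PP Φ f ≤ hinf Φ M + (1/2) * D0 := by
    refine le_of_forall_pos_le_add fun ε hε => ?_
    have ev : ∀ᶠ j in atTop, PP Φ (g (ns j)) ≤ hinf Φ M + (1/2) * D0 + ε := by
      filter_upwards [hns.tendsto_atTop.eventually (small ε hε),
        hgn.lim.eventually_le_const (show hinf Φ M < hinf Φ M + ε / 2 by linarith)] with j h1 h2
      have hj := hg.mem (ns j)
      have gj := rho_good h hj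
      rw [HC_eq h hj] at h2
      have xs := XX_add gj gf
      have := hg.xx (ns j)
      have ns' := N1_add gj gf
      rw [rho_N1 hj, rho_N1 hf] at ns'
      have s := h1 _ (gj.add gf) (by linarith) (by linarith)
      have e1 := Db_add_left gj gf (gj.sub gf)
      have e2 := Db_sub_left gj gf gj
      have e3 := Db_sub_left gj gf gf
      rw [Db_symm (spatialDensity (g (ns j))) (fun _ => _), Db_symm (spatialDensity f) (fun _ => _), e2, e3,
        Db_symm (spatialDensity f) (spatialDensity (g (ns j)))] at e1
      have := le_abs_self (Db (fun x => spatialDensity (g (ns j)) x + spatialDensity f x)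
        (fun x => spatialDensity (g (ns j)) x - spatialDensity f x))
      linarith
    have hL0 : 0 ≤ hinf Φ M + (1/2) * D0 + ε := by
      obtain ⟨j, hj⟩ := ev.exists
      exact (PP_nonneg h (hg.mem (ns j))).trans hj
    have := (fatou h hgn.mem hf0 hfi hae hL0 ev).2
    rwa [WW_eq hf.kin_int hf.cas_int] at this
  rw [HC_eq h hf]
  linarith
end fin

/-- existence of a minimizer of the energy-Casimir functional along
minimizing sequences, up to subsequences and spatial shifts, with strong `L²`
convergence of the induced gravitational fields. -/
theorem energyCasimir_minimizing_sequence
    (Φ Φ' : ℝ → ℝ) (k k' : ℝ) (hΦ : IsPhi Φ Φ' k k') (M : ℝ) (hM : 0 < M)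
    (f : ℕ → (R3 × R3 → ℝ)) (hfM : ∀ j, MemFM Φ M (f j))
    (hmin : Tendsto (fun j => HC Φ (f j)) atTop (𝓝 (sInf (HC Φ '' FMset Φ M)))) :
    ∃ f₀ : R3 × R3 → ℝ, MemFM Φ M f₀ ∧
      (∃ φ : ℕ → ℕ, StrictMono φ ∧ ∃ a : ℕ → R3,
        Tendsto
          (fun j => Dpair (fun x => spatialDensity (f (φ j)) (x + a j) - spatialDensity f₀ x))
          atTop (𝓝 0)) ∧
      HC Φ f₀ = sInf (HC Φ '' FMset Φ M) := by
  obtain ⟨B, hMB, a, hT⟩ := exists_tight hΦ hM hfM hmin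
  obtain ⟨φ, hφ, hD⟩ := D_cauchy hΦ hM hMB hT
  have hT' := hT.comp hφ
  obtain ⟨f₀, hf₀, hlim, hH⟩ := final hΦ hM hMB hT' (L1_cauchy hΦ hM hMB hT' hD)
  exact ⟨f₀, hf₀, ⟨φ, hφ, fun j => a (φ j), hlim⟩, hH⟩
end
end
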